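/- arXiv:1801.09852 — 5 statements merged into one kernel-verified Lean document; each statement's English description precedes it below -/
import Mathlib

section
/- Let A be a finitely generated algebra over a field k, let V ⊆ U be sets of variables, let I be a finitely generated ideal of A[V], and let J = I·A[U] be its extension. Then codim_{A[V]}(I) = codim_{A[U]}(J). -/
/-- The codimension (height) of an ideal. -/
noncomputable def Ideal.codim {R : Type*} [CommRing R] (I : Ideal R) : ℕ∞ :=
  ⨅ p ∈ {p : PrimeSpectrum R | I ≤ p.asIdeal}, Order.height p

section Aux
open MvPolynomial

theorem aux_comap_map {A σ τ : Type*} [CommRing A] (f : σ → τ) (hf : Function.Injective f)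
    (p : Ideal (MvPolynomial σ A)) {x : MvPolynomial σ A}
    (hx : rename (R := A) f x ∈ p.map (rename (R := A) f)) : x ∈ p := by
  have h := Ideal.mem_map_of_mem (killCompl (R := A) hf) hx
  rw [Ideal.map_mapₐ, killCompl_comp_rename, killCompl_rename_app] at h
  have h2 := Ideal.map_id p
  exact h2 ▸ h

theorem aux_prime_C {B ι : Type*} [CommRing B] (p : Ideal B) [p.IsPrime] :
    (p.map (C : B →+* MvPolynomial ι B)).IsPrime := by
  have h := MvPolynomial.ker_map (σ := ι) (Ideal.Quotient.mk p)
  rw [Ideal.mk_ker] at h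
  rw [← h]
  exact RingHom.ker_isPrime _

theorem aux_prime {A σ τ : Type*} [CommRing A] (f : σ → τ) (hf : Function.Injective f)
    (p : Ideal (MvPolynomial σ A)) [p.IsPrime] : (p.map (rename (R := A) f)).IsPrime := by
  classical
  let e : ((Set.range f)ᶜ : Set τ) ⊕ σ ≃ τ :=
    (Equiv.sumComm _ _).trans
      (((Equiv.ofInjective f hf).sumCongr (Equiv.refl _)).trans (Equiv.Set.sumCompl (Set.range f)))
  have he : ∀ x, e (Sum.inr x) = f x := fun x => by simp [e]
  let E : MvPolynomial ((Set.range f)ᶜ : Set τ) (MvPolynomial σ A) ≃+* MvPolynomial τ A :=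
    ((sumAlgEquiv A _ _).symm.trans (renameEquiv A e)).toRingEquiv
  have hE : (rename (R := A) f : MvPolynomial σ A →ₐ[A] MvPolynomial τ A).toRingHom
      = E.toRingHom.comp C := by
    apply MvPolynomial.ringHom_ext
    · intro r; simp [E]
    · intro i; simp [E, he]
  have h1 : p.map (rename (R := A) f) = (p.map (C : _ →+* MvPolynomial ((Set.range f)ᶜ : Set τ) (MvPolynomial σ A))).map E.toRingHom := by
    rw [Ideal.map_map, ← hE]; rfl
  rw [h1]
  have := aux_prime_C (ι := ((Set.range f)ᶜ : Set τ)) p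
  exact Ideal.map_isPrime_of_equiv E

theorem aux_height_fin {A σ τ : Type*} [CommRing A] [IsNoetherianRing A] [Finite σ] [Finite τ]
    (f : σ → τ) (hf : Function.Injective f)
    (p : Ideal (MvPolynomial σ A)) [p.IsPrime] :
    (p.map (rename (R := A) f)).height ≤ p.height := by
  classical
  have := aux_prime f hf p
  obtain ⟨s, hs, hc⟩ := p.exists_finset_card_eq_height_of_isNoetherianRing
  rw [← hc]
  have : p.map (rename (R := A) f) ∈
      (Ideal.span ((s.image (rename (R := A) f) : Finset _) : Set (MvPolynomial τ A))).minimalPrimes := by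
    have hsp : Ideal.span ((s.image (rename (R := A) f) : Finset _) : Set (MvPolynomial τ A))
        = (Ideal.span (s : Set _)).map (rename (R := A) f) := by
      rw [Ideal.map_span, Finset.coe_image]
    rw [hsp]
    refine ⟨⟨this, Ideal.map_mono hs.1.2⟩, ?_⟩
    rintro q ⟨hq, hle⟩ hqp
    have hq' := hq.comap (rename (R := A) f)
    refine Ideal.map_le_iff_le_comap.2 (hs.2 ⟨hq', Ideal.map_le_iff_le_comap.1 hle⟩ ?_)
    intro x hx
    exact aux_comap_map f hf p (hqp hx)
  refine (Ideal.height_le_card_of_mem_minimalPrimes_span_finset this).trans ?_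
  exact_mod_cast Finset.card_image_le

theorem aux_height {A σ τ : Type*} [CommRing A] [IsNoetherianRing A] [Finite σ]
    (f : σ → τ) (hf : Function.Injective f)
    (p : PrimeSpectrum (MvPolynomial σ A)) (q : PrimeSpectrum (MvPolynomial τ A))
    (hq : q.asIdeal = p.asIdeal.map (rename (R := A) f)) :
    Order.height q ≤ Order.height p := by
  classical
  refine Order.height_le fun l hl => ?_
  have hstep : ∀ i : Fin l.length, ∃ x, x ∈ (l i.succ).asIdeal ∧ x ∉ (l i.castSucc).asIdeal := by
    intro i
    have h := l.step i
    exact SetLike.exists_of_lt (show (l i.castSucc).asIdeal < (l i.succ).asIdeal from h)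
  choose x hx hx' using hstep
  have := Fintype.ofFinite σ
  let s : Finset τ := Finset.univ.image f ∪ Finset.univ.biUnion fun i => (x i).vars
  have hxs : ∀ i, ∃ y, rename (R := A) ((↑) : s → τ) y = x i := by
    intro i
    have := exists_rename_eq_of_vars_subset_range (x i) ((↑) : s → τ) Subtype.val_injective ?_
    · exact this
    · intro v hv
      rw [Subtype.range_coe]
      exact Finset.mem_union_right _ (Finset.mem_biUnion.2 ⟨i, Finset.mem_univ _, hv⟩)
  choose y hy using hxs
  let g : σ → s := fun a => ⟨f a, by simp [s]⟩
  have hg : Function.Injective g := fun a b h => hf (congrArg Subtype.val h)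
  let χ : MvPolynomial s A →+* MvPolynomial τ A := (rename (R := A) ((↑) : s → τ)).toRingHom
  let l' : LTSeries (PrimeSpectrum (MvPolynomial s A)) :=
    { length := l.length
      toFun := fun i => PrimeSpectrum.comap χ (l i)
      step := fun i => by
        have h : (PrimeSpectrum.comap χ (l i.castSucc)).asIdeal
            < (PrimeSpectrum.comap χ (l i.succ)).asIdeal := by
          refine SetLike.lt_iff_le_and_exists.2 ⟨?_, y i, ?_, ?_⟩
          · exact Ideal.comap_mono (l.step i).le
          · change rename (R := A) ((↑) : s → τ) (y i) ∈ (l i.succ).asIdeal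
            rw [hy]; exact hx i
          · change rename (R := A) ((↑) : s → τ) (y i) ∉ (l i.castSucc).asIdeal
            rw [hy]; exact hx' i
        exact h }
  have hP := aux_prime g hg p.asIdeal
  let P : PrimeSpectrum (MvPolynomial s A) := ⟨p.asIdeal.map (rename (R := A) g), hP⟩
  have hlast : l'.last ≤ P := by
    intro z hz
    have hz' : rename (R := A) ((↑) : s → τ) z ∈ l.last.asIdeal := hz
    rw [hl, hq] at hz'
    refine aux_comap_map ((↑) : s → τ) Subtype.val_injective _ ?_
    rw [Ideal.map_mapₐ]
    have : (rename (R := A) ((↑) : s → τ)).comp (rename g) = rename f := by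
      ext; simp [g]
    rw [this]; exact hz'
  have h1 : (l.length : ℕ∞) ≤ Order.height P := Order.length_le_height hlast
  refine h1.trans ?_
  rw [← PrimeSpectrum.height_eq_orderHeight, ← PrimeSpectrum.height_eq_orderHeight]
  exact aux_height_fin g hg p.asIdeal

theorem aux_height_ge {A σ τ : Type*} [CommRing A]
    (f : σ → τ) (hf : Function.Injective f)
    (p : PrimeSpectrum (MvPolynomial σ A)) (q : PrimeSpectrum (MvPolynomial τ A))
    (hq : p.asIdeal.map (rename (R := A) f) ≤ q.asIdeal) :
    Order.height p ≤ Order.height q := by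
  let F : PrimeSpectrum (MvPolynomial σ A) → PrimeSpectrum (MvPolynomial τ A) :=
    fun r => ⟨r.asIdeal.map (rename (R := A) f), aux_prime f hf r.asIdeal⟩
  have hF : StrictMono F := by
    intro a b hab
    have h : (F a).asIdeal < (F b).asIdeal := by
      obtain ⟨hle, z, hz, hz'⟩ := SetLike.lt_iff_le_and_exists.1 (show a.asIdeal < b.asIdeal from hab)
      exact SetLike.lt_iff_le_and_exists.2 ⟨Ideal.map_mono hle, _, Ideal.mem_map_of_mem _ hz,
        fun h => hz' (aux_comap_map f hf _ h)⟩
    exact h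
  exact (Order.height_le_height_apply_of_strictMono F hF p).trans
    (Order.height_mono (show F p ≤ q from hq))

theorem aux_codim {A σ τ : Type*} [CommRing A] [IsNoetherianRing A] [Finite σ]
    (f : σ → τ) (hf : Function.Injective f) (I : Ideal (MvPolynomial σ A)) :
    I.codim = (I.map (rename (R := A) f)).codim := by
  apply le_antisymm
  · refine le_iInf₂ fun q hq => ?_
    refine (iInf₂_le (PrimeSpectrum.comap (rename (R := A) f).toRingHom q) ?_).trans
      (aux_height_ge f hf _ q ?_)
    · exact Ideal.map_le_iff_le_comap.1 hq
    · exact Ideal.map_comap_le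
  · refine le_iInf₂ fun p hp => ?_
    exact (iInf₂_le (⟨_, aux_prime f hf p.asIdeal⟩ : PrimeSpectrum (MvPolynomial τ A))
      (Ideal.map_mono hp)).trans (aux_height f hf p _ rfl)

end Aux

theorem stmt9 {k A : Type*} [Field k] [CommRing A] [Algebra k A]
    [Algebra.FiniteType k A] (U : Type*) (V : Set U)
    (I : Ideal (MvPolynomial V A)) (hI : I.FG)
    (J : Ideal (MvPolynomial U A))
    (hJ : J = I.map (MvPolynomial.rename ((↑) : V → U) :
      MvPolynomial V A →ₐ[A] MvPolynomial U A)) :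
    I.codim = J.codim := by
  classical
  have : IsNoetherianRing A := Algebra.FiniteType.isNoetherianRing k A
  obtain ⟨S, hS⟩ := hI
  let s : Finset V := S.biUnion fun x => x.vars
  let I0 := I.comap (MvPolynomial.rename (R := A) ((↑) : s → V))
  have hI0 : I0.map (MvPolynomial.rename (R := A) ((↑) : s → V)) = I := by
    refine le_antisymm Ideal.map_comap_le ?_
    conv_lhs => rw [← hS]
    refine Ideal.span_le.2 fun x hx => ?_
    obtain ⟨y, hy⟩ := MvPolynomial.exists_rename_eq_of_vars_subset_range x ((↑) : s → V)
      Subtype.val_injective (by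
        intro v hv
        rw [Subtype.range_coe]
        exact Finset.mem_biUnion.2 ⟨x, hx, hv⟩)
    rw [← hy]
    refine Ideal.mem_map_of_mem _ ?_
    change MvPolynomial.rename (R := A) ((↑) : s → V) y ∈ I
    rw [hy, ← hS]
    exact Ideal.subset_span hx
  have h1 := aux_codim (A := A) ((↑) : s → V) Subtype.val_injective I0
  have h2 := aux_codim (A := A) (fun a : s => ((a : V) : U))
    (Subtype.val_injective.comp Subtype.val_injective) I0
  have h3 : I0.map (MvPolynomial.rename (R := A) (fun a : s => ((a : V) : U))) = J := by
    rw [hJ, ← hI0, Ideal.map_mapₐ]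
    congr 1
    ext; simp
  rw [hI0] at h1
  rw [h3] at h2
  rw [← h1, h2]
end

section
/- Let A be a finitely generated k-algebra, U a set, and J a finitely generated ideal of A[U] containing a nonzerodivisor f. Then the codimension of the image of J in A[U]/(f) equals codim_{A[U]}(J) − 1. -/
open MvPolynomial in
lemma aux_flat {A U : Type*} [CommRing A] (V : Set U) :
    (rename (R := A) ((↑) : V → U)).toRingHom.Flat := by
  classical
  let e : (↑Vᶜ ⊕ ↑V) ≃ U := (Equiv.sumComm _ _).trans (Equiv.Set.sumCompl V)
  let g : MvPolynomial ↑Vᶜ (MvPolynomial V A) ≃ₐ[A] MvPolynomial U A :=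
    (sumAlgEquiv A ↑Vᶜ ↑V).symm.trans (renameEquiv A e)
  have h1 : (C : MvPolynomial V A →+* MvPolynomial ↑Vᶜ (MvPolynomial V A)).Flat := by
    rw [← MvPolynomial.algebraMap_eq, RingHom.flat_algebraMap_iff]
    infer_instance
  have h2 : (g.toRingEquiv.toRingHom).Flat := RingHom.Flat.of_bijective g.bijective
  have h3 := h1.comp h2
  convert h3 using 1
  apply MvPolynomial.ringHom_ext
  · intro r
    simp [g]
  · intro i
    simp [g, e]

lemma aux_comap_strictMono {R : Type*} [CommRing R] (I : Ideal R) :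
    StrictMono (PrimeSpectrum.comap (Ideal.Quotient.mk I)) := by
  refine Monotone.strictMono_of_injective ?_
    (PrimeSpectrum.comap_injective_of_surjective _ Ideal.Quotient.mk_surjective)
  intro a b h
  exact Ideal.comap_mono h

lemma aux_mem {R : Type*} [CommRing R] (f : R) (P : PrimeSpectrum (R ⧸ Ideal.span {f})) :
    f ∈ (PrimeSpectrum.comap (Ideal.Quotient.mk (Ideal.span {f})) P).asIdeal := by
  have : Ideal.Quotient.mk (Ideal.span {f}) f = 0 :=
    Ideal.Quotient.eq_zero_iff_mem.2 (Ideal.mem_span_singleton_self f)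
  simp [this]

lemma aux_exists {R : Type*} [CommRing R] (f : R) (P : PrimeSpectrum R) (h : f ∈ P.asIdeal) :
    ∃ Q, PrimeSpectrum.comap (Ideal.Quotient.mk (Ideal.span {f})) Q = P := by
  have := range_comap_of_surjective _ (Ideal.Quotient.mk (Ideal.span {f}))
    Ideal.Quotient.mk_surjective
  have h2 : P ∈ Set.range (PrimeSpectrum.comap (Ideal.Quotient.mk (Ideal.span {f}))) := by
    rw [this]
    simpa [PrimeSpectrum.mem_zeroLocus, Ideal.span_le] using h
  exact h2

lemma aux_down {R : Type*} [CommRing R] (f : R) (P : PrimeSpectrum (R ⧸ Ideal.span {f}))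
    (l : LTSeries (PrimeSpectrum R)) (hl : f ∈ l.head.asIdeal)
    (hlast : l.last = PrimeSpectrum.comap (Ideal.Quotient.mk (Ideal.span {f})) P) :
    (l.length : ℕ∞) ≤ Order.height P := by
  have h : ∀ i, ∃ Q, PrimeSpectrum.comap (Ideal.Quotient.mk (Ideal.span {f})) Q = l i := by
    intro i
    apply aux_exists
    have : l.head ≤ l i := LTSeries.head_le l i
    exact this hl
  choose g hg using h
  have hinj := PrimeSpectrum.comap_injective_of_surjective (Ideal.Quotient.mk (Ideal.span {f}))
    Ideal.Quotient.mk_surjective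
  let L : LTSeries (PrimeSpectrum (R ⧸ Ideal.span {f})) :=
    { length := l.length
      toFun := g
      step := by
        intro i
        have h1 := l.step i
        change l _ < l _ at h1
        rw [← hg, ← hg] at h1
        change g _ < g _
        refine lt_of_le_of_ne ?_ ?_
        · intro x hx
          obtain ⟨y, rfl⟩ := Ideal.Quotient.mk_surjective x
          exact h1.le hx
        · intro h
          rw [h] at h1
          exact lt_irrefl _ h1 }
  have hL : L.last = P := by
    apply hinj
    rw [← hlast]
    exact hg _
  exact Order.length_le_height (p := L) hL.le

lemma aux_ge {R : Type*} [CommRing R] (f : R) (hf : f ∈ nonZeroDivisors R)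
    (P : PrimeSpectrum (R ⧸ Ideal.span {f})) :
    Order.height P + 1 ≤
      Order.height (PrimeSpectrum.comap (Ideal.Quotient.mk (Ideal.span {f})) P) := by
  have key : ∀ n : ℕ, (n : ℕ∞) ≤ Order.height P → ((n + 1 : ℕ) : ℕ∞) ≤
      Order.height (PrimeSpectrum.comap (Ideal.Quotient.mk (Ideal.span {f})) P) := by
    intro n hn
    obtain ⟨l, rfl, rfl⟩ := Order.exists_series_of_le_height P hn
    let L := l.map _ (aux_comap_strictMono (Ideal.span {f}))
    have hfL : f ∈ L.head.asIdeal := aux_mem f l.head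
    obtain ⟨q, hq, hqL⟩ := Ideal.exists_minimalPrimes_le (I := ⊥) (J := L.head.asIdeal) bot_le
    have hlt : (⟨q, hq.isPrime⟩ : PrimeSpectrum R) < L.head := by
      refine lt_of_le_of_ne hqL ?_
      intro h
      rw [← h] at hfL
      exact notMem_nonZeroDivisors_of_mem_mem_minimalPrimes hfL hq hf
    have := Order.length_le_height (p := L.cons _ hlt)
      (x := PrimeSpectrum.comap (Ideal.Quotient.mk (Ideal.span {f})) l.last)
      (by rw [RelSeries.last_cons]; exact le_rfl)
    simpa [L] using this
  cases h : Order.height P with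
  | top =>
    rw [h] at key
    have := ENat.eq_top_iff_forall_ge.2 fun n : ℕ =>
      le_trans (by exact_mod_cast Nat.le_succ n) (key n le_top)
    rw [this]; exact le_top
  | coe n => exact_mod_cast key n h.ge

open MvPolynomial in
lemma aux_le {A U : Type*} [CommRing A] [IsNoetherianRing A] (f : MvPolynomial U A)
    (P : PrimeSpectrum (MvPolynomial U A ⧸ Ideal.span {f})) :
    Order.height (PrimeSpectrum.comap (Ideal.Quotient.mk (Ideal.span {f})) P) ≤
      Order.height P + 1 := by
  classical
  refine ENat.forall_natCast_le_iff_le.1 ?_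
  intro n hn
  obtain ⟨l, hlast, rfl⟩ := Order.exists_series_of_le_height _ hn
  have hex : ∀ i : Fin l.length, ∃ x, x ∈ (l i.succ).asIdeal ∧ x ∉ (l i.castSucc).asIdeal := by
    intro i
    exact SetLike.exists_of_lt (l.step i)
  choose x hx1 hx2 using hex
  let V : Finset U := f.vars ∪ Finset.univ.biUnion fun i => (x i).vars
  let g := (rename (R := A) ((↑) : V → U)).toRingHom
  have hflat : g.Flat := aux_flat (V : Set U)
  obtain ⟨f0, hf0⟩ : ∃ f0, g f0 = f :=
    exists_rename_eq_of_vars_subset_range f _ Subtype.val_injective (by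
      intro a ha; simp [V]; exact Or.inl ha)
  have hx : ∀ i, ∃ y, g y = x i := fun i =>
    exists_rename_eq_of_vars_subset_range (x i) _ Subtype.val_injective (by
      intro a ha; simp [V]; exact Or.inr ⟨i, ha⟩)
  choose y hy using hx
  let l0 : LTSeries (PrimeSpectrum (MvPolynomial V A)) :=
    { length := l.length
      toFun := fun i => PrimeSpectrum.comap g (l i)
      step := by
        intro i
        change PrimeSpectrum.comap g (l _) < PrimeSpectrum.comap g (l _)
        refine lt_of_le_of_ne (Ideal.comap_mono (l.step i).le) ?_
        intro h
        have h1 : y i ∈ (PrimeSpectrum.comap g (l i.succ)).asIdeal := by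
          change g (y i) ∈ (l i.succ).asIdeal
          rw [hy]; exact hx1 i
        rw [← h] at h1
        change g (y i) ∈ (l i.castSucc).asIdeal at h1
        rw [hy] at h1
        exact hx2 i h1 }
  set q := PrimeSpectrum.comap (Ideal.Quotient.mk (Ideal.span {f})) P with hq
  have hl0last : l0.last = PrimeSpectrum.comap g q := by rw [← hlast]; rfl
  set p := PrimeSpectrum.comap g q with hp
  have hfp : f0 ∈ p.asIdeal := by
    change g f0 ∈ q.asIdeal
    rw [hf0]; exact aux_mem f P
  have h1 : (l.length : ℕ∞) ≤ Order.height p :=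
    Order.length_le_height (p := l0) hl0last.le
  obtain ⟨Q, hQ⟩ := aux_exists f0 p hfp
  have h2 := Ideal.height_le_height_add_one_of_mem hfp
  have hQ' : p.asIdeal.map (Ideal.Quotient.mk (Ideal.span {f0})) = Q.asIdeal := by
    rw [← hQ]
    exact Ideal.map_comap_of_surjective _ Ideal.Quotient.mk_surjective _
  rw [hQ', PrimeSpectrum.height_eq_orderHeight, PrimeSpectrum.height_eq_orderHeight] at h2
  have h3 := h1.trans h2
  rcases hn : l.length with _ | m
  · simp
  rw [hn] at h3
  have h4 : (m : ℕ∞) ≤ Order.height Q := by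
    push_cast at h3
    exact (ENat.add_le_add_iff_right (by simp)).1 h3
  obtain ⟨s, hs, rfl⟩ := Order.exists_series_of_le_height _ h4
  let s' := s.map _ (aux_comap_strictMono (Ideal.span {f0}))
  have hs'last : s'.last = p := by
    rw [← hQ, ← hs]; rfl
  have hmem : ∀ P ∈ s'.toList, f0 ∈ P.asIdeal := by
    intro P hP
    rw [RelSeries.mem_toList] at hP
    obtain ⟨i, rfl⟩ := hP
    exact aux_mem f0 (s i)
  let := g.toAlgebra
  have : Module.Flat (MvPolynomial V A) (MvPolynomial U A) := hflat
  have : q.asIdeal.LiesOver s'.last.asIdeal := ⟨by rw [hs'last]; rfl⟩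
  obtain ⟨L, hLlen, hLlast, hLl⟩ := Ideal.exists_ltSeries_of_hasGoingDown s' q.asIdeal
  have hLh : f ∈ L.head.asIdeal := by
    have : PrimeSpectrum.comap g L.head ∈ s'.toList := by
      rw [← hLl]
      exact List.mem_map_of_mem (f := PrimeSpectrum.comap g)
        (RelSeries.mem_toList.2 (RelSeries.head_mem L))
    have := hmem _ this
    rw [← hf0]
    exact this
  have := aux_down f P L hLh hLlast
  rw [hLlen] at this
  push_cast
  gcongr
  exact this

theorem stmt12 {k A : Type*} [Field k] [CommRing A] [Algebra k A]
    [Algebra.FiniteType k A] (U : Type*)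
    (J : Ideal (MvPolynomial U A)) (hJ : J.FG)
    (f : MvPolynomial U A) (hfJ : f ∈ J)
    (hf : f ∈ nonZeroDivisors (MvPolynomial U A)) :
    (J.map (Ideal.Quotient.mk (Ideal.span {f}))).codim = J.codim - 1 := by
  have : IsNoetherianRing A := Algebra.FiniteType.isNoetherianRing k A
  have key : J.codim = (J.map (Ideal.Quotient.mk (Ideal.span {f}))).codim + 1 := by
    unfold Ideal.codim
    rw [ENat.iInf₂_add]
    apply le_antisymm
    · refine le_iInf₂ fun P hP => ?_
      refine (iInf₂_le (PrimeSpectrum.comap (Ideal.Quotient.mk (Ideal.span {f})) P)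
        ?_).trans (aux_le f P)
      exact Ideal.map_le_iff_le_comap.1 hP
    · refine le_iInf₂ fun P hP => ?_
      obtain ⟨Q, rfl⟩ := aux_exists f P (hP hfJ)
      exact (iInf₂_le Q (Ideal.map_le_iff_le_comap.2 hP)).trans (aux_ge f hf Q)
  rw [key]
  exact (ENat.addLECancellable_of_ne_top ENat.one_ne_top).add_tsub_cancel_right.symm
end

section
/- Let A be a finitely generated k-algebra, U a set, R = A[U], S = R[y]. Let I be a finitely generated ideal of S containing a monic polynomial y^n + a_{n-1}y^{n-1} + ... + a_0 with n > 0 and a_i ∈ R. Then codim_R(R ∩ I) = codim_S(I) − 1. -/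
section Helpers

open Polynomial

/-- Going down for flat maps bounds the height of a contraction. -/
theorem aux_height_comap_le_of_flat {R S : Type*} [CommRing R] [CommRing S] (f : R →+* S)
    (hf : f.Flat) (P : PrimeSpectrum S) :
    Order.height (PrimeSpectrum.comap f P) ≤ Order.height P := by
  algebraize [f]
  apply Order.height_le
  intro l hl
  have : P.asIdeal.LiesOver l.last.asIdeal := by
    rw [hl]; exact ⟨rfl⟩
  obtain ⟨L, hL, hlast, -⟩ := Ideal.exists_ltSeries_of_hasGoingDown l P.asIdeal
  rw [← hL]
  exact Order.length_le_height hlast.le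

theorem aux_height_le_one {D : Type*} [CommRing D] [IsDomain D] (Q : Ideal D[X]) [Q.IsPrime]
    (hQ : Q.comap C = ⊥) : Q.height ≤ 1 := by
  let K := FractionRing D
  let := Polynomial.algebra D K
  have := Polynomial.isLocalization (nonZeroDivisors D) K
  have disj : Disjoint (((nonZeroDivisors D).map (C : D →+* D[X]) : Submonoid D[X]) : Set D[X])
      (Q : Set D[X]) := by
    refine Set.disjoint_left.mpr fun a ⟨b, hb, hab⟩ ha ↦ ?_
    have : b ∈ Q.comap C := by
      rw [Ideal.mem_comap, hab]; exact ha
    rw [hQ] at this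
    exact nonZeroDivisors.ne_zero hb this
  rw [← IsLocalization.height_map_of_disjoint (S := K[X]) _ Q disj]
  have hne : (Q.map (algebraMap D[X] K[X])) ≠ ⊤ :=
    (IsLocalization.isPrime_of_isPrime_disjoint _ K[X] Q ‹_› disj).ne_top
  have h := Ideal.height_le_ringKrullDim_of_ne_top hne
  rw [IsPrincipalIdealRing.ringKrullDim_eq_one _ (Polynomial.not_isField K)] at h
  exact_mod_cast h

theorem aux_noeth {R : Type*} [CommRing R] [IsNoetherianRing R] (P : PrimeSpectrum R[X]) :
    Order.height P ≤ Order.height (PrimeSpectrum.comap C P) + 1 := by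
  rw [← PrimeSpectrum.height_eq_orderHeight, ← PrimeSpectrum.height_eq_orderHeight]
  let p : Ideal R := P.asIdeal.comap C
  have : P.asIdeal.LiesOver p := ⟨rfl⟩
  refine (Ideal.height_le_height_add_of_liesOver p P.asIdeal).trans ?_
  refine add_le_add (le_refl _) ?_
  let e : (R[X] ⧸ (p.map (algebraMap R R[X]))) ≃+* (R ⧸ p)[X] :=
    (Ideal.polynomialQuotientEquivQuotientPolynomial p).symm
  have hle : p.map (algebraMap R R[X]) ≤ P.asIdeal := Ideal.map_comap_le
  set Q0 := P.asIdeal.map (Ideal.Quotient.mk (p.map (algebraMap R R[X]))) with hQ0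
  have h0 : Q0.IsPrime := Ideal.map_isPrime_of_surjective Ideal.Quotient.mk_surjective
    (by rw [Ideal.mk_ker]; exact hle)
  rw [← e.symm.height_comap]
  have : (Q0.comap e.symm).IsPrime := Ideal.comap_isPrime _ _
  apply aux_height_le_one
  rw [eq_bot_iff]
  intro x hx
  obtain ⟨r, rfl⟩ := Ideal.Quotient.mk_surjective x
  rw [Ideal.mem_comap, Ideal.mem_comap] at hx
  have h1 : e.symm (C (Ideal.Quotient.mk p r)) =
      Ideal.Quotient.mk (p.map (algebraMap R R[X])) (C r) := by
    have := Ideal.polynomialQuotientEquivQuotientPolynomial_map_mk p (C r)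
    simpa [e] using this
  have h2 : Ideal.Quotient.mk (p.map (algebraMap R R[X])) (C r) ∈ Q0 := by
    rw [← h1]; exact hx
  rw [hQ0, Ideal.mem_quotient_iff_mem hle] at h2
  exact Ideal.Quotient.eq_zero_iff_mem.mpr h2

theorem aux_flat_rename {A U : Type*} [CommRing A] (V : Set U) :
    ((MvPolynomial.rename ((↑) : V → U) : MvPolynomial V A →ₐ[A] MvPolynomial U A) :
      MvPolynomial V A →+* MvPolynomial U A).Flat := by
  classical
  let e1 : MvPolynomial (↥Vᶜ ⊕ V) A ≃ₐ[A] MvPolynomial U A :=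
    MvPolynomial.renameEquiv A ((Equiv.sumComm _ _).trans (Equiv.Set.sumCompl V))
  let e2 := MvPolynomial.sumAlgEquiv A (↥Vᶜ) V
  have h : ((MvPolynomial.rename ((↑) : V → U) : MvPolynomial V A →ₐ[A] MvPolynomial U A) :
      MvPolynomial V A →+* MvPolynomial U A) =
      ((e2.symm.trans e1).toRingEquiv : _ →+* _).comp
        (algebraMap (MvPolynomial V A) (MvPolynomial (↥Vᶜ) (MvPolynomial V A))) := by
    have h2 := MvPolynomial.sumAlgEquiv_comp_rename_inr A (↥Vᶜ) V
    refine RingHom.ext fun x => ?_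
    have h3 := DFunLike.congr_fun h2 x
    have h4 : e2.symm (algebraMap (MvPolynomial V A) (MvPolynomial (↥Vᶜ) (MvPolynomial V A)) x)
        = MvPolynomial.rename Sum.inr x := by
      rw [AlgEquiv.symm_apply_eq]
      exact h3.symm
    change MvPolynomial.rename _ x = e1 (e2.symm _)
    rw [h4]
    simp only [e1, MvPolynomial.renameEquiv_apply, MvPolynomial.rename_rename]
    rfl
  rw [h]
  exact RingHom.Flat.comp (RingHom.flat_algebraMap_iff.mpr inferInstance)
    (RingHom.Flat.of_bijective (e2.symm.trans e1).toRingEquiv.bijective)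

theorem aux_upper {A U : Type*} [CommRing A] [IsNoetherianRing A]
    (P : PrimeSpectrum (MvPolynomial U A)[X]) :
    Order.height P ≤ Order.height (PrimeSpectrum.comap C P) + 1 := by
  classical
  apply Order.height_le
  intro l hl
  have hw : ∀ i : Fin l.length, ∃ x, x ∈ (l i.succ).asIdeal ∧ x ∉ (l i.castSucc).asIdeal := by
    intro i
    have : (l i.castSucc).asIdeal < (l i.succ).asIdeal := l.step i
    exact SetLike.exists_of_lt this
  choose x hx hx' using hw
  let V0 : Finset U := Finset.univ.biUnion fun i : Fin l.length =>
    (x i).support.biUnion fun n => ((x i).coeff n).vars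
  obtain ⟨V, hV⟩ : ∃ V : Set U, V = (V0 : Set U) := ⟨_, rfl⟩
  have hfin : Finite V := by rw [hV]; exact V0.finite_toSet
  let ρ : MvPolynomial V A →+* MvPolynomial U A :=
    ((MvPolynomial.rename (Subtype.val : V → U) :
      MvPolynomial V A →ₐ[A] MvPolynomial U A) :
      MvPolynomial V A →+* MvPolynomial U A)
  have hmem : ∀ i, x i ∈ (mapRingHom ρ).range := by
    intro i
    rw [mem_map_range]
    intro n
    have : (x i).coeff n ∈ MvPolynomial.supported A V := by
      by_cases hn : n ∈ (x i).support
      · rw [MvPolynomial.mem_supported]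
        intro u hu
        simp only [hV, V0, Finset.coe_biUnion, Set.mem_iUnion]
        exact ⟨i, by simp, n, hn, hu⟩
      · rw [notMem_support_iff.mp hn]; exact zero_mem _
    rw [MvPolynomial.supported_eq_range_rename] at this
    exact this
  choose z hz using hmem
  let φ := PrimeSpectrum.comap (mapRingHom ρ)
  let l' : LTSeries (PrimeSpectrum (MvPolynomial V A)[X]) :=
    { length := l.length
      toFun := fun i => φ (l i)
      step := fun i => by
        change (φ (l i.castSucc)).asIdeal < (φ (l i.succ)).asIdeal
        refine lt_of_le_of_ne (Ideal.comap_mono (l.step i).le) fun h => hx' i ?_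
        have h1 : z i ∈ (φ (l i.succ)).asIdeal := by
          change mapRingHom ρ (z i) ∈ (l i.succ).asIdeal
          rw [hz]; exact hx i
        rw [← h] at h1
        rw [← hz]; exact h1 }
  have h1 : (l.length : ℕ∞) ≤ Order.height (φ P) := by
    have : l'.last = φ P := by rw [← hl]; rfl
    exact Order.length_le_height (p := l') this.le
  refine h1.trans ((aux_noeth _).trans ?_)
  refine add_le_add ?_ le_rfl
  have h2 : PrimeSpectrum.comap C (φ P) = PrimeSpectrum.comap ρ (PrimeSpectrum.comap C P) := by
    ext r
    change mapRingHom ρ (C r) ∈ P.asIdeal ↔ C (ρ r) ∈ P.asIdeal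
    simp
  rw [h2]
  exact aux_height_comap_le_of_flat ρ (aux_flat_rename _) _

theorem aux_lower {R : Type*} [CommRing R] (P : PrimeSpectrum R[X]) (g : R[X]) (hg : g.Monic)
    (hgP : g ∈ P.asIdeal) :
    Order.height (PrimeSpectrum.comap C P) + 1 ≤ Order.height P := by
  set p := PrimeSpectrum.comap (C : R →+* R[X]) P with hp
  have hprime : (p.asIdeal.map (C : R →+* R[X])).IsPrime := Ideal.isPrime_map_C_of_isPrime
  let Q : PrimeSpectrum R[X] := ⟨p.asIdeal.map C, hprime⟩
  have hQp : PrimeSpectrum.comap C Q = p := by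
    ext r
    change C r ∈ p.asIdeal.map C ↔ _
    rw [Ideal.mem_map_C_iff]
    constructor
    · intro h; simpa using h 0
    · intro h n
      rw [coeff_C]; split_ifs
      · exact h
      · exact zero_mem _
  have hlt : Q < P := by
    change p.asIdeal.map C < P.asIdeal
    refine lt_of_le_of_ne Ideal.map_comap_le fun h => ?_
    rw [← h, Ideal.mem_map_C_iff] at hgP
    have := hgP g.natDegree
    rw [coeff_natDegree, hg.leadingCoeff] at this
    exact p.2.ne_top ((Ideal.eq_top_iff_one _).mpr this)
  refine le_trans ?_ (Order.height_add_one_le hlt)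
  refine add_le_add ?_ le_rfl
  rw [← hQp]
  exact aux_height_comap_le_of_flat C
    (RingHom.flat_algebraMap_iff (R := R) (S := R[X]).mpr inferInstance) Q

theorem aux_lying_over {R : Type*} [CommRing R] (I : Ideal R[X]) (g : R[X]) (hg : g.Monic)
    (hgI : g ∈ I) (p : PrimeSpectrum R) (hp : I.comap C ≤ p.asIdeal) :
    ∃ P : PrimeSpectrum R[X], I ≤ P.asIdeal ∧ PrimeSpectrum.comap C P = p := by
  have hint := hg.quotient_isIntegral hgI
  have : Algebra.IsIntegral R (R[X] ⧸ I) := ⟨hint⟩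
  obtain ⟨Q, -, hQ, hQp⟩ := Ideal.exists_ideal_over_prime_of_isIntegral (S := R[X] ⧸ I) p.asIdeal ⊥
    (by
      intro r hr
      apply hp
      rw [Ideal.mem_comap, Ideal.mem_bot] at hr
      exact (Ideal.Quotient.eq_zero_iff_mem (I := I)).mp hr)
  refine ⟨PrimeSpectrum.comap (Ideal.Quotient.mk I) ⟨Q, hQ⟩, ?_, ?_⟩
  · intro f hf
    change Ideal.Quotient.mk I f ∈ Q
    rw [Ideal.Quotient.eq_zero_iff_mem.mpr hf]
    exact zero_mem _
  · ext r
    rw [← hQp]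
    rfl

end Helpers

theorem stmt13 {k A : Type*} [Field k] [CommRing A] [Algebra k A]
    [Algebra.FiniteType k A] (U : Type*)
    (I : Ideal (Polynomial (MvPolynomial U A))) (hI : I.FG)
    -- `I` contains a monic polynomial of positive degree in `y`:
    (hmonic : ∃ g ∈ I, g.Monic ∧ 0 < g.natDegree) :
    (I.comap (Polynomial.C : MvPolynomial U A →+* Polynomial (MvPolynomial U A))).codim =
      I.codim - 1 := by
  obtain ⟨g, hgI, hg, -⟩ := hmonic
  have : IsNoetherianRing A := Algebra.FiniteType.isNoetherianRing k A
  have key : I.codim = (I.comap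
      (Polynomial.C : MvPolynomial U A →+* Polynomial (MvPolynomial U A))).codim + 1 := by
    unfold Ideal.codim
    apply le_antisymm
    · simp only [ENat.iInf_add]
      refine le_iInf₂ fun p hp => ?_
      obtain ⟨P, hIP, rfl⟩ := aux_lying_over I g hg hgI p hp
      exact (iInf₂_le P hIP).trans (aux_upper P)
    · refine le_iInf₂ fun P hP => ?_
      refine le_trans ?_ (aux_lower P g hg (hP hgI))
      refine add_le_add ?_ le_rfl
      exact iInf₂_le (PrimeSpectrum.comap Polynomial.C P) (Ideal.comap_mono hP)
  rw [key]
  exact ((ENat.addLECancellable_of_ne_top ENat.one_ne_top).add_tsub_cancel_right).symm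
end

section
/- Let A be an integral domain and R = A[y_1,...,y_r] a graded polynomial ring over A with each deg(y_i) ≥ 1. If M is a finitely presented graded R-module, then there exists a nonzero f ∈ A such that the localization M_f is flat over A_f and admits a finite free resolution G over R_f whose specialization k ⊗ G at any point y ∈ Spec(A_f) with residue field k is a minimal free resolution of M_y; in particular the graded Betti numbers of M_y are independent of the point y of the dense open set Spec(A_f). -/
open MvPolynomial

/-- Data for a complex of graded free modules over the weighted-graded polynomial ring
`MvPolynomial (Fin r) B` (weights `w`): ranks, degree twists, and differentials given by
matrices.  The differential `d i` defines the map from the `(i+1)`-st free module to the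
`i`-th one via `mulVecLin`. -/
structure GradedFreeComplexData {r : ℕ} (w : Fin r → ℤ) (B : Type*) [CommRing B] where
  rk : ℕ → ℕ
  tw : (i : ℕ) → Fin (rk i) → ℤ
  d : (i : ℕ) → Matrix (Fin (rk i)) (Fin (rk (i + 1))) (MvPolynomial (Fin r) B)

namespace GradedFreeComplexData

variable {r : ℕ} {w : Fin r → ℤ} {B C : Type*} [CommRing B] [CommRing C]

/-- Base change of the complex along a homomorphism of coefficient rings. -/
noncomputable def mapCoeff (G : GradedFreeComplexData w B) (χ : B →+* C) :
    GradedFreeComplexData w C where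
  rk := G.rk
  tw := G.tw
  d := fun i => (G.d i).map (MvPolynomial.map χ)

/-- The complex has finite length. -/
def IsFinite (G : GradedFreeComplexData w B) : Prop := ∃ p, ∀ i, p < i → G.rk i = 0

/-- The differentials are homogeneous with respect to the twists. -/
def IsGraded (G : GradedFreeComplexData w B) : Prop :=
  ∀ i a b, (G.d i a b).IsWeightedHomogeneous w (G.tw (i + 1) b - G.tw i a)

/-- Minimality: every entry of every differential has vanishing constant term
(equivalently, positive degree). -/
def IsMinimal (G : GradedFreeComplexData w B) : Prop :=
  ∀ i a b, MvPolynomial.constantCoeff (G.d i a b) = 0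

/-- `G` is a free resolution of the module `M`. -/
def IsResolutionOf (G : GradedFreeComplexData w B) (M : Type*) [AddCommGroup M]
    [Module (MvPolynomial (Fin r) B) M] : Prop :=
  (∀ i, LinearMap.range (G.d (i + 1)).mulVecLin = LinearMap.ker (G.d i).mulVecLin) ∧
  Nonempty (((Fin (G.rk 0) → MvPolynomial (Fin r) B) ⧸
      LinearMap.range (G.d 0).mulVecLin) ≃ₗ[MvPolynomial (Fin r) B] M)

/-- The graded Betti numbers read off from the complex. -/
noncomputable def betti (G : GradedFreeComplexData w B) (i : ℕ) (j : ℤ) : ℕ :=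
  (Finset.univ.filter fun a : Fin (G.rk i) => G.tw i a = j).card

end GradedFreeComplexData

/-- The module with homogeneous presentation matrix `Φ`, base changed to coefficients `C`
along `χ : A →+* C`: the cokernel of the specialized presentation matrix. -/
abbrev PresentedModule {r m0 m1 : ℕ} {A C : Type*} [CommRing A] [CommRing C]
    (Φ : Matrix (Fin m0) (Fin m1) (MvPolynomial (Fin r) A)) (χ : A →+* C) :=
  (Fin m0 → MvPolynomial (Fin r) C) ⧸
    LinearMap.range (Φ.map (MvPolynomial.map χ)).mulVecLin

theorem aux_map_mulVec {m n : ℕ} {R S : Type*} [CommRing R] [CommRing S] (φ : R →+* S)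
    (M : Matrix (Fin m) (Fin n) R) (v : Fin n → R) :
    (M.map φ).mulVec (φ ∘ v) = φ ∘ (M.mulVec v) := by
  ext i
  exact (RingHom.map_mulVec φ M v i).symm

theorem aux_exact_iff {a b c : ℕ} {R : Type*} [CommRing R]
    (M : Matrix (Fin a) (Fin b) R) (N : Matrix (Fin b) (Fin c) R) :
    LinearMap.range N.mulVecLin = LinearMap.ker M.mulVecLin ↔
      (∀ u, M.mulVec (N.mulVec u) = 0) ∧ ∀ v, M.mulVec v = 0 → ∃ u, N.mulVec u = v := by
  constructor
  · intro h
    constructor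
    · intro u
      have : N.mulVecLin u ∈ LinearMap.ker M.mulVecLin := h ▸ LinearMap.mem_range_self _ u
      simpa using this
    · intro v hv
      have : v ∈ LinearMap.range N.mulVecLin := by rw [h]; simpa using hv
      simpa using this
  · rintro ⟨h1, h2⟩
    ext v
    constructor
    · rintro ⟨u, rfl⟩
      simpa using h1 u
    · intro hv
      obtain ⟨u, hu⟩ := h2 v (by simpa using hv)
      exact ⟨u, by simpa using hu⟩

theorem syz_bound (K : Type*) [Field K] : ∀ (r : ℕ) (rk : ℕ → ℕ)
    (d : ∀ i, Matrix (Fin (rk i)) (Fin (rk (i+1))) (MvPolynomial (Fin r) K)),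
    (∀ i, LinearMap.range (d (i+1)).mulVecLin = LinearMap.ker (d i).mulVecLin) →
    (∀ i a b, MvPolynomial.constantCoeff (d i a b) = 0) → ∀ i, r < i → rk i = 0 := by
  intro r
  induction r with
  | zero =>
    intro rk d hex hmin i hi
    obtain ⟨i, rfl⟩ := Nat.exists_eq_succ_of_ne_zero (Nat.ne_of_gt hi)
    have hz : ∀ i, d i = 0 := by
      intro i
      ext a b : 2
      have := hmin i a b
      rw [MvPolynomial.eq_C_of_isEmpty (d i a b)]
      rw [MvPolynomial.constantCoeff_eq] at this
      simp [this]
    by_contra hne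
    obtain ⟨_, h2⟩ := (aux_exact_iff _ _).1 (hex i)
    obtain ⟨u, hu⟩ := h2 (fun _ => 1) (by rw [hz]; simp)
    rw [hz] at hu
    have := congrFun hu ⟨0, Nat.pos_of_ne_zero hne⟩
    simp at this
  | succ r ih =>
    intro rk d hex hmin i hi
    let e := MvPolynomial.finSuccEquiv K r
    let φ : MvPolynomial (Fin (r+1)) K →+* MvPolynomial (Fin r) K :=
      (Polynomial.constantCoeff).comp (e : MvPolynomial (Fin (r+1)) K →+* _)
    have hφs : Function.Surjective φ := fun p =>
      ⟨e.symm (Polynomial.C p), by simp [φ]⟩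
    have hφk : ∀ p, φ p = 0 → ∃ q, p = MvPolynomial.X 0 * q := by
      intro p hp
      have : Polynomial.X ∣ e p := by
        rw [Polynomial.X_dvd_iff]; exact hp
      obtain ⟨q, hq⟩ := this
      refine ⟨e.symm q, e.injective ?_⟩
      rw [hq, map_mul]
      simp [e, MvPolynomial.finSuccEquiv_apply]
    have hφX : φ (MvPolynomial.X 0) = 0 := by simp [φ, e, MvPolynomial.finSuccEquiv_apply]
    have hφc : ∀ p, MvPolynomial.constantCoeff (φ p) = MvPolynomial.constantCoeff p := by
      intro p
      have : (MvPolynomial.constantCoeff).comp φ = MvPolynomial.constantCoeff := by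
        apply MvPolynomial.ringHom_ext
        · intro a; simp [φ, e, MvPolynomial.finSuccEquiv_apply]
        · intro i
          refine Fin.cases ?_ (fun j => ?_) i <;> simp [φ, e, MvPolynomial.finSuccEquiv_apply]
      exact RingHom.congr_fun this p
    obtain ⟨i, rfl⟩ := Nat.exists_eq_succ_of_ne_zero (by omega : i ≠ 0)
    have := ih (fun i => rk (i+1)) (fun i => (d (i+1)).map φ) ?_ ?_ i (by omega)
    · exact this
    · intro i
      obtain ⟨a1, a2⟩ := (aux_exact_iff _ _).1 (hex i)
      obtain ⟨b1, b2⟩ := (aux_exact_iff _ _).1 (hex (i+1))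
      rw [aux_exact_iff]
      constructor
      · intro u
        obtain ⟨u, rfl⟩ := hφs.comp_left u
        rw [aux_map_mulVec, aux_map_mulVec, b1]
        ext; simp
      · intro v hv
        obtain ⟨v, rfl⟩ := hφs.comp_left v
        rw [aux_map_mulVec] at hv
        choose u hu using fun a => hφk _ (congrFun hv a)
        have hu' : (d (i+1)).mulVec v = (MvPolynomial.X 0 : MvPolynomial (Fin (r+1)) K) • u := by
          ext1 a; exact hu a
        have h0 := a1 v
        rw [hu', Matrix.mulVec_smul] at h0
        have h1 : (d i).mulVec u = 0 :=
          (smul_eq_zero.1 h0).resolve_left (MvPolynomial.X_ne_zero 0)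
        obtain ⟨t, ht⟩ := a2 u h1
        obtain ⟨s, hs⟩ := b2 (v - (MvPolynomial.X 0 : MvPolynomial (Fin (r+1)) K) • t) (by
          rw [Matrix.mulVec_sub, Matrix.mulVec_smul, ht, hu', sub_self])
        refine ⟨φ ∘ s, ?_⟩
        rw [aux_map_mulVec, hs]
        ext1 a
        simp [hφX]
    · intro i a b
      simp [hφc, hmin]

theorem whc_mul {r : ℕ} {w : Fin r → ℤ} {K : Type*} [CommRing K] {p : MvPolynomial (Fin r) K}
    {e : ℤ} (hp : p.IsWeightedHomogeneous w e) (q : MvPolynomial (Fin r) K) (j : ℤ) :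
    weightedHomogeneousComponent w (e + j) (p * q) =
      p * weightedHomogeneousComponent w j q := by
  let _ := MvPolynomial.weightedGradedAlgebra K w
  have := DirectSum.coe_decompose_mul_add_of_left_mem (weightedHomogeneousSubmodule K w)
    (i := e) (j := j) (a := p) (b := q) hp
  have h1 := fun (x : MvPolynomial (Fin r) K) m =>
    MvPolynomial.weightedDecomposition.decompose'_apply K w x m
  erw [h1, h1] at this
  exact this

/-- Homogeneous component of a vector. -/
noncomputable def hcmp {r n : ℕ} {K : Type*} [CommRing K] (w : Fin r → ℤ) (t : Fin n → ℤ) (j : ℤ)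
    (v : Fin n → MvPolynomial (Fin r) K) : Fin n → MvPolynomial (Fin r) K :=
  fun a => weightedHomogeneousComponent w (j - t a) (v a)

/-- Homogeneous matrix. -/
def HMat {r n m : ℕ} {K : Type*} [CommRing K] (w : Fin r → ℤ) (t : Fin n → ℤ) (t' : Fin m → ℤ)
    (D : Matrix (Fin n) (Fin m) (MvPolynomial (Fin r) K)) : Prop :=
  ∀ a b, (D a b).IsWeightedHomogeneous w (t' b - t a)

/-- Homogeneous submodule. -/
def HomSub {r n : ℕ} {K : Type*} [CommRing K] (w : Fin r → ℤ) (t : Fin n → ℤ)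
    (N : Submodule (MvPolynomial (Fin r) K) (Fin n → MvPolynomial (Fin r) K)) : Prop :=
  ∀ v ∈ N, ∀ j, hcmp w t j v ∈ N

section graded
variable {r n m l : ℕ} {K : Type*} [CommRing K] {w : Fin r → ℤ} {t : Fin n → ℤ} {t' : Fin m → ℤ}
  {t'' : Fin l → ℤ}

theorem hcmp_mulVec {D : Matrix (Fin n) (Fin m) (MvPolynomial (Fin r) K)}
    (hD : HMat w t t' D) (j : ℤ) (v : Fin m → MvPolynomial (Fin r) K) :
    hcmp w t j (D.mulVec v) = D.mulVec (hcmp w t' j v) := by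
  ext1 a
  simp only [hcmp, Matrix.mulVec, dotProduct, map_sum]
  refine Finset.sum_congr rfl fun b _ => ?_
  rw [← whc_mul (hD a b)]
  congr 2
  ring

theorem HMat.mul {D : Matrix (Fin n) (Fin m) (MvPolynomial (Fin r) K)}
    (hD : HMat w t t' D) {E : Matrix (Fin m) (Fin l) (MvPolynomial (Fin r) K)}
    (hE : HMat w t' t'' E) : HMat w t t'' (D * E) := by
  intro a b
  rw [Matrix.mul_apply]
  refine IsWeightedHomogeneous.sum _ _ _ fun c _ => ?_
  have := (hD a c).mul (hE c b)
  convert this using 1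
  ring

theorem HomSub.range {D : Matrix (Fin n) (Fin m) (MvPolynomial (Fin r) K)}
    (hD : HMat w t t' D) : HomSub w t (LinearMap.range D.mulVecLin) := by
  rintro _ ⟨v, rfl⟩ j
  exact ⟨hcmp w t' j v, by simp [hcmp_mulVec hD]⟩

theorem HomSub.comap {D : Matrix (Fin n) (Fin m) (MvPolynomial (Fin r) K)}
    (hD : HMat w t t' D) {N} (hN : HomSub w t N) : HomSub w t' (N.comap D.mulVecLin) := by
  intro v hv j
  simp only [Submodule.mem_comap, Matrix.mulVecLin_apply] at hv ⊢
  rw [← hcmp_mulVec hD]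
  exact hN _ hv j

theorem hcmp_zero (j : ℤ) : hcmp (K := K) w t j 0 = 0 := by
  ext1 a; simp [hcmp]

theorem HomSub.bot : HomSub (K := K) w t ⊥ := by
  intro v hv j
  rw [Submodule.mem_bot] at hv ⊢
  rw [hv, hcmp_zero]

theorem HomSub.ker {D : Matrix (Fin n) (Fin m) (MvPolynomial (Fin r) K)}
    (hD : HMat w t t' D) : HomSub w t' (LinearMap.ker D.mulVecLin) :=
  HomSub.comap hD HomSub.bot

theorem hcmp_sum (v : Fin n → MvPolynomial (Fin r) K) :
    ∃ s : Finset ℤ, v = ∑ j ∈ s, hcmp w t j v := by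
  classical
  have hfin : ∀ a, (Function.support fun j => weightedHomogeneousComponent w j (v a)).Finite :=
    fun a => weightedHomogeneousComponent_finsupp (v a)
  refine ⟨Finset.univ.biUnion fun a => (hfin a).toFinset.image (· + t a), ?_⟩
  ext1 a
  rw [Finset.sum_apply]
  simp only [hcmp]
  conv_lhs => rw [← finsum_weightedHomogeneousComponent w (v a)]
  rw [← finsum_comp_equiv (Equiv.subRight (t a))]
  apply finsum_eq_sum_of_support_subset
  intro j hj
  simp only [Finset.coe_biUnion, Finset.coe_image, Set.mem_iUnion]
  refine ⟨a, Finset.mem_coe.2 (Finset.mem_univ _), j - t a, ?_, by simp⟩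
  simpa using hj

theorem HomSub.exists_matrix {N} (hN : HomSub (K := K) w t N) (hfg : N.FG) :
    ∃ (m : ℕ) (t' : Fin m → ℤ) (D : Matrix (Fin n) (Fin m) (MvPolynomial (Fin r) K)),
      HMat w t t' D ∧ LinearMap.range D.mulVecLin = N := by
  classical
  obtain ⟨S, hS⟩ := hfg
  choose s hs using hcmp_sum (K := K) (w := w) (t := t)
  let T : Finset (Σ _ : (Fin n → MvPolynomial (Fin r) K), ℤ) := S.sigma s
  let e := T.equivFin.symm
  refine ⟨T.card, fun b => (e b).1.2, Matrix.of fun a b => hcmp w t (e b).1.2 (e b).1.1 a, ?_, ?_⟩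
  · intro a b
    exact weightedHomogeneousComponent_isWeightedHomogeneous _ _ 
  · rw [Matrix.range_mulVecLin]
    apply le_antisymm
    · rw [Submodule.span_le]
      rintro _ ⟨b, rfl⟩
      refine hN _ ?_ _
      rw [← hS]
      exact Submodule.subset_span (Finset.mem_sigma.1 (e b).2).1
    · rw [← hS, Submodule.span_le]
      intro v hv
      rw [hs v]
      refine Submodule.sum_mem _ fun j hj => Submodule.subset_span ?_
      refine ⟨T.equivFin ⟨⟨v, j⟩, Finset.mem_sigma.2 ⟨hv, hj⟩⟩, ?_⟩
      ext1 a
      simp [Matrix.col, e]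

end graded

/-- A homogeneous submodule of a graded free module, contained in the maximal ideal part. -/
structure HState {r : ℕ} (w : Fin r → ℤ) (K : Type*) [CommRing K] where
  n : ℕ
  t : Fin n → ℤ
  N : Submodule (MvPolynomial (Fin r) K) (Fin n → MvPolynomial (Fin r) K)
  hom : HomSub w t N
  min : ∀ v ∈ N, ∀ a, constantCoeff (v a) = 0

theorem whc_zero_eq_C {r : ℕ} {K : Type*} [CommRing K] (w : Fin r → ℤ) (hw : ∀ i, 1 ≤ w i)
    (p : MvPolynomial (Fin r) K) :
    weightedHomogeneousComponent w 0 p = C (constantCoeff p) := by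
  classical
  ext d
  rw [coeff_weightedHomogeneousComponent, coeff_C, constantCoeff_eq]
  have : Finsupp.weight w d = 0 ↔ 0 = d := by
    constructor
    · intro h
      rw [Finsupp.weight_apply, Finsupp.sum_fintype _ _ (by simp)] at h
      have h' := (Finset.sum_eq_zero_iff_of_nonneg (fun i _ => by
        have := hw i
        simp only [nsmul_eq_mul]; positivity)).1 h
      ext i
      have := h' i (Finset.mem_univ _)
      have hi := hw i
      simp only [nsmul_eq_mul, mul_eq_zero] at this
      have : (d i : ℤ) = 0 := this.resolve_right (by omega)
      simp; omega
    · rintro rfl; simp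
  by_cases h : 0 = d
  · subst h; simp
  · rw [if_neg (fun h' => h (this.1 h')), if_neg h]

theorem HomSub.reduce {r : ℕ} {K : Type*} [Field K] (w : Fin r → ℤ) (hw : ∀ i, 1 ≤ w i) :
    ∀ (n : ℕ) (t : Fin n → ℤ) (N), HomSub (K := K) w t N →
    ∃ (s : HState w K) (E : Matrix (Fin n) (Fin s.n) (MvPolynomial (Fin r) K)),
      HMat w t s.t E ∧ s.N = N.comap E.mulVecLin ∧ ∀ v, ∃ q, v - E.mulVec q ∈ N := by
  have key : ∀ (n : ℕ) (t : Fin n → ℤ) (N), HomSub (K := K) w t N →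
      (∀ v ∈ N, ∀ a, constantCoeff (v a) = 0) → 
      ∃ (s : HState w K) (E : Matrix (Fin n) (Fin s.n) (MvPolynomial (Fin r) K)),
      HMat w t s.t E ∧ s.N = N.comap E.mulVecLin ∧ ∀ v, ∃ q, v - E.mulVec q ∈ N := by
    intro n t N hN hmin
    refine ⟨⟨n, t, N, hN, hmin⟩, (1 : Matrix (Fin n) (Fin n) _), ?_, ?_, ?_⟩
    · intro a b
      rw [Matrix.one_apply]
      split_ifs with h
      · subst h; simpa using isWeightedHomogeneous_one K w
      · exact isWeightedHomogeneous_zero _ _ _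
    · simp
    · intro v; exact ⟨v, by simp⟩
  intro n
  induction n with
  | zero =>
    intro t N hN
    exact key 0 t N hN (fun v _ a => a.elim0)
  | succ n ih =>
    intro t N hN
    by_cases hmin : ∀ v ∈ N, ∀ a, constantCoeff (v a) = 0
    · exact key _ t N hN hmin
    push Not at hmin
    obtain ⟨v, hv, b, hb⟩ := hmin
    obtain ⟨v, hv, hb⟩ : ∃ v ∈ N, v b = 1 := by
      refine ⟨(C (constantCoeff (v b))⁻¹ : MvPolynomial (Fin r) K) • hcmp w t (t b) v,
        N.smul_mem _ (hN v hv _), ?_⟩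
      simp only [hcmp, Pi.smul_apply, sub_self, whc_zero_eq_C w hw, smul_eq_mul]
      rw [← C_mul, inv_mul_cancel₀ hb, C_1]
    let E : Matrix (Fin (n+1)) (Fin n) (MvPolynomial (Fin r) K) :=
      fun a c => if a = b.succAbove c then 1 else 0
    let t1 : Fin n → ℤ := fun c => t (b.succAbove c)
    have hE : HMat w t t1 E := by
      intro a c
      simp only [E, t1]
      split_ifs with h
      · subst h; simpa using isWeightedHomogeneous_one K w
      · exact isWeightedHomogeneous_zero _ _ _
    obtain ⟨s, E', hE', hsN, hq⟩ := ih t1 (N.comap E.mulVecLin) (HomSub.comap hE hN)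
    refine ⟨s, E * E', hE.mul hE', ?_, ?_⟩
    · rw [hsN, Matrix.mulVecLin_mul, Submodule.comap_comp]
    · intro x
      let q1 : Fin n → MvPolynomial (Fin r) K := fun c => x (b.succAbove c) - x b * v (b.succAbove c)
      obtain ⟨q, hq⟩ := hq q1
      refine ⟨q, ?_⟩
      have hq1 : x - E.mulVec q1 = x b • v := by
        ext1 a
        simp only [E, Matrix.mulVec, dotProduct, Pi.sub_apply, Pi.smul_apply, smul_eq_mul,
          ite_mul, one_mul, zero_mul]
        refine Fin.succAboveCases b ?_ (fun c => ?_) a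
        · simp [hb, Fin.ne_succAbove]
        · simp [q1]
      have h2 : x - (E * E').mulVec q = x b • v + E.mulVec (q1 - E'.mulVec q) := by
        rw [← hq1, Matrix.mulVec_sub, Matrix.mulVec_mulVec]
        abel
      rw [h2]
      exact N.add_mem (N.smul_mem _ hv) (by simpa using hq)

theorem HState.next {r : ℕ} {K : Type*} [Field K] (w : Fin r → ℤ) (hw : ∀ i, 1 ≤ w i)
    (s : HState w K) : ∃ (s' : HState w K) (D : Matrix (Fin s.n) (Fin s'.n) (MvPolynomial (Fin r) K)),
      HMat w s.t s'.t D ∧ LinearMap.range D.mulVecLin = s.N ∧ s'.N = LinearMap.ker D.mulVecLin := by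
  obtain ⟨m, t', P, hP, hr⟩ := HomSub.exists_matrix s.hom (IsNoetherian.noetherian s.N)
  obtain ⟨s', E, hE, hN, hq⟩ := HomSub.reduce w hw m t' _ (HomSub.ker hP)
  refine ⟨s', P * E, hP.mul hE, ?_, ?_⟩
  · rw [← hr, Matrix.mulVecLin_mul]
    apply le_antisymm (LinearMap.range_comp_le_range _ _)
    rintro _ ⟨v, rfl⟩
    obtain ⟨q, hq⟩ := hq v
    refine ⟨q, ?_⟩
    rw [LinearMap.mem_ker, map_sub, sub_eq_zero] at hq
    exact hq.symm
  · rw [hN, Matrix.mulVecLin_mul, LinearMap.ker_comp]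

/-- Minimal graded resolution over a field. -/
theorem exists_min_res {r n : ℕ} {K : Type*} [Field K] (w : Fin r → ℤ) (hw : ∀ i, 1 ≤ w i)
    (t : Fin n → ℤ) (N) (hN : HomSub (K := K) w t N) :
    ∃ G : GradedFreeComplexData w K,
    ∃ E : Matrix (Fin n) (Fin (G.rk 0)) (MvPolynomial (Fin r) K),
      (∀ i, r < i → G.rk i = 0) ∧ G.IsGraded ∧ G.IsMinimal ∧
      (∀ i, LinearMap.range (G.d (i + 1)).mulVecLin = LinearMap.ker (G.d i).mulVecLin) ∧
      (∀ v, v ∈ LinearMap.range (G.d 0).mulVecLin ↔ E.mulVec v ∈ N) ∧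
      ∀ v, ∃ q, v - E.mulVec q ∈ N := by
  obtain ⟨s, E, hE, hsN, hq⟩ := HomSub.reduce w hw n t N hN
  choose nx D hD hr hk using HState.next (K := K) w hw
  let st : ℕ → HState w K := fun i => Nat.rec s (fun _ x => nx x) i
  let G : GradedFreeComplexData w K :=
    { rk := fun i => (st i).n, tw := fun i => (st i).t, d := fun i => D (st i) }
  have hex : ∀ i, LinearMap.range (G.d (i + 1)).mulVecLin = LinearMap.ker (G.d i).mulVecLin :=
    fun i => (hr (st (i+1))).trans (hk (st i))
  have hmin : G.IsMinimal := by
    intro i a b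
    have : (D (st i)).mulVecLin (Pi.single b 1) ∈ (st i).N := by
      rw [← hr]; exact LinearMap.mem_range_self _ _
    have := (st i).min _ this a
    rw [Matrix.mulVecLin_apply, Matrix.mulVec_single_one] at this
    exact this
  refine ⟨G, E, syz_bound K r G.rk G.d hex hmin, fun i => hD (st i), hmin, hex, fun v => ?_, hq⟩
  exact iff_of_eq (congrArg (v ∈ ·) ((hr s).trans hsN))

theorem free_of_leading {B P I Λ : Type*} [CommRing B] [AddCommGroup P] [Module B P]
    [LinearOrder Λ] [WellFoundedLT Λ] (b : Module.Basis I B P) (o : I → Λ)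
    (ho : Function.Injective o) (N : Submodule B P)
    (h : ∀ v ∈ N, ∀ i, b.repr v i ≠ 0 → (∀ j, o i < o j → b.repr v j = 0) →
      ∃ z ∈ N, b.repr z i = 1 ∧ ∀ j, o i < o j → b.repr z j = 0) :
    Module.Free B (P ⧸ N) := by
  classical
  let S : Set I := {i | ¬ ∃ v ∈ N, b.repr v i ≠ 0 ∧ ∀ j, o i < o j → b.repr v j = 0}
  let Q : Submodule B P := Submodule.span B (b '' S)
  have hfree : Module.Free B Q := by
    have hli : LinearIndependent B (fun s : S => b s) :=
      b.linearIndependent.comp _ Subtype.val_injective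
    have := Module.Free.of_basis (Module.Basis.span hli)
    have e : Set.range (fun s : S => b s) = b '' S := by
      ext; simp
    rw [e] at this
    exact this
  have hc : IsCompl N Q := by
    constructor
    · rw [Submodule.disjoint_def]
      intro v hvN hvQ
      by_contra hv
      have hne : (b.repr v).support.Nonempty := by
        rw [Finsupp.support_nonempty_iff]; simpa using hv
      obtain ⟨i, hi, hmax⟩ := Finset.exists_max_image _ o hne
      have hiS : i ∈ S := (b.mem_span_image.1 hvQ) hi
      refine hiS ⟨v, hvN, by simpa using hi, fun j hj => ?_⟩
      by_contra hj'
      exact absurd (hmax j (by simpa using hj')) (not_le.2 hj)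
    · rw [codisjoint_iff, eq_top_iff, ← b.span_eq, Submodule.span_le]
      rintro _ ⟨i, rfl⟩
      have : ∀ l : Λ, ∀ i, o i = l → b i ∈ N ⊔ Q := by
        intro l
        induction l using WellFoundedLT.induction with
        | ind l ih =>
          rintro i rfl
          by_cases hiS : i ∈ S
          · exact Submodule.mem_sup_right (Submodule.subset_span ⟨i, hiS, rfl⟩)
          · simp only [S, Set.mem_ofPred_eq, not_not] at hiS
            obtain ⟨v, hv, hvi, hvj⟩ := hiS
            obtain ⟨z, hz, hzi, hzj⟩ := h v hv i hvi hvj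
            have h1 : b i = z - (z - b i) := by abel
            rw [h1]
            refine Submodule.sub_mem _ (Submodule.mem_sup_left hz) ?_
            rw [← b.linearCombination_repr (z - b i), Finsupp.linearCombination_apply]
            refine Submodule.sum_mem _ fun j hj => Submodule.smul_mem _ _ ?_
            rcases lt_trichotomy (o j) (o i) with hlt | heq | hgt
            · exact ih _ hlt j rfl
            · exfalso
              have := ho heq
              subst this
              simp [hzi] at hj
            · exfalso
              have hne : i ≠ j := fun e => by subst e; exact lt_irrefl _ hgt
              simp [hzj j hgt, hne] at hj
      exact this _ i rfl
  exact Module.Free.of_equiv (Submodule.quotientEquivOfIsCompl N Q hc).symm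

/-- Position of a term. -/
noncomputable def tord {r n : ℕ} (j : Fin n) (u : Fin r →₀ ℕ) :
    Fin n ×ₗ (MonomialOrder.lex (σ := Fin r)).syn :=
  toLex (j, MonomialOrder.lex.toSyn u)

theorem tord_lt {r n : ℕ} {j j' : Fin n} {u u' : Fin r →₀ ℕ} :
    tord j u < tord j' u' ↔ j < j' ∨ j = j' ∧ 
      MonomialOrder.lex.toSyn u < MonomialOrder.lex.toSyn u' := by
  simp [tord, Prod.Lex.toLex_lt_toLex]

/-- No term after the given position. -/
def Above {r n : ℕ} {R : Type*} [CommRing R] (v : Fin n → MvPolynomial (Fin r) R) (j : Fin n)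
    (u : Fin r →₀ ℕ) : Prop :=
  ∀ j' u', tord j u < tord j' u' → coeff u' (v j') = 0

theorem above_shift {r n : ℕ} {R : Type*} [CommRing R] {v : Fin n → MvPolynomial (Fin r) R}
    {j : Fin n} {u : Fin r →₀ ℕ} (h : Above v j u) (e : Fin r →₀ ℕ) :
    Above ((monomial e (1 : R)) • v) j (u + e) := by
  intro j' u' hlt
  rw [Pi.smul_apply, smul_eq_mul, coeff_monomial_mul', one_mul]
  split_ifs with hle
  · apply h
    obtain ⟨u'', rfl⟩ := exists_add_of_le hle
    rw [tord_lt] at hlt ⊢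
    rw [map_add, map_add, add_comm (MonomialOrder.lex.toSyn e)] at hlt
    simpa using hlt
  · rfl

theorem exists_lead {r n : ℕ} {A : Type*} [CommRing A] [IsDomain A]
    (N : Submodule (MvPolynomial (Fin r) A) (Fin n → MvPolynomial (Fin r) A)) :
    ∃ f : A, f ≠ 0 ∧ ∀ j u, (∃ z ∈ N, coeff u (z j) ≠ 0 ∧ Above z j u) →
      ∃ z ∈ N, coeff u (z j) = f ∧ Above z j u := by
  classical
  let T : Fin n → (Fin r →₀ ℕ) → Prop := fun j u => ∃ z ∈ N, coeff u (z j) ≠ 0 ∧ Above z j u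
  let F : Fin n → Set (Fin r →₀ ℕ) := fun j => {u | Minimal (T j) u}
  have hF : ∀ j, (F j).Finite := fun j =>
    WellQuasiOrderedLE.finite_of_isAntichain (setOfPred_minimal_antichain _)
  have hz : ∀ j u, ∃ c : A, c ≠ 0 ∧ (u ∈ F j → ∃ z ∈ N, coeff u (z j) = c ∧ Above z j u) := by
    intro j u
    by_cases hu : u ∈ F j
    · obtain ⟨z, hz, hc, ha⟩ := hu.1
      exact ⟨_, hc, fun _ => ⟨z, hz, rfl, ha⟩⟩
    · exact ⟨1, one_ne_zero, fun h => absurd h hu⟩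
  choose c hc0 hc using hz
  refine ⟨∏ j, ∏ u ∈ (hF j).toFinset, c j u, ?_, ?_⟩
  · exact Finset.prod_ne_zero_iff.2 fun j _ => Finset.prod_ne_zero_iff.2 fun u _ => hc0 j u
  · intro j u hT
    obtain ⟨u', hle, hu'⟩ := exists_minimal_le_of_wellFoundedLT (T j) u hT
    obtain ⟨z, hzN, hzc, hza⟩ := hc j u' hu'
    have hdvd : c j u' ∣ ∏ j, ∏ u ∈ (hF j).toFinset, c j u :=
      (Finset.dvd_prod_of_mem (c j) ((hF j).mem_toFinset.2 hu')).trans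
        (Finset.dvd_prod_of_mem (fun j => ∏ u ∈ (hF j).toFinset, c j u) (Finset.mem_univ j))
    obtain ⟨q, hq⟩ := hdvd
    obtain ⟨e, rfl⟩ := exists_add_of_le hle
    refine ⟨(C q : MvPolynomial (Fin r) A) • (monomial e (1 : A)) • z,
      N.smul_mem _ (N.smul_mem _ hzN), ?_, ?_⟩
    · rw [hq, Pi.smul_apply, Pi.smul_apply, smul_eq_mul, smul_eq_mul, coeff_C_mul, add_comm u' e,
        coeff_monomial_mul, hzc]
      ring
    · intro j' u'' hlt
      rw [Pi.smul_apply, smul_eq_mul, coeff_C_mul, above_shift hza e j' u'' hlt, mul_zero]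

theorem clear_den {r : ℕ} {A B ι : Type*} [Finite ι] [CommRing A] [CommRing B] [Algebra A B]
    (M : Submonoid A) [IsLocalization M B] (u : ι → MvPolynomial (Fin r) B) :
    ∃ m ∈ M, ∃ u0 : ι → MvPolynomial (Fin r) A,
      ∀ i, C (algebraMap A B m) * u i = MvPolynomial.map (algebraMap A B) (u0 i) := by
  let _ := MvPolynomial.algebraMvPolynomial (σ := Fin r) (R := A) (S := B)
  obtain ⟨⟨_, m, hm, rfl⟩, h⟩ := IsLocalization.exist_integer_multiples_of_finite
    (M.map (C (σ := Fin r))) u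
  choose u0 h using h
  refine ⟨m, hm, u0, fun i => ?_⟩
  have : MvPolynomial.map (algebraMap A B) (u0 i) =
      MvPolynomial.map (algebraMap A B) (C m) * u i := (h i).trans (Algebra.smul_def _ _)
  rw [this, map_C]

theorem free_coker {r n m : ℕ} {A B : Type*} [CommRing A] [IsDomain A] [CommRing B]
    [Algebra A B] (M : Submonoid A) (hM : M ≤ nonZeroDivisors A) [IsLocalization M B]
    (X : Matrix (Fin n) (Fin m) (MvPolynomial (Fin r) A)) (f : A)
    (hf : ∀ j u, (∃ z ∈ LinearMap.range X.mulVecLin, coeff u (z j) ≠ 0 ∧ Above z j u) →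
      ∃ z ∈ LinearMap.range X.mulVecLin, coeff u (z j) = f ∧ Above z j u)
    (hu : IsUnit (algebraMap A B f))
    (XB : Matrix (Fin n) (Fin m) (MvPolynomial (Fin r) B))
    (hXB : LinearMap.range XB.mulVecLin =
      LinearMap.range (X.map (MvPolynomial.map (algebraMap A B))).mulVecLin) :
    Module.Free B ((Fin n → MvPolynomial (Fin r) B) ⧸ LinearMap.range XB.mulVecLin) := by
  rw [hXB]
  set N := LinearMap.range (X.map (MvPolynomial.map (algebraMap A B))).mulVecLin with hN
  have hinj : Function.Injective (algebraMap A B) := IsLocalization.injective B hM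
  suffices Module.Free B ((Fin n → MvPolynomial (Fin r) B) ⧸ N.restrictScalars B) from
    Module.Free.of_equiv (Submodule.Quotient.restrictScalarsEquiv B N)
  let b : Module.Basis (Σ _ : Fin n, (Fin r →₀ ℕ)) B (Fin n → MvPolynomial (Fin r) B) :=
    Pi.basis fun _ => MvPolynomial.basisMonomials (Fin r) B
  have hb : ∀ v i, b.repr v i = coeff i.2 (v i.1) := by
    intro v i
    simp only [b, Pi.basis_repr]
    rfl
  refine free_of_leading b (fun i => tord i.1 i.2) ?_ _ ?_
  · rintro ⟨j, u⟩ ⟨j', u'⟩ h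
    simp only [tord, EmbeddingLike.apply_eq_iff_eq, Prod.mk.injEq] at h
    obtain ⟨rfl, rfl⟩ := h
    rfl
  · rintro v hv ⟨j, u⟩ h1 h2
    simp only [hb] at h1 h2 ⊢
    obtain ⟨y, rfl⟩ := hv
    obtain ⟨a, ha, y0, hy0⟩ := clear_den (r := r) M y
    have haB : IsUnit (algebraMap A B a) := IsLocalization.map_units B ⟨a, ha⟩
    have hy : MvPolynomial.map (algebraMap A B) ∘ y0 =
        (C (algebraMap A B a) : MvPolynomial (Fin r) B) • y := by
      ext1 i; exact (hy0 i).symm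
    have key : ∀ j u, algebraMap A B (coeff u (X.mulVec y0 j)) = algebraMap A B a *
        coeff u ((X.map (MvPolynomial.map (algebraMap A B))).mulVecLin y j) := by
      intro j u
      have := aux_map_mulVec (MvPolynomial.map (σ := Fin r) (algebraMap A B)) X y0
      rw [hy, Matrix.mulVec_smul] at this
      have := congrArg (coeff u) (congrFun this j)
      simpa [coeff_C_mul, coeff_map] using this.symm
    obtain ⟨z, ⟨x, rfl⟩, hzc, hza⟩ := hf j u ⟨X.mulVecLin y0, LinearMap.mem_range_self _ _, by
        intro h0
        apply h1
        have := key j u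
        rw [Matrix.mulVecLin_apply] at h0
        rw [h0, map_zero] at this
        exact (haB.mul_right_eq_zero.1 this.symm), by
        intro j' u' hlt
        apply hinj
        rw [Matrix.mulVecLin_apply, key, h2 ⟨j', u'⟩ hlt, mul_zero, map_zero]⟩
    obtain ⟨g, hg⟩ := hu.exists_left_inv
    refine ⟨(C g : MvPolynomial (Fin r) B) • (MvPolynomial.map (algebraMap A B) ∘ X.mulVec x),
      ?_, ?_, ?_⟩
    · rw [← aux_map_mulVec]
      exact N.smul_mem _ ⟨_, rfl⟩
    · rw [Matrix.mulVecLin_apply] at hzc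
      simp [coeff_C_mul, coeff_map, hzc, hg]
    · rintro ⟨j', u'⟩ hlt
      have := hza j' u' hlt
      rw [Matrix.mulVecLin_apply] at this
      simp [coeff_C_mul, coeff_map, this]

theorem pmap_comp_smul {r n : ℕ} {B D : Type*} [CommRing B] [CommRing D] (χ : B →+* D) (c : B)
    (x : Fin n → MvPolynomial (Fin r) B) :
    (MvPolynomial.map χ) ∘ (c • x) = χ c • ((MvPolynomial.map χ) ∘ x) := by
  ext1 i
  simp [MvPolynomial.smul_eq_C_mul]

theorem pmap_comp_add {r n : ℕ} {B D : Type*} [CommRing B] [CommRing D] (χ : B →+* D)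
    (x y : Fin n → MvPolynomial (Fin r) B) :
    (MvPolynomial.map χ) ∘ (x + y) = (MvPolynomial.map χ) ∘ x + (MvPolynomial.map χ) ∘ y := by
  ext1 i
  simp

theorem pmap_comp_zero {r n : ℕ} {B D : Type*} [CommRing B] [CommRing D] (χ : B →+* D) :
    (MvPolynomial.map χ) ∘ (0 : Fin n → MvPolynomial (Fin r) B) = 0 := by
  ext1 i
  simp

/-- The monomial basis of a free module. -/
noncomputable def vb (r n : ℕ) (B : Type*) [CommRing B] :
    Module.Basis (Σ _ : Fin n, (Fin r →₀ ℕ)) B (Fin n → MvPolynomial (Fin r) B) :=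
  Pi.basis fun _ => MvPolynomial.basisMonomials (Fin r) B

theorem map_vb {r n : ℕ} {B D : Type*} [CommRing B] [CommRing D] (χ : B →+* D) (i) :
    (MvPolynomial.map χ) ∘ (vb r n B i) = vb r n D i := by
  obtain ⟨j, u⟩ := i
  ext1 k
  simp only [vb, Pi.basis_apply, Function.comp_apply, coe_basisMonomials]
  by_cases h : k = j
  · subst h; simp
  · simp [h]

theorem split_aux {B P Q : Type*} [CommRing B] [AddCommGroup P] [Module B P] [AddCommGroup Q]
    [Module B Q] [Module.Projective B Q] (g : P →ₗ[B] Q)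
    [Module.Projective B (Q ⧸ LinearMap.range g)] : ∃ s : Q →ₗ[B] P, ∀ x, g (s (g x)) = g x := by
  let π := (LinearMap.range g).mkQ
  have hπ : Function.Surjective π := Submodule.mkQ_surjective _
  obtain ⟨σ, hσ⟩ := Module.projective_lifting_property π LinearMap.id hπ
  have hrange : ∀ x, (LinearMap.id - σ ∘ₗ π : Q →ₗ[B] Q) x ∈ LinearMap.range g := by
    intro x
    have : π ((LinearMap.id - σ ∘ₗ π : Q →ₗ[B] Q) x) = 0 := by
      have := LinearMap.congr_fun hσ (π x)
      simp only [LinearMap.comp_apply, LinearMap.id_apply] at this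
      simp [this]
    exact (Submodule.Quotient.mk_eq_zero _).1 this
  obtain ⟨s, hs⟩ := Module.projective_lifting_property g.rangeRestrict
    (LinearMap.codRestrict (LinearMap.range g) _ hrange) g.surjective_rangeRestrict
  refine ⟨s, fun x => ?_⟩
  have h3 := congrArg Subtype.val (LinearMap.congr_fun hs (g x))
  have h4 : π (g x) = 0 := (Submodule.Quotient.mk_eq_zero _).2 ⟨x, rfl⟩
  simp only [LinearMap.comp_apply, LinearMap.codRestrict_apply, LinearMap.sub_apply, h4,
    map_zero, sub_zero, LinearMap.id_apply] at h3
  exact h3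

theorem exact_basechange {r a b c : ℕ} {B D : Type*} [CommRing B] [CommRing D] (χ : B →+* D)
    (M : Matrix (Fin a) (Fin b) (MvPolynomial (Fin r) B))
    (N : Matrix (Fin b) (Fin c) (MvPolynomial (Fin r) B))
    (hex : LinearMap.range N.mulVecLin = LinearMap.ker M.mulVecLin)
    (hfree : Module.Free B ((Fin a → MvPolynomial (Fin r) B) ⧸ LinearMap.range M.mulVecLin)) :
    LinearMap.range (N.map (MvPolynomial.map χ)).mulVecLin =
      LinearMap.ker (M.map (MvPolynomial.map χ)).mulVecLin := by
  obtain ⟨h1, h2⟩ := (aux_exact_iff _ _).1 hex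
  obtain ⟨s, hs⟩ : ∃ s : (Fin a → MvPolynomial (Fin r) B) →ₗ[B] (Fin b → MvPolynomial (Fin r) B),
      ∀ x, M.mulVec (s (M.mulVec x)) = M.mulVec x := by
    have e : LinearMap.range (M.mulVecLin.restrictScalars B) =
        (LinearMap.range M.mulVecLin).restrictScalars B := by
      ext x; rfl
    have : Module.Free B ((Fin a → MvPolynomial (Fin r) B) ⧸
        LinearMap.range (M.mulVecLin.restrictScalars B)) := by
      rw [e]
      exact Module.Free.of_equiv
        (Submodule.Quotient.restrictScalarsEquiv B (LinearMap.range M.mulVecLin)).symm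
    obtain ⟨s, hs⟩ := split_aux (M.mulVecLin.restrictScalars B) 
    exact ⟨s, hs⟩
  let sD : (Fin a → MvPolynomial (Fin r) D) →ₗ[D] (Fin b → MvPolynomial (Fin r) D) :=
    (vb r a D).constr D (fun i => (MvPolynomial.map χ) ∘ (s (vb r a B i)))
  have hsD : ∀ x, sD ((MvPolynomial.map χ) ∘ x) = (MvPolynomial.map χ) ∘ (s x) := by
    intro x
    have hx := (vb r a B).mem_span x
    induction hx using Submodule.span_induction with
    | mem x hx =>
      obtain ⟨i, rfl⟩ := hx
      rw [map_vb]
      simp [sD, Module.Basis.constr_basis]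
    | zero => simp
    | add x y _ _ hx hy => rw [pmap_comp_add, map_add, hx, hy, map_add, pmap_comp_add]
    | smul c x _ hx => rw [pmap_comp_smul, map_smul, hx, map_smul, pmap_comp_smul]
  rw [aux_exact_iff]
  constructor
  · intro u
    rw [Matrix.mulVec_mulVec, ← Matrix.map_mul]
    have : M * N = 0 := by
      apply Matrix.ext_of_mulVec_single
      intro i
      rw [← Matrix.mulVec_mulVec, h1]; simp; rfl
    rw [this]; simp
  · have key : ∀ w, ∃ u, (N.map (MvPolynomial.map χ)).mulVec u =
        w - sD ((M.map (MvPolynomial.map χ)).mulVec w) := by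
      intro w
      have hw := (vb r b D).mem_span w
      induction hw using Submodule.span_induction with
      | mem x hx =>
        obtain ⟨i, rfl⟩ := hx
        obtain ⟨u, hu⟩ := h2 (vb r b B i - s (M.mulVec (vb r b B i))) (by
          rw [Matrix.mulVec_sub, hs, sub_self])
        refine ⟨MvPolynomial.map χ ∘ u, ?_⟩
        rw [← map_vb χ, aux_map_mulVec, aux_map_mulVec, hsD, hu]
        ext1 k; simp
      | zero => exact ⟨0, by simp⟩
      | add x y _ _ hx hy =>
        obtain ⟨u, hu⟩ := hx
        obtain ⟨v, hv⟩ := hy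
        refine ⟨u + v, ?_⟩
        rw [Matrix.mulVec_add, hu, hv, Matrix.mulVec_add, map_add]; abel
      | smul c x _ hx =>
        obtain ⟨u, hu⟩ := hx
        refine ⟨c • u, ?_⟩
        rw [Matrix.mulVec_smul, hu, Matrix.mulVec_smul, map_smul, smul_sub]
    intro v hv
    obtain ⟨u, hu⟩ := key v
    exact ⟨u, by rw [hu, hv]; simp⟩

/-- Exactness over the fraction field descends when the cokernel is torsion free. -/
theorem exact_descend {r a b c : ℕ} {B K : Type*} [CommRing B] [IsDomain B] [Field K]
    [Algebra B K] [IsFractionRing B K]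
    (M : Matrix (Fin a) (Fin b) (MvPolynomial (Fin r) B))
    (N : Matrix (Fin b) (Fin c) (MvPolynomial (Fin r) B))
    (hex : LinearMap.range (N.map (MvPolynomial.map (algebraMap B K))).mulVecLin =
      LinearMap.ker (M.map (MvPolynomial.map (algebraMap B K))).mulVecLin)
    (hfree : Module.Free B ((Fin b → MvPolynomial (Fin r) B) ⧸ LinearMap.range N.mulVecLin)) :
    LinearMap.range N.mulVecLin = LinearMap.ker M.mulVecLin := by
  obtain ⟨h1, h2⟩ := (aux_exact_iff _ _).1 hex
  have hinj : Function.Injective (MvPolynomial.map (σ := Fin r) (algebraMap B K)) :=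
    MvPolynomial.map_injective _ (IsFractionRing.injective B K)
  rw [aux_exact_iff]
  constructor
  · intro u
    have := h1 (MvPolynomial.map (algebraMap B K) ∘ u)
    rw [aux_map_mulVec, aux_map_mulVec] at this
    ext1 k
    apply hinj
    simpa using congrFun this k
  · intro v hv
    obtain ⟨u, hu⟩ := h2 (MvPolynomial.map (algebraMap B K) ∘ v) (by
      rw [aux_map_mulVec, hv, pmap_comp_zero])
    obtain ⟨m, hm, u0, hu0⟩ := clear_den (nonZeroDivisors B) u
    have hmv : N.mulVec u0 = m • v := by
      have h3 : MvPolynomial.map (algebraMap B K) ∘ u0 =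
          (C (algebraMap B K m) : MvPolynomial (Fin r) K) • u := by
        ext1 i; exact (hu0 i).symm
      ext1 k
      apply hinj
      have := aux_map_mulVec (MvPolynomial.map (σ := Fin r) (algebraMap B K)) N u0
      rw [h3, Matrix.mulVec_smul, hu] at this
      have := congrFun this k
      simpa [MvPolynomial.smul_eq_C_mul] using this.symm
    have h0 : m • (LinearMap.range N.mulVecLin).mkQ v = 0 := by
      rw [← LinearMap.map_smul_of_tower, ← hmv]
      exact (Submodule.Quotient.mk_eq_zero _).2 ⟨u0, rfl⟩
    have hm0 : m ≠ 0 := nonZeroDivisors.ne_zero hm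
    have h4 := (smul_eq_zero.1 h0).resolve_left hm0
    have : v ∈ LinearMap.range N.mulVecLin := (Submodule.Quotient.mk_eq_zero _).1 h4
    simpa using this

theorem coker_equiv {R : Type*} [CommRing R] {n m p q : ℕ}
    (Φ : Matrix (Fin n) (Fin m) R) (d : Matrix (Fin p) (Fin q) R)
    (E : Matrix (Fin n) (Fin p) R) (Q : Matrix (Fin p) (Fin n) R)
    (T : Matrix (Fin m) (Fin q) R) (V : Matrix (Fin m) (Fin n) R)
    (T' : Matrix (Fin q) (Fin m) R) (U : Matrix (Fin q) (Fin p) R)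
    (h1 : E * d = Φ * T) (h2 : 1 = E * Q + Φ * V) (h3 : Q * Φ = d * T') (h4 : Q * E = 1 + d * U) :
    Nonempty (((Fin p → R) ⧸ LinearMap.range d.mulVecLin) ≃ₗ[R]
      ((Fin n → R) ⧸ LinearMap.range Φ.mulVecLin)) := by
  refine ⟨LinearEquiv.ofLinearMap
    (Submodule.mapQ _ _ E.mulVecLin ?_) (Submodule.mapQ _ _ Q.mulVecLin ?_) ?_ ?_⟩
  · rintro _ ⟨x, rfl⟩
    refine ⟨T.mulVec x, ?_⟩
    simp [Matrix.mulVec_mulVec, h1]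
  · rintro _ ⟨x, rfl⟩
    refine ⟨T'.mulVec x, ?_⟩
    simp [Matrix.mulVec_mulVec, h3]
  · apply Submodule.linearMap_qext
    apply LinearMap.ext
    intro x
    simp only [LinearMap.comp_apply, Submodule.mkQ_apply, Submodule.mapQ_apply, LinearMap.id_apply]
    rw [Submodule.Quotient.eq]
    refine ⟨V.mulVec (-x), ?_⟩
    have : (1 : Matrix (Fin n) (Fin n) R).mulVec x = (E * Q + Φ * V).mulVec x := by rw [← h2]
    rw [Matrix.one_mulVec, Matrix.add_mulVec] at this
    simp only [Matrix.mulVecLin_apply, Matrix.mulVec_mulVec, Matrix.mulVec_neg]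
    nth_rewrite 3 [this]
    abel
  · apply Submodule.linearMap_qext
    apply LinearMap.ext
    intro x
    simp only [LinearMap.comp_apply, Submodule.mkQ_apply, Submodule.mapQ_apply, LinearMap.id_apply]
    rw [Submodule.Quotient.eq]
    refine ⟨U.mulVec x, ?_⟩
    simp only [Matrix.mulVecLin_apply, Matrix.mulVec_mulVec, h4, Matrix.add_mulVec,
      Matrix.one_mulVec]
    abel

theorem exists_factor {R : Type*} [CommRing R] {n m k : ℕ} (X : Matrix (Fin n) (Fin m) R)
    (Y : Matrix (Fin n) (Fin k) R) (h : ∀ x, Y.mulVec x ∈ LinearMap.range X.mulVecLin) :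
    ∃ Z : Matrix (Fin m) (Fin k) R, Y = X * Z := by
  choose z hz using fun b => h (Pi.single b 1)
  refine ⟨Matrix.of fun a b => z b a, ?_⟩
  ext a b
  have := congrFun (hz b) a
  rw [Matrix.mulVec_single_one] at this
  exact this.symm

theorem map_map_inj {r n m : ℕ} {B K : Type*} [CommRing B] [CommRing K] {φ : B →+* K}
    (hφ : Function.Injective φ) {X Y : Matrix (Fin n) (Fin m) (MvPolynomial (Fin r) B)}
    (h : X.map (MvPolynomial.map φ) = Y.map (MvPolynomial.map φ)) : X = Y :=
  Matrix.map_injective (MvPolynomial.map_injective φ hφ) h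

theorem spread {r n m : ℕ} {A K : Type} [CommRing A] [IsDomain A] [Field K] [Algebra A K]
    [IsFractionRing A K] (X : Matrix (Fin n) (Fin m) (MvPolynomial (Fin r) K)) :
    ∃ f : A, f ≠ 0 ∧ ∀ (B : Type) [CommRing B] [Algebra A B] [Algebra B K] [IsScalarTower A B K]
      (M : Submonoid A) (_ : M ≤ nonZeroDivisors A) [IsLocalization M B],
      IsUnit (algebraMap A B f) →
      ∃ XB : Matrix (Fin n) (Fin m) (MvPolynomial (Fin r) B),
        XB.map (MvPolynomial.map (algebraMap B K)) = X ∧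
        Module.Free B ((Fin n → MvPolynomial (Fin r) B) ⧸ LinearMap.range XB.mulVecLin) := by
  obtain ⟨a, ha, u, hu⟩ := clear_den (A := A) (nonZeroDivisors A)
    (fun p : Fin n × Fin m => X p.1 p.2)
  let X0 : Matrix (Fin n) (Fin m) (MvPolynomial (Fin r) A) := Matrix.of fun i j => u (i, j)
  obtain ⟨g, hg0, hg⟩ := exists_lead (LinearMap.range X0.mulVecLin)
  refine ⟨a * g, mul_ne_zero (nonZeroDivisors.ne_zero ha) hg0, ?_⟩
  intro B _ _ _ _ M hM _ hunit
  rw [map_mul, IsUnit.mul_iff] at hunit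
  obtain ⟨hua, hug⟩ := hunit
  obtain ⟨c, hc⟩ := hua.exists_left_inv
  refine ⟨(C c : MvPolynomial (Fin r) B) • X0.map (MvPolynomial.map (algebraMap A B)), ?_, ?_⟩
  · ext i j : 2
    have h1 := hu (i, j)
    have h2 : MvPolynomial.map (algebraMap B K) (MvPolynomial.map (algebraMap A B) (u (i, j))) =
        MvPolynomial.map (algebraMap A K) (u (i, j)) := by
      rw [MvPolynomial.map_map, IsScalarTower.algebraMap_eq A B K]
    simp only [Matrix.map_apply, Matrix.smul_apply, smul_eq_mul, map_mul, map_C, X0, Matrix.of_apply]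
    rw [h2, ← h1, ← mul_assoc, ← C_mul, IsScalarTower.algebraMap_apply A B K, ← map_mul, hc,
      map_one, C_1, one_mul]
  · refine free_coker M hM X0 g hg hug _ ?_
    apply le_antisymm
    · rintro _ ⟨x, rfl⟩
      refine ⟨(C c : MvPolynomial (Fin r) B) • x, ?_⟩
      simp [Matrix.smul_mulVec, Matrix.mulVec_smul]
    · rintro _ ⟨x, rfl⟩
      refine ⟨(C (algebraMap A B a) : MvPolynomial (Fin r) B) • x, ?_⟩
      rw [Matrix.mulVecLin_apply, Matrix.mulVecLin_apply, Matrix.smul_mulVec, Matrix.mulVec_smul,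
        smul_smul, ← C_mul, hc, C_1, one_smul]

theorem isWH_map {r : ℕ} {w : Fin r → ℤ} {B K : Type*} [CommRing B] [CommRing K] (φ : B →+* K)
    {p : MvPolynomial (Fin r) B} {e : ℤ} (h : p.IsWeightedHomogeneous w e) :
    (MvPolynomial.map φ p).IsWeightedHomogeneous w e := by
  intro d hd
  apply h
  intro h0
  apply hd
  rw [coeff_map, h0, map_zero]

theorem isWH_of_map {r : ℕ} {w : Fin r → ℤ} {B K : Type*} [CommRing B] [CommRing K] (φ : B →+* K)
    (hφ : Function.Injective φ)
    {p : MvPolynomial (Fin r) B} {e : ℤ} (h : (MvPolynomial.map φ p).IsWeightedHomogeneous w e) :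
    p.IsWeightedHomogeneous w e := by
  intro d hd
  apply h
  rw [coeff_map]
  intro h0
  exact hd (hφ (by rw [h0, map_zero]))


theorem stmt18 {A : Type} [CommRing A] [IsDomain A] {r : ℕ}
    (w : Fin r → ℤ) (hw : ∀ i, 1 ≤ w i)
    {m0 m1 : ℕ} (t0 : Fin m0 → ℤ) (t1 : Fin m1 → ℤ)
    (Φ : Matrix (Fin m0) (Fin m1) (MvPolynomial (Fin r) A))
    (hΦ : ∀ a b, (Φ a b).IsWeightedHomogeneous w (t1 b - t0 a)) :
    ∃ f : A, f ≠ 0 ∧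
      -- the localized module `M_f` is flat over `A_f` . . .
      Module.Flat (Localization.Away f)
        (PresentedModule Φ (algebraMap A (Localization.Away f))) ∧
      ∃ G : GradedFreeComplexData w (Localization.Away f),
        G.IsFinite ∧ G.IsGraded ∧
        -- . . . and admits a finite graded free resolution `G` over `R_f` . . .
        G.IsResolutionOf (PresentedModule Φ (algebraMap A (Localization.Away f))) ∧
        -- . . . whose specialization at any point `y` of `Spec (A_f)` with residue field
        -- `κ` is a minimal free resolution of `M_y`:
        ∀ (κ : Type) [Field κ] (y : Localization.Away f →+* κ),
          (G.mapCoeff y).IsResolutionOf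
            (PresentedModule Φ (y.comp (algebraMap A (Localization.Away f)))) ∧
          (G.mapCoeff y).IsMinimal ∧
          -- in particular, the graded Betti numbers of `M_y` do not depend on `y`:
          ∀ i j, (G.mapCoeff y).betti i j = G.betti i j := by
  classical
  let K := FractionRing A
  let ΦK := Φ.map (MvPolynomial.map (σ := Fin r) (algebraMap A K))
  have hΦK : HMat w t0 t1 ΦK := fun a b => isWH_map _ (hΦ a b)
  obtain ⟨GK, E, hrk, hgr, hmin, hex, h0, hq⟩ := exists_min_res w hw t0 _ (HomSub.range hΦK)
  -- matrices for the isomorphism of cokernels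
  choose q hq using fun b => hq (Pi.single b 1)
  let Q : Matrix (Fin (GK.rk 0)) (Fin m0) (MvPolynomial (Fin r) K) := Matrix.of fun a b => q b a
  obtain ⟨V, hV⟩ : ∃ V : Matrix (Fin m1) (Fin m0) (MvPolynomial (Fin r) K), 1 - E * Q = ΦK * V := by
    choose V hV using hq
    refine ⟨Matrix.of fun a b => V b a, ?_⟩
    refine Matrix.ext fun a b => ?_
    have := congrFun (hV b) a
    refine Eq.trans ?_ this.symm
    simp [Matrix.one_apply, Matrix.mul_apply, Matrix.mulVec, dotProduct, Q, Pi.single_apply]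
  have h2 : 1 = E * Q + ΦK * V := by rw [← hV]; abel
  obtain ⟨T, hT⟩ := exists_factor ΦK (E * GK.d 0) (fun x => by
    rw [← Matrix.mulVec_mulVec]
    exact (h0 _).1 ⟨x, rfl⟩)
  obtain ⟨T', hT'⟩ := exists_factor (GK.d 0) (Q * ΦK) (fun x => by
    rw [h0, Matrix.mulVec_mulVec]
    refine ⟨(1 - V * ΦK).mulVec x, ?_⟩
    rw [Matrix.mulVecLin_apply, Matrix.mulVec_mulVec]
    congr 1
    rw [Matrix.mul_sub, ← Matrix.mul_assoc, ← Matrix.mul_assoc, ← hV, Matrix.mul_one,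
      Matrix.sub_mul, Matrix.one_mul]
    abel)
  obtain ⟨U, hU⟩ := exists_factor (GK.d 0) (Q * E - 1) (fun x => by
    rw [h0, Matrix.mulVec_mulVec]
    refine ⟨(-(V * E)).mulVec x, ?_⟩
    rw [Matrix.mulVecLin_apply, Matrix.mulVec_mulVec]
    congr 1
    rw [Matrix.mul_neg, ← Matrix.mul_assoc, ← hV, Matrix.mul_sub, Matrix.mul_one, Matrix.sub_mul,
      Matrix.one_mul, Matrix.mul_assoc]
    abel)
  have h4 : Q * E = 1 + GK.d 0 * U := by rw [← hU]; abel
  -- denominators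
  obtain ⟨fE, fE0, hfE⟩ := spread (A := A) E
  obtain ⟨fQ, fQ0, hfQ⟩ := spread (A := A) Q
  obtain ⟨fT, fT0, hfT⟩ := spread (A := A) T
  obtain ⟨fV, fV0, hfV⟩ := spread (A := A) V
  obtain ⟨fT', fT'0, hfT'⟩ := spread (A := A) T'
  obtain ⟨fU, fU0, hfU⟩ := spread (A := A) U
  obtain ⟨fΦ, fΦ0, hfΦ⟩ := spread (A := A) ΦK
  choose fd fd0 hfd using fun i => spread (A := A) (GK.d i)
  let f : A := fE * fQ * fT * fV * fT' * fU * fΦ * ∏ i ∈ Finset.range (r + 1), fd i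
  have hf0 : f ≠ 0 := by
    simp only [f]
    refine mul_ne_zero ?_ (Finset.prod_ne_zero_iff.2 fun i _ => fd0 i)
    simp [fE0, fQ0, fT0, fV0, fT'0, fU0, fΦ0]
  refine ⟨f, hf0, ?_⟩
  let B := Localization.Away f
  let M := Submonoid.powers f
  have hM : M ≤ nonZeroDivisors A := powers_le_nonZeroDivisors_of_noZeroDivisors hf0
  let algBK : Algebra B K := IsLocalization.localizationAlgebraOfSubmonoidLe B K M (nonZeroDivisors A) hM
  have tower : IsScalarTower A B K :=
    IsLocalization.localization_isScalarTower_of_submonoid_le B K M (nonZeroDivisors A) hM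
  have domB : IsDomain B := IsLocalization.isDomain_localization hM
  have frac : IsFractionRing B K :=
    IsFractionRing.isFractionRing_of_isDomain_of_isLocalization M B K
  have hinj : Function.Injective (algebraMap B K) := IsFractionRing.injective B K
  have hunit : IsUnit (algebraMap A B f) := IsLocalization.Away.algebraMap_isUnit f
  have hunit' := hunit
  simp only [f, map_mul, IsUnit.mul_iff] at hunit'
  obtain ⟨⟨⟨⟨⟨⟨⟨uE, uQ⟩, uT⟩, uV⟩, uT'⟩, uU⟩, uΦ⟩, ud⟩ := hunit'
  obtain ⟨EB, hEB, -⟩ := hfE B M hM uE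
  obtain ⟨QB, hQB, -⟩ := hfQ B M hM uQ
  obtain ⟨TB, hTB, -⟩ := hfT B M hM uT
  obtain ⟨VB, hVB, -⟩ := hfV B M hM uV
  obtain ⟨TB', hTB', -⟩ := hfT' B M hM uT'
  obtain ⟨UB, hUB, -⟩ := hfU B M hM uU
  obtain ⟨ΦB, hΦB, flatΦ⟩ := hfΦ B M hM uΦ
  have eΦ : ΦB = Φ.map (MvPolynomial.map (algebraMap A B)) := by
    apply map_map_inj hinj
    rw [hΦB]
    ext i j : 2
    simp only [ΦK, Matrix.map_apply, MvPolynomial.map_map]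
    rw [IsScalarTower.algebraMap_eq A B K]
  have hd : ∀ i, ∃ XB : Matrix (Fin (GK.rk i)) (Fin (GK.rk (i+1))) (MvPolynomial (Fin r) B),
        XB.map (MvPolynomial.map (algebraMap B K)) = GK.d i ∧
        Module.Free B ((Fin (GK.rk i) → MvPolynomial (Fin r) B) ⧸
          LinearMap.range XB.mulVecLin) := by
    intro i
    by_cases hi : i < r + 1
    · refine hfd i B M hM ?_
      exact isUnit_of_dvd_unit
        (map_dvd _ (Finset.dvd_prod_of_mem fd (Finset.mem_range.2 hi))) ud
    · have : IsEmpty (Fin (GK.rk i)) := by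
        rw [hrk i (by omega)]; infer_instance
      refine ⟨0, ?_, ?_⟩
      · ext a; exact isEmptyElim a
      · have : Subsingleton ((Fin (GK.rk i) → MvPolynomial (Fin r) B) ⧸ LinearMap.range
          (0 : Matrix (Fin (GK.rk i)) (Fin (GK.rk (i+1))) (MvPolynomial (Fin r) B)).mulVecLin) :=
          (Submodule.mkQ_surjective _).subsingleton
        exact Module.Free.of_subsingleton _ _
  choose dB hdB hfree using hd
  have i1 : EB * dB 0 = ΦB * TB := by
    apply map_map_inj hinj
    rw [Matrix.map_mul, Matrix.map_mul, hEB, hdB, hΦB, hTB, hT]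
  have i2 : 1 = EB * QB + ΦB * VB := by
    apply map_map_inj hinj
    rw [Matrix.map_add _ (map_add _), Matrix.map_mul, Matrix.map_mul, hEB, hQB, hΦB, hVB, ← h2,
      Matrix.map_one _ (map_zero _) (map_one _)]
  have i3 : QB * ΦB = dB 0 * TB' := by
    apply map_map_inj hinj
    rw [Matrix.map_mul, Matrix.map_mul, hQB, hdB, hΦB, hTB', hT']
  have i4 : QB * EB = 1 + dB 0 * UB := by
    apply map_map_inj hinj
    rw [Matrix.map_add _ (map_add _), Matrix.map_mul, Matrix.map_mul, hEB, hQB, hdB, hUB, h4,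
      Matrix.map_one _ (map_zero _) (map_one _)]
  have exB : ∀ i, LinearMap.range (dB (i + 1)).mulVecLin = LinearMap.ker (dB i).mulVecLin := by
    intro i
    refine exact_descend (K := K) _ _ ?_ (hfree (i+1))
    rw [hdB, hdB]
    exact hex i
  have minB : ∀ i a b, MvPolynomial.constantCoeff (dB i a b) = 0 := by
    intro i a b
    apply hinj
    have := hmin i a b
    rw [← hdB, Matrix.map_apply, MvPolynomial.constantCoeff_map] at this
    rw [this, map_zero]
  refine ⟨?_, ⟨GK.rk, GK.tw, dB⟩, ⟨r, hrk⟩, ?_, ⟨exB, ?_⟩, ?_⟩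
  · rw [eΦ] at flatΦ
    exact Module.Flat.of_free
  · intro i a b
    apply isWH_of_map _ hinj
    have := hgr i a b
    rw [← hdB] at this
    exact this
  · have := coker_equiv ΦB (dB 0) EB QB TB VB TB' UB i1 i2 i3 i4
    rw [eΦ] at this
    exact this
  · intro κ _ y
    refine ⟨⟨fun i => exact_basechange y _ _ (exB i) (hfree i), ?_⟩, ?_, fun i j => rfl⟩
    · have e : Φ.map (MvPolynomial.map (y.comp (algebraMap A B))) =
          ΦB.map (MvPolynomial.map y) := by
        rw [eΦ]
        ext i j : 2
        simp only [Matrix.map_apply, MvPolynomial.map_map]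
      have := coker_equiv (ΦB.map (MvPolynomial.map y)) ((dB 0).map (MvPolynomial.map y))
        (EB.map (MvPolynomial.map y)) (QB.map (MvPolynomial.map y)) (TB.map (MvPolynomial.map y))
        (VB.map (MvPolynomial.map y)) (TB'.map (MvPolynomial.map y)) (UB.map (MvPolynomial.map y))
        (by rw [← Matrix.map_mul, ← Matrix.map_mul, i1])
        (by rw [← Matrix.map_mul, ← Matrix.map_mul, ← Matrix.map_add _ (map_add _), ← i2,
              Matrix.map_one _ (map_zero _) (map_one _)])
        (by rw [← Matrix.map_mul, ← Matrix.map_mul, i3])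
        (by rw [← Matrix.map_mul, ← Matrix.map_mul, i4, Matrix.map_add _ (map_add _),
              Matrix.map_one _ (map_zero _) (map_one _)])
      rw [← e] at this
      exact this
    · intro i a b
      have h := minB i a b
      change MvPolynomial.constantCoeff (MvPolynomial.map y (dB i a b)) = 0
      rw [MvPolynomial.constantCoeff_map, h, map_zero]
end

section
/- Fix positive integers d_1, ..., d_r. There exists an integer N = N(d_1,...,d_r) such that for every perfect field k, every n, and all homogeneous polynomials f_1, ..., f_r ∈ k[x_1,...,x_n] of degrees d_1, ..., d_r with collective strength at least N, the elements f_1, ..., f_r form a regular sequence. -/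
open MvPolynomial

/-- `f` admits a decomposition as a sum of at most `N` products of pairs of homogeneous
polynomials of positive degree, i.e. `f` has strength `< N` (strength `≤ N - 1`). -/
def HasStrengthDecomp {k : Type*} [Field k] {σ : Type*} (N : ℕ)
    (f : MvPolynomial σ k) : Prop :=
  ∃ (m : ℕ), m ≤ N ∧ ∃ g h : Fin m → MvPolynomial σ k,
    (∀ i, ∃ a, 0 < a ∧ (g i).IsHomogeneous a) ∧
    (∀ i, ∃ a, 0 < a ∧ (h i).IsHomogeneous a) ∧
    f = ∑ i, g i * h i

/-- `f₁,…,f_r` (homogeneous of degrees `d i`) have collective strength at least `N`: no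
nontrivial homogeneous `k`-linear combination of them is a sum of at most `N` products of
positive-degree homogeneous elements. -/
def CollectiveStrengthGE {k : Type*} [Field k] {σ : Type*} {r : ℕ} (N : ℕ)
    (d : Fin r → ℕ) (f : Fin r → MvPolynomial σ k) : Prop :=
  ∀ c : Fin r → k, c ≠ 0 →
    (∀ i j, c i ≠ 0 → c j ≠ 0 → d i = d j) →   -- the combination is homogeneous
    ¬ HasStrengthDecomp N (∑ i, MvPolynomial.C (c i) * f i)

section Piece1
open MvPolynomial

/-- A (possibly incomplete) graded algebra with projections and translations. -/
structure GData (k R J : Type*) [Field k] [CommRing R] [Algebra k R] where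
  S : ℕ → Submodule k R
  mul_mem : ∀ {i j : ℕ} {a b : R}, a ∈ S i → b ∈ S j → a * b ∈ S (i + j)
  zero_ex : ∀ x ∈ S 0, ∃ c : k, algebraMap k R c = x
  alg_mem : ∀ c : k, algebraMap k R c ∈ S 0
  π : ℕ → R →ₗ[k] R
  π_same : ∀ {e : ℕ} {x : R}, x ∈ S e → π e x = x
  π_ne : ∀ {e i : ℕ} {x : R}, x ∈ S i → i ≠ e → π e x = 0
  τ : J → R →+* PowerSeries R
  τ_alg : ∀ j c, τ j (algebraMap k R c) = PowerSeries.C (algebraMap k R c)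
  τ_zero : ∀ j x, PowerSeries.coeff 0 (τ j x) = x
  τ_mem : ∀ j {e n : ℕ} {x : R}, x ∈ S e → n ≤ e → PowerSeries.coeff n (τ j x) ∈ S (e - n)
  τ_gt : ∀ j {e n : ℕ} {x : R}, x ∈ S e → e < n → PowerSeries.coeff n (τ j x) = 0
  inv : ∀ {e : ℕ} {x : R}, x ∈ S e → 0 < e →
    (∀ j n, 0 < n → PowerSeries.coeff n (τ j x) = 0) → x = 0

namespace GData

variable {k R J ι : Type*} [Field k] [CommRing R] [Algebra k R] (G : GData k R J)

/-- decomposables -/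
def Dec : Submodule k R :=
  Submodule.span k {x | ∃ i j a b, 0 < i ∧ 0 < j ∧ a ∈ G.S i ∧ b ∈ G.S j ∧ x = a * b}

variable {G} {u : ι → R} {w : ι → ℕ}

lemma prod_mem (hu : ∀ i, u i ∈ G.S (w i)) (d : ι →₀ ℕ) :
    (d.prod fun i n => u i ^ n) ∈ G.S (Finsupp.weight w d) := by
  classical
  induction d using Finsupp.induction_linear with
  | zero => simpa using G.alg_mem 1
  | add f g hf hg =>
    rw [Finsupp.prod_add_index' (by simp) (by intros; rw [pow_add]), map_add]
    exact G.mul_mem hf hg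
  | single i n =>
    rw [Finsupp.prod_single_index (by simp)]
    induction n with
    | zero => simpa using G.alg_mem 1
    | succ n ih =>
      rw [pow_succ, Finsupp.single_add, map_add]
      refine G.mul_mem ih ?_
      simpa [Finsupp.weight_single] using hu i

lemma psi_mem (hu : ∀ i, u i ∈ G.S (w i)) {F : MvPolynomial ι k} {e : ℕ}
    (hF : F.IsWeightedHomogeneous w e) : aeval u F ∈ G.S e := by
  induction hF using IsWeightedHomogeneous.induction_on with
  | zero => simp
  | add p q hp hq h1 h2 => rw [map_add]; exact add_mem h1 h2
  | monomial d r hr =>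
    rw [aeval_monomial, ← hr, ← Algebra.smul_def]
    exact Submodule.smul_mem _ _ (prod_mem hu d)

lemma gen (hu : ∀ i, u i ∈ G.S (w i))
    (hsp : ∀ e, 0 < e → ∀ x ∈ G.S e, G.Dec.mkQ x ∈ Submodule.span k (Set.range (G.Dec.mkQ ∘ u)))
    (e : ℕ) : ∀ x ∈ G.S e, ∃ F : MvPolynomial ι k, F.IsWeightedHomogeneous w e ∧ aeval u F = x := by
  induction e using Nat.strong_induction_on with
  | _ e ih =>
  intro x hx
  rcases Nat.eq_zero_or_pos e with rfl | he
  · obtain ⟨c, rfl⟩ := G.zero_ex x hx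
    exact ⟨C c, isWeightedHomogeneous_C w c, by simp⟩
  let T : Submodule k R := (weightedHomogeneousSubmodule k w e).map (aeval u).toLinearMap
  suffices h : G.π e x ∈ T by
    obtain ⟨F, hF, h⟩ := h
    exact ⟨F, hF, by simpa [G.π_same hx] using h⟩
  have hdec : G.Dec ≤ T.comap (G.π e) := by
    refine Submodule.span_le.mpr ?_
    rintro _ ⟨i, j, a, b, hi, hj, ha, hb, rfl⟩
    have hab := G.mul_mem ha hb
    by_cases hij : i + j = e
    · subst hij
      obtain ⟨A, hA, rfl⟩ := ih i (by omega) a ha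
      obtain ⟨B, hB, rfl⟩ := ih j (by omega) b hb
      refine ⟨A * B, hA.mul hB, ?_⟩
      rw [G.π_same hab]; simp
    · change G.π e _ ∈ T
      rw [G.π_ne hab hij]; exact zero_mem _
  have hsp' := hsp e he x hx
  rw [Set.range_comp, ← Submodule.map_span] at hsp'
  obtain ⟨y, hy, hxy⟩ := hsp'
  have h1 : x - y ∈ G.Dec := by
    rw [← Submodule.ker_mkQ G.Dec, LinearMap.mem_ker, map_sub, hxy, sub_self]
  have h2 : Submodule.span k (Set.range u) ≤ T.comap (G.π e) := by
    refine Submodule.span_le.mpr ?_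
    rintro _ ⟨i, rfl⟩
    by_cases hij : w i = e
    · refine ⟨X i, ?_, ?_⟩
      · rw [← hij]; exact isWeightedHomogeneous_X k w i
      · rw [G.π_same (hij ▸ hu i)]; simp
    · change G.π e _ ∈ T
      rw [G.π_ne (hu i) hij]; exact zero_mem _
  have := add_mem (hdec h1) (h2 hy)
  simpa using this

lemma lin_part (hw : ∀ i, 0 < w i) (hu : ∀ i, u i ∈ G.S (w i))
    (hli : LinearIndependent k (fun i => G.Dec.mkQ (u i)))
    {F : MvPolynomial ι k} {e : ℕ} (he : 0 < e) (hF : F.IsWeightedHomogeneous w e)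
    (h0 : aeval u F = 0) (i : ι) : coeff (Finsupp.single i 1) F = 0 := by
  classical
  let L : MvPolynomial ι k → (ι →₀ k) := fun F =>
    Finsupp.comapDomain (fun i : ι => Finsupp.single i 1) (AddMonoidAlgebra.coeff F)
      (Function.Injective.injOn (Finsupp.single_left_injective one_ne_zero))
  have hL : ∀ F i, L F i = coeff (Finsupp.single i 1) F := fun F i => rfl
  have key : G.Dec.mkQ (aeval u F) =
      Finsupp.linearCombination k (fun i => G.Dec.mkQ (u i)) (L F) := by
    clear h0
    induction hF using IsWeightedHomogeneous.induction_on with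
    | zero =>
      have : L 0 = 0 := by ext i; simp [hL]
      rw [this]; simp
    | add p q hp hq h1 h2 =>
      have : L (p + q) = L p + L q := by ext i; simp [hL]
      rw [this, map_add, map_add, map_add, h1, h2]
    | monomial d r hr =>
      have hd : d ≠ 0 := by rintro rfl; simp at hr; omega
      obtain ⟨l, hl⟩ := Finsupp.ne_iff.mp hd
      simp only [Finsupp.coe_zero, Pi.zero_apply] at hl
      obtain ⟨d', rfl⟩ : ∃ d', d = Finsupp.single l 1 + d' := by
        refine exists_add_of_le ?_
        rw [Finsupp.single_le_iff]; omega
      by_cases hd' : d' = 0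
      · subst hd'
        have : L (monomial (Finsupp.single l 1 + 0) r) = Finsupp.single l r := by
          ext i
          rw [hL, add_zero, coeff_monomial, Finsupp.single_apply]
          simp [Finsupp.single_left_inj]
        rw [this]
        simp [aeval_monomial, ← Algebra.smul_def]
      · have : L (monomial (Finsupp.single l 1 + d') r) = 0 := by
          ext i
          rw [hL, coeff_monomial, if_neg]; · rfl
          intro h
          apply hd'
          have h1 := congrArg Finsupp.degree h
          simp at h1
          exact (Finsupp.degree_eq_zero_iff d').mp h1
        rw [this, map_zero, ← LinearMap.mem_ker, Submodule.ker_mkQ, aeval_monomial,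
          ← Algebra.smul_def]
        refine Submodule.smul_mem _ _ (Submodule.subset_span ?_)
        refine ⟨w l, Finsupp.weight w d', u l, d'.prod fun i n => u i ^ n, hw l, ?_, hu l,
          prod_mem hu d', ?_⟩
        · rw [pos_iff_ne_zero]
          intro h
          apply hd'
          have : Finsupp.NonTorsionWeight ℕ w := Finsupp.nonTorsionWeight_of ℕ w (fun s => (hw s).ne')
          exact (Finsupp.weight_eq_zero_iff_eq_zero w).mp h
        · rw [Finsupp.prod_add_index' (by simp) (by intros; rw [pow_add])]
          simp
  rw [h0, map_zero] at key
  have h2 := (linearIndependent_iff.mp hli) (L F) key.symm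
  rw [← hL, h2]; rfl

end GData
end Piece1

section Piece2
open MvPolynomial

namespace GData

lemma exists_root {k ι : Type*} [Field k] {p : ℕ} [Fact p.Prime] [CharP k p] [PerfectField k]
    {w : ι → ℕ} {F : MvPolynomial ι k} {D : ℕ} (hF : F.IsWeightedHomogeneous w D)
    (h : ∀ m, coeff m F ≠ 0 → ∀ i, p ∣ m i) :
    ∃ G : MvPolynomial ι k, G.IsWeightedHomogeneous w (D / p) ∧ G ^ p = F := by
  classical
  have hp : p.Prime := Fact.out
  have : ExpChar k p := ExpChar.prime hp
  have : CharP (MvPolynomial ι k) p := inferInstance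
  have : PerfectRing k p := PerfectField.toPerfectRing p
  choose rt hrt using fun c : k => surjective_frobenius k p c
  let q : (ι →₀ ℕ) → (ι →₀ ℕ) := fun m => m.mapRange (· / p) (Nat.zero_div p)
  have hq : ∀ m ∈ F.support, p • q m = m := by
    intro m hm
    ext i
    have := h m (mem_support_iff.mp hm) i
    simp [q, Nat.mul_div_cancel' this]
  refine ⟨∑ m ∈ F.support, monomial (q m) (rt (coeff m F)), ?_, ?_⟩
  · refine IsWeightedHomogeneous.sum _ _ _ fun m hm => isWeightedHomogeneous_monomial _ _ _ ?_
    have h1 := hF (mem_support_iff.mp hm)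
    rw [← hq m hm, map_nsmul] at h1
    rw [← h1, smul_eq_mul, Nat.mul_div_cancel_left _ hp.pos]
  · rw [sum_pow_char p]
    conv_rhs => rw [F.as_sum]
    refine Finset.sum_congr rfl fun m hm => ?_
    rw [monomial_pow, hq m hm]
    congr 1
    exact hrt _

variable {k R J ι : Type*} [Field k] [CommRing R] [Algebra k R] {G : GData k R J}
  {u : ι → R} {w : ι → ℕ}

/-- apply a partial derivative to all coefficients of a power series -/
noncomputable def pdc (i : ι) (P : PowerSeries (MvPolynomial ι k)) :
    PowerSeries (MvPolynomial ι k) := PowerSeries.mk fun n => pderiv i (PowerSeries.coeff n P)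

lemma pdc_add (i : ι) (P Q : PowerSeries (MvPolynomial ι k)) :
    pdc i (P + Q) = pdc i P + pdc i Q := by ext1 n; simp [pdc]

lemma pdc_mul (i : ι) (P Q : PowerSeries (MvPolynomial ι k)) :
    pdc i (P * Q) = pdc i P * Q + P * pdc i Q := by
  ext1 n
  simp only [pdc, PowerSeries.coeff_mk, PowerSeries.coeff_mul, map_add, map_sum, pderiv_mul,
    Finset.sum_add_distrib]

lemma pdc_C (i : ι) (c : MvPolynomial ι k) : pdc i (PowerSeries.C c) = PowerSeries.C (pderiv i c) := by
  ext1 n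
  simp only [pdc, PowerSeries.coeff_mk, PowerSeries.coeff_C]
  split_ifs <;> simp

lemma chain (T : MvPolynomial ι k →+* PowerSeries (MvPolynomial ι k))
    (hT : ∀ c, T (C c) = PowerSeries.C (C c)) (i : ι) (F : MvPolynomial ι k) :
    ∃ s0 : Finset ι, ∀ s, s0 ⊆ s →
      pdc i (T F) = ∑ j ∈ s, T (pderiv j F) * pdc i (T (X j)) := by
  classical
  induction F using MvPolynomial.induction_on with
  | C c => exact ⟨∅, fun s _ => by simp [hT, pdc_C]⟩
  | add p q hp hq =>
    obtain ⟨s1, h1⟩ := hp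
    obtain ⟨s2, h2⟩ := hq
    refine ⟨s1 ∪ s2, fun s hs => ?_⟩
    rw [map_add, pdc_add, h1 s (Finset.union_subset_left hs), h2 s (Finset.union_subset_right hs),
      ← Finset.sum_add_distrib]
    refine Finset.sum_congr rfl fun j _ => ?_
    rw [map_add, map_add, add_mul]
  | mul_X p l hp =>
    obtain ⟨s1, h1⟩ := hp
    refine ⟨insert l s1, fun s hs => ?_⟩
    rw [map_mul, pdc_mul, h1 s ((Finset.subset_insert _ _).trans hs)]
    have hl : l ∈ s := hs (Finset.mem_insert_self _ _)
    simp only [pderiv_mul, map_add, map_mul, add_mul, Finset.sum_add_distrib]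
    congr 1
    · rw [Finset.sum_mul]
      exact Finset.sum_congr rfl fun j _ => by ring
    · rw [Finset.sum_eq_single l]
      · simp
      · intro j _ hj
        rw [pderiv_X_of_ne hj.symm]; simp
      · exact fun h => absurd hl h

/-- homogeneity for power series of polynomials: coefficient `n` has degree `e - n`. -/
def HP (w : ι → ℕ) (e : ℕ) (P : PowerSeries (MvPolynomial ι k)) : Prop :=
  ∀ n, (n ≤ e → (PowerSeries.coeff n P).IsWeightedHomogeneous w (e - n)) ∧
    (e < n → PowerSeries.coeff n P = 0)

lemma HP.mul {e f : ℕ} {P Q : PowerSeries (MvPolynomial ι k)} (hP : HP w e P) (hQ : HP w f Q) :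
    HP w (e + f) (P * Q) := by
  intro n
  rw [PowerSeries.coeff_mul]
  constructor
  · intro hn
    refine IsWeightedHomogeneous.sum _ _ _ ?_
    rintro ⟨a, b⟩ hab
    rw [Finset.HasAntidiagonal.mem_antidiagonal] at hab
    simp only at hab ⊢
    by_cases ha : a ≤ e
    · by_cases hb : b ≤ f
      · have := ((hP a).1 ha).mul ((hQ b).1 hb)
        rwa [show e - a + (f - b) = e + f - n by omega] at this
      · rw [(hQ b).2 (by omega), mul_zero]; exact isWeightedHomogeneous_zero _ _ _
    · rw [(hP a).2 (by omega), zero_mul]; exact isWeightedHomogeneous_zero _ _ _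
  · intro hn
    refine Finset.sum_eq_zero ?_
    rintro ⟨a, b⟩ hab
    rw [Finset.HasAntidiagonal.mem_antidiagonal] at hab
    simp only at hab ⊢
    by_cases ha : a ≤ e
    · rw [(hQ b).2 (by omega), mul_zero]
    · rw [(hP a).2 (by omega), zero_mul]

lemma HP.C (c : k) : HP w 0 (PowerSeries.C (C c : MvPolynomial ι k)) := by
  intro n
  constructor
  · intro hn
    obtain rfl : n = 0 := by omega
    simpa using isWeightedHomogeneous_C w c
  · intro hn
    rw [PowerSeries.coeff_C, if_neg (by omega)]

lemma HP.monom (T : MvPolynomial ι k →+* PowerSeries (MvPolynomial ι k))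
    (hT : ∀ c, T (MvPolynomial.C c) = PowerSeries.C (MvPolynomial.C c))
    (hX : ∀ i, HP w (w i) (T (X i))) (d : ι →₀ ℕ) (c : k) :
    HP w (Finsupp.weight w d) (T (monomial d c)) := by
  classical
  induction d using Finsupp.induction_linear generalizing c with
  | zero => 
    have := HP.C (w := w) c
    rw [← hT] at this
    simpa using! this
  | add f g hf hg =>
    have : (monomial (f + g) c : MvPolynomial ι k) = monomial f c * monomial g 1 := by
      rw [monomial_mul, mul_one]
    rw [this, map_mul, map_add]
    exact (hf c).mul (hg 1)
  | single i n =>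
    induction n with
    | zero =>
      have := HP.C (w := w) c
      rw [← hT] at this
      simpa using! this
    | succ n ih =>
      have : (monomial (Finsupp.single i (n+1)) c : MvPolynomial ι k)
          = monomial (Finsupp.single i n) c * X i := by
        rw [X, monomial_mul, mul_one, ← Finsupp.single_add]
      rw [this, map_mul, Finsupp.single_add, map_add]
      refine ih.mul ?_
      simpa [Finsupp.weight_single] using hX i

lemma HP.whom (T : MvPolynomial ι k →+* PowerSeries (MvPolynomial ι k))
    (hT : ∀ c, T (MvPolynomial.C c) = PowerSeries.C (MvPolynomial.C c))
    (hX : ∀ i, HP w (w i) (T (X i))) {F : MvPolynomial ι k} {e : ℕ}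
    (hF : F.IsWeightedHomogeneous w e) : HP w e (T F) := by
  induction hF using IsWeightedHomogeneous.induction_on with
  | zero => intro n; simp [isWeightedHomogeneous_zero]
  | add p q hp hq h1 h2 =>
    intro n
    rw [map_add, map_add]
    exact ⟨fun hn => ((h1 n).1 hn).add ((h2 n).1 hn), fun hn => by
      rw [(h1 n).2 hn, (h2 n).2 hn, add_zero]⟩
  | monomial d r hr => rw [← hr]; exact HP.monom T hT hX d r

lemma pderiv_low {F : MvPolynomial ι k} {e : ℕ} (hF : F.IsWeightedHomogeneous w e) {i : ι}
    (hi : e < w i) : pderiv i F = 0 := by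
  ext m
  rw [coeff_pderiv, hF.coeff_eq_zero, zero_mul, coeff_zero]
  rw [map_add, Finsupp.weight_single]
  simp; omega

end GData
end Piece2

section Piece3
open MvPolynomial

namespace GData
variable {k R J ι : Type*} [Field k] [CommRing R] [Algebra k R] {G : GData k R J}
  {u : ι → R} {w : ι → ℕ}

lemma whom_zero (hw : ∀ i, 0 < w i) {F : MvPolynomial ι k} (hF : F.IsWeightedHomogeneous w 0) :
    F = C (coeff 0 F) := by
  classical
  ext m
  rw [coeff_C]
  split_ifs with h
  · rw [h]
  · refine hF.coeff_eq_zero m ?_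
    have : Finsupp.NonTorsionWeight ℕ w := Finsupp.nonTorsionWeight_of ℕ w (fun s => (hw s).ne')
    rw [Ne, Finsupp.weight_eq_zero_iff_eq_zero w]
    exact fun h' => h h'.symm

lemma pderiv_whom {F : MvPolynomial ι k} {e : ℕ} (hF : F.IsWeightedHomogeneous w e) (i : ι) :
    (pderiv i F).IsWeightedHomogeneous w (e - w i) := by
  intro m hm
  rw [coeff_pderiv] at hm
  have := hF (left_ne_zero_of_mul hm)
  rw [map_add, Finsupp.weight_single] at this
  simp at this; omega

lemma exists_T (hu : ∀ i, u i ∈ G.S (w i))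
    (hsp : ∀ e, 0 < e → ∀ x ∈ G.S e, G.Dec.mkQ x ∈ Submodule.span k (Set.range (G.Dec.mkQ ∘ u)))
    (j : J) : ∃ T : MvPolynomial ι k →+* PowerSeries (MvPolynomial ι k),
      (∀ c, T (C c) = PowerSeries.C (C c)) ∧ (∀ i, HP w (w i) (T (X i))) ∧
      (∀ F, PowerSeries.coeff 0 (T F) = F) ∧
      (∀ F n, aeval u (PowerSeries.coeff n (T F)) = PowerSeries.coeff n (G.τ j (aeval u F))) := by
  classical
  have h1 : ∀ i n, ∃ P : MvPolynomial ι k, n ≤ w i → (P.IsWeightedHomogeneous w (w i - n) ∧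
      aeval u P = PowerSeries.coeff n (G.τ j (u i))) := by
    intro i n
    by_cases h : n ≤ w i
    · obtain ⟨P, hP⟩ := gen hu hsp _ _ (G.τ_mem j (hu i) h)
      exact ⟨P, fun _ => hP⟩
    · exact ⟨0, fun h' => absurd h' h⟩
  choose P hP using h1
  let T : MvPolynomial ι k →+* PowerSeries (MvPolynomial ι k) :=
    eval₂Hom ((PowerSeries.C).comp C) (fun i => PowerSeries.mk fun n =>
      if n = 0 then X i else if n ≤ w i then P i n else 0)
  have hTC : ∀ c, T (C c) = PowerSeries.C (C c) := fun c => by simp [T]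
  have hTX : ∀ i n, PowerSeries.coeff n (T (X i)) =
      if n = 0 then X i else if n ≤ w i then P i n else 0 := fun i n => by simp [T]
  refine ⟨T, hTC, ?_, ?_, ?_⟩
  · intro i n
    rw [hTX]
    constructor
    · intro hn
      split_ifs with h
      · subst h; exact isWeightedHomogeneous_X k w i
      · exact (hP i n hn).1
    · intro hn
      rw [if_neg (by omega), if_neg (by omega)]
  · intro F
    have : ((PowerSeries.constantCoeff).comp T) = RingHom.id _ := by
      apply MvPolynomial.ringHom_ext
      · intro c; simp [hTC]
      · intro i
        have := hTX i 0
        simpa using this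
    have := RingHom.congr_fun this F
    simpa using this
  · intro F n
    have : ((PowerSeries.map (aeval u : MvPolynomial ι k →ₐ[k] R).toRingHom).comp T) =
        (G.τ j).comp (aeval u : MvPolynomial ι k →ₐ[k] R).toRingHom := by
      apply MvPolynomial.ringHom_ext
      · intro c; simp [hTC, G.τ_alg]
      · intro i
        ext n
        simp only [RingHom.comp_apply, PowerSeries.coeff_map, hTX]
        split_ifs with h h'
        · subst h; simp [G.τ_zero]
        · simpa using (hP i n h').2
        · simp [G.τ_gt j (hu i) (not_le.mp h')]
    have := congrArg (PowerSeries.coeff n) (RingHom.congr_fun this F)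
    simpa using this

theorem inj [PerfectField k] [IsReduced R] [Nontrivial R] (hw : ∀ i, 0 < w i)
    (hu : ∀ i, u i ∈ G.S (w i))
    (hli : LinearIndependent k (fun i => G.Dec.mkQ (u i)))
    (hsp : ∀ e, 0 < e → ∀ x ∈ G.S e, G.Dec.mkQ x ∈ Submodule.span k (Set.range (G.Dec.mkQ ∘ u)))
    (D : ℕ) : ∀ F : MvPolynomial ι k, F.IsWeightedHomogeneous w D → aeval u F = 0 → F = 0 := by
  classical
  induction D using Nat.strong_induction_on with
  | _ D ih =>
  intro F hF h0
  rcases Nat.eq_zero_or_pos D with rfl | hD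
  · have := whom_zero hw hF
    rw [this] at h0
    rw [this]
    simp only [algHom_C, map_eq_zero] at h0
    rw [h0, map_zero]
  -- translations
  have hTF : ∀ j, ∃ T : MvPolynomial ι k →+* PowerSeries (MvPolynomial ι k),
      (∀ c, T (C c) = PowerSeries.C (C c)) ∧ (∀ i, HP w (w i) (T (X i))) ∧
      (∀ F, PowerSeries.coeff 0 (T F) = F) ∧
      (∀ F n, aeval u (PowerSeries.coeff n (T F)) = PowerSeries.coeff n (G.τ j (aeval u F))) ∧
      T F = PowerSeries.C F := by
    intro j
    obtain ⟨T, h1, h2, h3, h4⟩ := exists_T hu hsp j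
    refine ⟨T, h1, h2, h3, h4, ?_⟩
    ext1 n
    rcases Nat.eq_zero_or_pos n with rfl | hn
    · rw [h3]; simp
    rw [PowerSeries.coeff_C, if_neg hn.ne']
    have h5 := HP.whom T h1 h2 hF n
    by_cases hnD : n ≤ D
    · refine ih (D - n) (by omega) _ (h5.1 hnD) ?_
      rw [h4, h0]; simp
    · exact h5.2 (by omega)
  by_cases hall : ∀ i, pderiv i F = 0
  · obtain ⟨p, hp⟩ := CharP.exists k
    have hdiv : ∀ m, coeff m F ≠ 0 → ∀ i, p ∣ m i := by
      intro m hm i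
      by_cases hmi : m i = 0
      · rw [hmi]; exact dvd_zero _
      have h1 := congrArg (coeff (m - Finsupp.single i 1)) (hall i)
      have h2 : m - Finsupp.single i 1 + Finsupp.single i 1 = m :=
        tsub_add_cancel_of_le (by rw [Finsupp.single_le_iff]; omega)
      rw [coeff_pderiv, h2, coeff_zero] at h1
      have h3 := (mul_eq_zero.mp h1).resolve_left hm
      rw [← CharP.cast_eq_zero_iff k p, ← h3]
      have : m i = (m i - 1) + 1 := by omega
      conv_lhs => rw [this]
      simp
    rcases CharP.char_is_prime_or_zero k p with hpp | rfl
    · have : Fact p.Prime := ⟨hpp⟩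
      obtain ⟨H, hH, rfl⟩ := exists_root hF hdiv
      have : aeval u H = 0 := by
        rw [map_pow] at h0
        exact pow_eq_zero_iff hpp.ne_zero |>.mp h0
      rw [ih (D / p) (Nat.div_lt_self hD hpp.one_lt) H hH this, zero_pow hpp.ne_zero]
    · ext m
      rw [coeff_zero]
      by_contra hm
      have h1 := hdiv m hm
      have : m = 0 := by ext i; simpa using h1 i
      have h2 := hF hm
      rw [this] at h2
      simp at h2; omega
  · exfalso
    push Not at hall
    have hex : ∃ m, ∃ i, pderiv i F ≠ 0 ∧ D - w i = m := ⟨_, hall.choose, hall.choose_spec, rfl⟩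
    obtain ⟨i, hi, hmi⟩ := Nat.find_spec hex
    have hle : ∀ l, pderiv l F ≠ 0 → w l ≤ D := fun l hl => by
      by_contra h
      exact hl (pderiv_low hF (by omega))
    have hmax : ∀ l, pderiv l F ≠ 0 → w l ≤ w i := by
      intro l hl
      have := Nat.find_min' hex ⟨l, hl, rfl⟩
      have := hle l hl
      have := hle i hi
      omega
    have hhom := pderiv_whom hF i
    have hfix : ∀ j n, 0 < n → PowerSeries.coeff n (G.τ j (aeval u (pderiv i F))) = 0 := by
      intro j n hn
      obtain ⟨T, h1, h2, h3, h4, h5⟩ := hTF j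
      rw [← h4]
      obtain ⟨s0, hs⟩ := chain T h1 i F
      have hs := hs (insert i s0) (Finset.subset_insert _ _)
      rw [Finset.sum_eq_single i, h5, pdc_C] at hs
      · have hone : pdc i (T (X i)) = 1 := by
          ext1 n
          rw [pdc, PowerSeries.coeff_mk]
          rcases Nat.eq_zero_or_pos n with rfl | hn
          · rw [h3]; simp
          rw [PowerSeries.coeff_one, if_neg hn.ne']
          by_cases hnw : n ≤ w i
          · exact pderiv_low ((h2 i n).1 hnw) (by omega)
          · rw [(h2 i n).2 (by omega), map_zero]
        rw [hone, mul_one] at hs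
        rw [← hs, PowerSeries.coeff_C, if_neg hn.ne', map_zero]
      · intro l _ hl
        by_cases hl0 : pderiv l F = 0
        · rw [hl0]; simp
        have hwl := hmax l hl0
        have hz : pdc i (T (X l)) = 0 := by
          ext1 n
          rw [pdc, PowerSeries.coeff_mk]
          rcases Nat.eq_zero_or_pos n with rfl | hn
          · rw [h3, pderiv_X_of_ne hl]; simp
          by_cases hnw : n ≤ w l
          · exact pderiv_low ((h2 l n).1 hnw) (by have := hw l; omega)
          · rw [(h2 l n).2 (by omega), map_zero, map_zero]
        rw [hz, mul_zero]
      · intro h; exact absurd (Finset.mem_insert_self _ _) h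
    rcases Nat.eq_zero_or_pos (D - w i) with hz | hpos
    · rw [hz] at hhom
      apply hi
      rw [whom_zero hw hhom, coeff_pderiv, zero_add, lin_part hw hu hli hD hF h0 i]
      simp
    · exact hi (ih _ (by have := hw i; omega) _ hhom (G.inv (psi_mem hu hhom) hpos hfix))

end GData
end Piece3

section Piece4
open MvPolynomial

attribute [local instance] MvPolynomial.algebraMvPolynomial

lemma chain_le_dim {A B : Type*} [CommRing A] [IsDomain A] [CommRing B] {h r : ℕ}
    (φ : MvPolynomial (Fin h) A →+* B) (hφ : Function.Surjective φ)
    (P : Fin (r + 1) → Ideal B) (hP : StrictMono P) (hp : ∀ j, (P j).IsPrime)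
    (hQ : ∀ a : A, φ (C a) ∈ P (Fin.last r) → a = 0) : r ≤ h := by
  let K := FractionRing A
  let M : Submonoid (MvPolynomial (Fin h) A) := (nonZeroDivisors A).map (C (σ := Fin h))
  have hloc : IsLocalization M (MvPolynomial (Fin h) K) := inferInstance
  have hd : ∀ j, Disjoint (M : Set (MvPolynomial (Fin h) A)) ((P j).comap φ : Ideal _) := by
    intro j
    rw [Set.disjoint_left]
    rintro _ ⟨a, ha, rfl⟩ h2
    have : φ (C a) ∈ P (Fin.last r) := hP.monotone (Fin.le_last j) h2
    exact nonZeroDivisors.ne_zero ha (hQ a this)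
  let e := IsLocalization.orderIsoOfPrime M (MvPolynomial (Fin h) K)
  let g : Fin (r + 1) → PrimeSpectrum (MvPolynomial (Fin h) K) := fun j =>
    (PrimeSpectrum.equivSubtype _).symm (e.symm ⟨(P j).comap φ, (hp j).comap φ, hd j⟩)
  have hg : StrictMono g := by
    intro i j hij
    refine (PrimeSpectrum.equivSubtype _).symm.strictMono (e.symm.strictMono ?_)
    have : (P i).comap φ < (P j).comap φ := by
      refine lt_of_le_not_ge (Ideal.comap_mono (hP hij).le) fun hle => ?_
      exact (hP hij).not_ge ((Ideal.comap_le_comap_iff_of_surjective φ hφ _ _).mp hle)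
    exact this
  have h1 := Order.LTSeries.length_le_krullDim (LTSeries.mk r g hg)
  have h2 : ringKrullDim (MvPolynomial (Fin h) K) = h := by
    rw [MvPolynomial.ringKrullDim_of_isNoetherianRing]
    simp
  change (r : WithBot ℕ∞) ≤ ringKrullDim _ at h1
  rw [h2] at h1
  exact_mod_cast h1

/-- kill the first `j` chosen variables -/
noncomputable def killV {k ι : Type*} [Field k] {r : ℕ} (v : Fin r → ι) (j : ℕ) :
    MvPolynomial ι k →ₐ[k] MvPolynomial ι k := by
  classical
  exact aeval fun i => if ∃ a : Fin r, a.1 < j ∧ v a = i then 0 else X i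

lemma vars_le_dim {k ι A : Type*} [Field k] [CommRing A] [IsDomain A] {h r : ℕ}
    (φ : MvPolynomial (Fin h) A →+* MvPolynomial ι k) (hφ : Function.Surjective φ)
    (Q : Ideal (MvPolynomial ι k)) (v : Fin r → ι) (hv : Function.Injective v)
    (hvQ : ∀ a, X (v a) ∈ Q)
    (hQ : ∀ a : A, φ (C a) ∈ Q → a = 0) : r ≤ h := by
  classical
  have hX : ∀ j i, killV (k := k) v j (X i) = if ∃ a : Fin r, a.1 < j ∧ v a = i then 0 else X i := by
    intro j i; simp [killV]
  have hcomp : ∀ i j, i ≤ j → ∀ x, killV (k := k) v j (killV v i x) = killV v j x := by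
    intro i j hij x
    have : (killV (k := k) v j).comp (killV v i) = killV v j := by
      apply MvPolynomial.algHom_ext
      intro l
      rw [AlgHom.comp_apply, hX, hX]
      split_ifs with h1 h2 h2
      · simp
      · obtain ⟨a, ha, rfl⟩ := h1
        exact absurd ⟨a, by omega, rfl⟩ h2
      · rw [hX, if_pos h2]
      · rw [hX, if_neg h2]
    exact DFunLike.congr_fun this x
  have hmono : Monotone fun j => RingHom.ker (killV (k := k) v j) := by
    intro i j hij x hx
    rw [RingHom.mem_ker] at hx ⊢
    rw [← hcomp i j hij, hx, map_zero]
  refine chain_le_dim φ hφ (fun j : Fin (r + 1) => RingHom.ker (killV (k := k) v j)) ?_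
    (fun j => RingHom.ker_isPrime _) ?_
  · intro i j hij
    refine lt_of_le_not_ge (hmono (by exact_mod_cast hij.le)) fun hle => ?_
    have hij' : i.1 < j.1 := hij
    let a : Fin r := ⟨i.1, by omega⟩
    have h1 : X (v a) ∈ RingHom.ker (killV (k := k) v j) := by
      rw [RingHom.mem_ker, hX, if_pos ⟨a, hij', rfl⟩]
    have h2 := hle h1
    rw [RingHom.mem_ker, hX, if_neg] at h2
    · exact X_ne_zero _ h2
    · rintro ⟨b, hb, hab⟩
      rw [hv hab] at hb
      exact lt_irrefl _ hb
  · intro a ha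
    apply hQ
    rw [RingHom.mem_ker] at ha
    have : (Ideal.Quotient.mkₐ k Q).comp (killV (k := k) v (Fin.last r).1) =
        Ideal.Quotient.mkₐ k Q := by
      apply MvPolynomial.algHom_ext
      intro l
      rw [AlgHom.comp_apply, hX]
      split_ifs with h1
      · obtain ⟨a, ha, rfl⟩ := h1
        rw [map_zero]
        exact (Ideal.Quotient.eq_zero_iff_mem.mpr (hvQ a)).symm
      · rfl
    have := DFunLike.congr_fun this (φ (C a))
    rw [AlgHom.comp_apply, ha, map_zero] at this
    exact Ideal.Quotient.eq_zero_iff_mem.mp this.symm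
end Piece4

section Piece5
open MvPolynomial

namespace GData
variable {k R J ι : Type*} [Field k] [CommRing R] [Algebra k R] {G : GData k R J}
  {u : ι → R} {w : ι → ℕ}

lemma inj_full [PerfectField k] [IsReduced R] [Nontrivial R] (hw : ∀ i, 0 < w i)
    (hu : ∀ i, u i ∈ G.S (w i))
    (hli : LinearIndependent k (fun i => G.Dec.mkQ (u i)))
    (hsp : ∀ e, 0 < e → ∀ x ∈ G.S e, G.Dec.mkQ x ∈ Submodule.span k (Set.range (G.Dec.mkQ ∘ u))) :
    Function.Injective (aeval u : MvPolynomial ι k →ₐ[k] R) := by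
  classical
  have hc : ∀ e (F : MvPolynomial ι k), aeval u (weightedHomogeneousComponent w e F) =
      G.π e (aeval u F) := by
    intro e F
    conv_lhs => rw [F.as_sum]
    conv_rhs => rw [F.as_sum]
    simp only [map_sum]
    refine Finset.sum_congr rfl fun m _ => ?_
    have hC := isWeightedHomogeneous_monomial (R := k) w m (coeff m F) rfl
    by_cases h : Finsupp.weight w m = e
    · subst h
      rw [hC.weightedHomogeneousComponent_same, G.π_same (psi_mem hu hC)]
    · rw [hC.weightedHomogeneousComponent_ne _ (Ne.symm h), G.π_ne (psi_mem hu hC) h, map_zero]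
  rw [injective_iff_map_eq_zero]
  intro F hF
  ext m
  have h1 := inj hw hu hli hsp _ _
    (weightedHomogeneousComponent_isWeightedHomogeneous (w := w) (Finsupp.weight w m) F)
    (by rw [hc, hF, map_zero])
  have h2 := congrArg (coeff m) h1
  rwa [coeff_weightedHomogeneousComponent, if_pos rfl] at h2

theorem main_bound [PerfectField k] [IsDomain R] {r h : ℕ} (G : GData k R J)
    (f : Fin r → R) (d : Fin r → ℕ) (hd : ∀ i, 0 < d i) (hf : ∀ i, f i ∈ G.S (d i))
    (hfli : LinearIndependent k (fun i => G.Dec.mkQ (f i)))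
    (AS : Subalgebra k R) (y : Fin h → R) (hy : ∀ j, y j ∈ G.S 1)
    (hdec : ∀ e, ∀ x ∈ G.S (e + 1), ∃ a ∈ AS, a ∈ G.S (e + 1) ∧ ∃ s : Fin h → R,
      (∀ j, s j ∈ G.S e) ∧ x = a + ∑ j, y j * s j)
    (Q : Ideal R) (hfQ : ∀ i, f i ∈ Q) (hQ : ∀ a ∈ AS, a ∈ Q → a = 0) : r ≤ h := by
  classical
  have hfinj : Function.Injective f := by
    intro a b hab
    exact hfli.injective (by simp [hab])
  let t : Set R := {x | ∃ e, 0 < e ∧ x ∈ G.S e}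
  obtain ⟨b, hbt, hfb, hspan, hbli⟩ := exists_linearIndepOn_extension
    (K := k) (v := G.Dec.mkQ) (s := Set.range f) (t := t)
    ((linearIndepOn_range_iff hfinj _).mpr hfli)
    (by rintro _ ⟨i, rfl⟩; exact ⟨d i, hd i, hf i⟩)
  choose w hw hu using fun i : b => hbt i.2
  let u : b → R := Subtype.val
  have hu : ∀ i : b, u i ∈ G.S (w i) := hu
  have hsp : ∀ e, 0 < e → ∀ x ∈ G.S e, G.Dec.mkQ x ∈
      Submodule.span k (Set.range (G.Dec.mkQ ∘ u)) := by
    intro e he x hx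
    have := hspan ⟨x, ⟨e, he, hx⟩, rfl⟩
    rwa [Set.range_comp, Subtype.range_coe]
  have hli : LinearIndependent k (fun i => G.Dec.mkQ (u i)) := hbli
  have hinj := inj_full hw hu hli hsp
  let ψ : MvPolynomial b k →ₐ[k] R := aeval u
  let A := AS.comap ψ
  choose y' hy'1 hy'2 using fun j => gen hu hsp 1 (y j) (hy j)
  let φ : MvPolynomial (Fin h) A →ₐ[A] MvPolynomial b k := aeval y'
  have hsurj0 : ∀ e, ∀ F : MvPolynomial b k, F.IsWeightedHomogeneous w e → F ∈ φ.range := by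
    intro e
    induction e with
    | zero =>
      intro F hF
      rw [whom_zero hw hF]
      have : C (coeff 0 F) ∈ A := A.algebraMap_mem _
      exact φ.range.algebraMap_mem ⟨_, this⟩
    | succ e ih =>
      intro F hF
      obtain ⟨a, haA, haS, s, hs, hx⟩ := hdec e _ (psi_mem hu hF)
      obtain ⟨a', ha', rfl⟩ := gen hu hsp _ a haS
      choose s' hs'1 hs'2 using fun j => gen hu hsp e (s j) (hs j)
      have : F = a' + ∑ j, y' j * s' j := by
        apply hinj
        rw [hx]
        simp [hy'2, hs'2]
      rw [this]
      refine add_mem (φ.range.algebraMap_mem ⟨a', haA⟩) (sum_mem fun j _ => MulMemClass.mul_mem ?_ (ih _ (hs'1 j)))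
      exact ⟨X j, by simp [φ]⟩
  have hsurj : Function.Surjective φ := by
    intro F
    change F ∈ φ.range
    rw [F.as_sum]
    exact sum_mem fun m _ => hsurj0 _ _ (isWeightedHomogeneous_monomial w m _ rfl)
  refine vars_le_dim φ.toRingHom hsurj (Q.comap ψ) (fun i => (⟨f i, hfb ⟨i, rfl⟩⟩ : b)) ?_ ?_ ?_
  · intro a c hac
    exact hfinj (congrArg Subtype.val hac)
  · intro a
    rw [Ideal.mem_comap]
    simpa [ψ, u] using hfQ a
  · intro a ha
    have h1 : ψ a.1 ∈ Q := by
      simpa [φ, Algebra.algebraMap_eq_smul_one, Subalgebra.smul_def] using ha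
    have h2 := hQ _ a.2 h1
    apply Subtype.ext
    apply hinj
    simpa using h2

end GData
end Piece5

section Piece6
open MvPolynomial

/-- translation of polynomials in direction `c` -/
noncomputable def trl {k σ : Type*} [Field k] (c : σ → k) :
    MvPolynomial σ k →+* PowerSeries (MvPolynomial σ k) :=
  eval₂Hom ((PowerSeries.C).comp C)
    (fun i => PowerSeries.C (X i) + PowerSeries.C (C (c i)) * PowerSeries.X)

section trl
variable {k σ : Type*} [Field k]

lemma trl_C (c : σ → k) (a : k) : trl c (C a) = PowerSeries.C (C a) := by simp [trl]

lemma trl_X (c : σ → k) (i : σ) :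
    trl c (X i) = PowerSeries.C (X i) + PowerSeries.C (C (c i)) * PowerSeries.X := by simp [trl]

lemma trl_HP (c : σ → k) {F : MvPolynomial σ k} {e : ℕ} (hF : F.IsHomogeneous e) :
    GData.HP (1 : σ → ℕ) e (trl c F) := by
  refine GData.HP.whom _ (trl_C c) ?_ hF
  intro i n
  rw [trl_X]
  rcases n with _ | _ | n
  · refine ⟨fun _ => ?_, fun h => by simp at h⟩
    simpa using isWeightedHomogeneous_X k (1 : σ → ℕ) i
  · refine ⟨fun _ => ?_, fun h => by simp at h⟩
    simpa [PowerSeries.coeff_C] using isWeightedHomogeneous_C (1 : σ → ℕ) (c i)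
  · refine ⟨fun h => by simp at h, fun _ => ?_⟩
    simp [PowerSeries.coeff_C, PowerSeries.coeff_X]

lemma trl_zero (c : σ → k) (F : MvPolynomial σ k) : PowerSeries.coeff 0 (trl c F) = F := by
  have : (PowerSeries.constantCoeff).comp (trl c) = RingHom.id _ := by
    apply MvPolynomial.ringHom_ext
    · intro a; simp [trl_C]
    · intro i; simp [trl_X]
  simpa using RingHom.congr_fun this F

/-- replace the variable `j` by the power series variable -/
noncomputable def spc [DecidableEq σ] (j : σ) :
    MvPolynomial σ k →+* PowerSeries (MvPolynomial σ k) :=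
  eval₂Hom ((PowerSeries.C).comp C)
    (fun i => if i = j then PowerSeries.X else PowerSeries.C (X i))

lemma spc_monomial [DecidableEq σ] (j : σ) (d : σ →₀ ℕ) (c : k) :
    spc j (monomial d c) = PowerSeries.C (monomial (d.erase j) c) * PowerSeries.X ^ (d j) := by
  rw [spc, coe_eval₂Hom, eval₂_monomial, ← Finsupp.mul_prod_erase' d j _ (by simp)]
  have : (d.erase j).prod (fun i n => (if i = j then PowerSeries.X else
      PowerSeries.C (X i : MvPolynomial σ k)) ^ n) =
      PowerSeries.C ((d.erase j).prod fun i n => (X i : MvPolynomial σ k) ^ n) := by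
    rw [Finsupp.prod, Finsupp.prod, map_prod]
    refine Finset.prod_congr rfl fun i hi => ?_
    rw [if_neg, map_pow]
    rintro rfl
    simp at hi
  rw [this, monomial_eq, map_mul, if_pos rfl]
  simp only [RingHom.comp_apply]
  ring

lemma spc_coeff [DecidableEq σ] (j : σ) (F : MvPolynomial σ k) (d : σ →₀ ℕ) :
    coeff (d.erase j) (PowerSeries.coeff (d j) (spc j F)) = coeff d F := by
  conv_lhs => rw [F.as_sum]
  conv_rhs => rw [F.as_sum]
  simp only [map_sum, coeff_sum]
  refine Finset.sum_congr rfl fun m _ => ?_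
  rw [spc_monomial, PowerSeries.coeff_C_mul, PowerSeries.coeff_X_pow]
  by_cases h : m = d
  · subst h; simp
  · rw [coeff_monomial, if_neg h]
    by_cases h1 : d j = m j
    · rw [if_pos h1, mul_one, coeff_monomial, if_neg]
      intro h2
      apply h
      ext i
      by_cases hi : i = j
      · rw [hi, h1]
      · have := DFunLike.congr_fun h2 i
        simpa [Finsupp.erase_ne hi] using this
    · simp [if_neg h1]

lemma trl_inv {F : MvPolynomial σ k} {e : ℕ} (hF : F.IsHomogeneous e) (he : 0 < e)
    (h : ∀ c n, 0 < n → n ≤ e → PowerSeries.coeff n (trl c F) = 0) : F = 0 := by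
  classical
  have hT : ∀ c, trl c F = PowerSeries.C F := by
    intro c
    ext1 n
    rcases Nat.eq_zero_or_pos n with rfl | hn
    · rw [trl_zero]; simp
    rw [PowerSeries.coeff_C, if_neg hn.ne']
    by_cases hne : n ≤ e
    · exact h c n hn hne
    · exact (trl_HP c hF n).2 (by omega)
  ext d
  by_contra hd
  rw [coeff_zero] at hd
  have hd0 : d ≠ 0 := by
    rintro rfl
    have := hF hd
    simp at this; omega
  obtain ⟨j, hj⟩ := Finsupp.ne_iff.mp hd0
  have hcomp : ((PowerSeries.map (eval₂Hom C (fun i => if i = j then 0 else X i) :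
      MvPolynomial σ k →+* MvPolynomial σ k)).comp (trl (Pi.single j 1))) = spc j := by
    apply MvPolynomial.ringHom_ext
    · intro a; simp [trl_C, spc]
    · intro i
      by_cases hi : i = j
      · subst hi; simp [trl_X, spc]
      · simp [trl_X, spc, hi]
  have h1 := RingHom.congr_fun hcomp F
  rw [RingHom.comp_apply, hT, PowerSeries.map_C] at h1
  apply hd
  rw [← spc_coeff j, ← h1, PowerSeries.coeff_C, if_neg (by simpa using hj), coeff_zero]
end trl
end Piece6

section Piece7
open MvPolynomial Filter

/-- `ρ` presents `R` as the ultraproduct of the rings `A N`. -/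
structure IsUP (U : Ultrafilter ℕ) {A : ℕ → Type*} [∀ N, CommRing (A N)] {R : Type*} [CommRing R]
    (ρ : (∀ N, A N) →+* R) : Prop where
  surj : Function.Surjective ρ
  zero_iff : ∀ s, ρ s = 0 ↔ ∀ᶠ N in (U : Filter ℕ), s N = 0

namespace IsUP
section basic
variable {U : Ultrafilter ℕ} {A : ℕ → Type*} [∀ N, CommRing (A N)] {R : Type*} [CommRing R]
    {ρ : (∀ N, A N) →+* R}

lemma eq_iff (h : IsUP U ρ) (s t : ∀ N, A N) : ρ s = ρ t ↔ ∀ᶠ N in (U : Filter ℕ), s N = t N := by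
  rw [← sub_eq_zero, ← map_sub, h.zero_iff]
  simp [sub_eq_zero]

lemma isDomain (h : IsUP U ρ) [∀ N, IsDomain (A N)] : IsDomain R := by
  have : Nontrivial R := by
    refine ⟨1, 0, fun h1 => ?_⟩
    rw [← map_one ρ, h.zero_iff] at h1
    obtain ⟨N, hN⟩ := h1.exists
    exact one_ne_zero hN
  have : NoZeroDivisors R := by
    refine ⟨fun {a b} hab => ?_⟩
    obtain ⟨s, rfl⟩ := h.surj a
    obtain ⟨t, rfl⟩ := h.surj b
    rw [← map_mul, h.zero_iff] at hab
    rw [h.zero_iff, h.zero_iff, ← Ultrafilter.eventually_or]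
    exact hab.mono fun N hN => mul_eq_zero.mp hN
  exact NoZeroDivisors.to_isDomain R

end basic

lemma perfect {U : Ultrafilter ℕ} {k : ℕ → Type*} [∀ N, Field (k N)] [∀ N, PerfectField (k N)]
    {K : Type*} [Field K] {κ : (∀ N, k N) →+* K} (h : IsUP U κ) : PerfectField K := by
  obtain ⟨p, hp⟩ := CharP.exists K
  rcases CharP.char_is_prime_or_zero K p with hpp | rfl
  · have : Fact p.Prime := ⟨hpp⟩
    have : ExpChar K p := ExpChar.prime hpp
    have h0 : ∀ᶠ N in (U : Filter ℕ), ((p : ∀ N, k N)) N = 0 := by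
      rw [← h.zero_iff]; simp
    have : PerfectRing K p := by
      refine PerfectRing.ofSurjective K p fun x => ?_
      obtain ⟨s, rfl⟩ := h.surj x
      have hr : ∀ N, ∃ t : k N, (p : k N) = 0 → t ^ p = s N := by
        intro N
        by_cases hN : (p : k N) = 0
        · have : CharP (k N) p := by
            have := ringChar.charP (k N)
            have h2 := (ringChar.spec (k N) p).mp hN
            have h3 := (Nat.dvd_prime hpp).mp h2
            rcases h3 with h3 | h3
            · exact absurd h3 (CharP.ringChar_ne_one)
            · rwa [h3] at this
          have : ExpChar (k N) p := ExpChar.prime hpp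
          have : PerfectRing (k N) p := PerfectField.toPerfectRing p
          obtain ⟨t, ht⟩ := surjective_frobenius (k N) p (s N)
          exact ⟨t, fun _ => ht⟩
        · exact ⟨0, fun h => absurd h hN⟩
      choose t ht using hr
      refine ⟨κ t, ?_⟩
      rw [frobenius_def, ← map_pow, h.eq_iff]
      exact h0.mono fun N hN => ht N (by simpa using hN)
    exact PerfectRing.toPerfectField K p
  · have : CharZero K := CharP.charP_to_charZero K
    infer_instance

section main
variable {U : Ultrafilter ℕ} {k : ℕ → Type} [∀ N, Field (k N)] {n : ℕ → ℕ}
  {K : Type} [Field K] {κ : (∀ N, k N) →+* K}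
  {R : Type} [CommRing R] {ρ : (∀ N, MvPolynomial (Fin (n N)) (k N)) →+* R} [Algebra K R]

/-- lift of coordinatewise maps -/
noncomputable def lft (hρ : IsUP U ρ)
    (g : ∀ N, MvPolynomial (Fin (n N)) (k N) → MvPolynomial (Fin (n N)) (k N)) (x : R) : R :=
  ρ fun N => g N ((Function.surjInv hρ.surj x) N)

lemma lft_apply (hρ : IsUP U ρ)
    (g : ∀ N, MvPolynomial (Fin (n N)) (k N) → MvPolynomial (Fin (n N)) (k N))
    (s : ∀ N, MvPolynomial (Fin (n N)) (k N)) : lft hρ g (ρ s) = ρ fun N => g N (s N) := by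
  rw [lft, hρ.eq_iff]
  have := (hρ.eq_iff _ _).mp (Function.surjInv_eq hρ.surj (ρ s))
  exact this.mono fun N hN => by rw [hN]

/-- translations on the ultraproduct -/
noncomputable def tau (hρ : IsUP U ρ) (c : ∀ N, Fin (n N) → k N) : R →+* PowerSeries R :=
    { toFun := fun x => PowerSeries.mk fun m =>
        lft hρ (fun N F => PowerSeries.coeff m (trl (c N) F)) x
      map_one' := by
        ext m
        rw [PowerSeries.coeff_mk, ← map_one ρ, lft_apply, PowerSeries.coeff_one]
        simp only [Pi.one_apply, map_one, PowerSeries.coeff_one]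
        split_ifs
        · exact map_one ρ
        · exact map_zero ρ
      map_zero' := by
        ext m
        rw [PowerSeries.coeff_mk, ← map_zero ρ, lft_apply]
        simp only [Pi.zero_apply, map_zero]
        exact map_zero ρ
      map_add' := by
        intro x y
        obtain ⟨s, rfl⟩ := hρ.surj x
        obtain ⟨t, rfl⟩ := hρ.surj y
        ext m
        rw [map_add, PowerSeries.coeff_mk, PowerSeries.coeff_mk, PowerSeries.coeff_mk, ← map_add,
          lft_apply, lft_apply, lft_apply, ← map_add]
        congr 1
        ext1 N
        simp
      map_mul' := by
        intro x y
        obtain ⟨s, rfl⟩ := hρ.surj x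
        obtain ⟨t, rfl⟩ := hρ.surj y
        ext m
        rw [PowerSeries.coeff_mul]
        simp only [PowerSeries.coeff_mk]
        simp only [← map_mul, lft_apply, ← map_sum]
        congr 1
        ext1 N
        simp [PowerSeries.coeff_mul, Finset.sum_apply] }

lemma coeff_tau (hρ : IsUP U ρ) (c : ∀ N, Fin (n N) → k N) (m : ℕ)
    (s : ∀ N, MvPolynomial (Fin (n N)) (k N)) :
    PowerSeries.coeff m (tau hρ c (ρ s)) = ρ fun N => PowerSeries.coeff m (trl (c N) (s N)) := by
  simp only [tau, RingHom.coe_mk, MonoidHom.coe_mk, OneHom.coe_mk, PowerSeries.coeff_mk, lft_apply]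

/-- the graded structure on the ultraproduct -/
noncomputable def gdata (hκ : IsUP U κ) (hρ : IsUP U ρ)
    (halg : ∀ c, algebraMap K R (κ c) = ρ fun N => C (c N)) :
    GData K R (∀ N, Fin (n N) → k N) where
  S e :=
    { carrier := {x | ∃ s, ρ s = x ∧ ∀ N, (s N).IsHomogeneous e}
      zero_mem' := ⟨0, map_zero _, fun N => isHomogeneous_zero _ _ _⟩
      add_mem' := by
        rintro _ _ ⟨s, rfl, hs⟩ ⟨t, rfl, ht⟩
        exact ⟨s + t, map_add _ _ _, fun N => (hs N).add (ht N)⟩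
      smul_mem' := by
        rintro c _ ⟨s, rfl, hs⟩
        obtain ⟨c, rfl⟩ := hκ.surj c
        refine ⟨(fun N => C (c N)) * s, ?_, fun N => ?_⟩
        · rw [map_mul, ← halg, Algebra.smul_def]
        · simpa using (isHomogeneous_C _ (c N)).mul (hs N) }
  mul_mem := by
    rintro i j _ _ ⟨s, rfl, hs⟩ ⟨t, rfl, ht⟩
    exact ⟨s * t, map_mul _ _ _, fun N => (hs N).mul (ht N)⟩
  zero_ex := by
    rintro _ ⟨s, rfl, hs⟩
    refine ⟨κ fun N => coeff 0 (s N), ?_⟩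
    rw [halg]
    congr 1
    ext1 N
    exact (GData.whom_zero (fun _ => one_pos) (hs N)).symm
  alg_mem := by
    intro c
    obtain ⟨c, rfl⟩ := hκ.surj c
    exact ⟨_, (halg c).symm, fun N => isHomogeneous_C _ _⟩
  π e :=
    { toFun := lft hρ fun N => homogeneousComponent e
      map_add' := by
        intro x y
        obtain ⟨s, rfl⟩ := hρ.surj x
        obtain ⟨t, rfl⟩ := hρ.surj y
        rw [← map_add, lft_apply, lft_apply, lft_apply, ← map_add]
        congr 1
        ext1 N
        simp
      map_smul' := by
        intro c x
        obtain ⟨s, rfl⟩ := hρ.surj x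
        obtain ⟨c, rfl⟩ := hκ.surj c
        rw [RingHom.id_apply, Algebra.smul_def, Algebra.smul_def, halg, ← map_mul, lft_apply,
          lft_apply, ← map_mul]
        congr 1
        ext1 N
        simp [homogeneousComponent_C_mul] }
  π_same := by
    rintro e _ ⟨s, rfl, hs⟩
    change lft hρ _ _ = _
    rw [lft_apply]
    congr 1
    ext1 N
    rw [homogeneousComponent_of_mem (hs N), if_pos rfl]
  π_ne := by
    rintro e i _ ⟨s, rfl, hs⟩ hi
    change lft hρ _ _ = _
    rw [lft_apply, ← map_zero ρ]
    congr 1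
    ext1 N
    rw [homogeneousComponent_of_mem (hs N), if_neg (Ne.symm hi)]; rfl
  τ c := tau hρ c
  τ_alg := by
    intro j c
    obtain ⟨c, rfl⟩ := hκ.surj c
    ext m
    rw [halg]
    rw [coeff_tau, PowerSeries.coeff_C]
    split_ifs with h
    · subst h
      simp only [trl_zero]
    · rw [← map_zero ρ]
      congr 1
      ext1 N
      rw [trl_C, PowerSeries.coeff_C, if_neg h]; rfl
  τ_zero := by
    intro j x
    obtain ⟨s, rfl⟩ := hρ.surj x
    rw [coeff_tau]
    simp only [trl_zero]
  τ_mem := by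
    rintro j e m _ ⟨s, rfl, hs⟩ hm
    rw [coeff_tau]
    exact ⟨_, rfl, fun N => (trl_HP (j N) (hs N) m).1 hm⟩
  τ_gt := by
    rintro j e m _ ⟨s, rfl, hs⟩ hm
    rw [coeff_tau, ← map_zero ρ]
    congr 1
    ext1 N
    exact (trl_HP (j N) (hs N) m).2 hm
  inv := by
    rintro e _ ⟨s, rfl, hs⟩ he h
    have h1 : ∀ N, ∃ c : Fin (n N) → k N,
        (∀ m, 0 < m → m ≤ e → PowerSeries.coeff m (trl c (s N)) = 0) → s N = 0 := by
      intro N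
      by_contra hcon
      push Not at hcon
      by_cases h0 : s N = 0
      · exact (hcon 0).2 h0
      · exact h0 (trl_inv (hs N) he fun c m hm hme => (hcon c).1 m hm hme)
    choose c hc using h1
    have h2 : ∀ m ∈ Finset.Icc 1 e, ∀ᶠ N in (U : Filter ℕ),
        PowerSeries.coeff m (trl (c N) (s N)) = 0 := by
      intro m hm
      rw [Finset.mem_Icc] at hm
      have := h c m (by omega)
      rw [coeff_tau, hρ.zero_iff] at this
      exact this
    rw [← Filter.eventually_all_finset] at h2
    rw [hρ.zero_iff]
    exact h2.mono fun N hN => hc N fun m hm hme => hN m (Finset.mem_Icc.mpr ⟨hm, hme⟩)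

end main
end IsUP
end Piece7

section Piece8
open MvPolynomial Filter

lemma split_vars {k σ : Type*} [Field k] {h : ℕ} (Z : Set σ) (y : Fin h → σ)
    (hy : ∀ i, i ∈ Z ∨ ∃ j, y j = i) {e : ℕ} {F : MvPolynomial σ k} (hF : F.IsHomogeneous (e + 1)) :
    ∃ a ∈ supported k Z, a.IsHomogeneous (e + 1) ∧ ∃ s : Fin h → MvPolynomial σ k,
      (∀ j, (s j).IsHomogeneous e) ∧ F = a + ∑ j, X (y j) * s j := by
  classical
  have hF' : F.IsWeightedHomogeneous (1 : σ → ℕ) (e + 1) := hF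
  clear hF
  induction hF' using IsWeightedHomogeneous.induction_on with
  | zero => exact ⟨0, zero_mem _, isHomogeneous_zero _ _ _, 0, fun j => isHomogeneous_zero _ _ _,
      by simp⟩
  | add p q hp hq h1 h2 =>
    obtain ⟨a, ha, ha', s, hs, rfl⟩ := h1
    obtain ⟨b, hb, hb', t, ht, rfl⟩ := h2
    refine ⟨a + b, add_mem ha hb, ha'.add hb', s + t, fun j => (hs j).add (ht j), ?_⟩
    simp only [Pi.add_apply, mul_add, Finset.sum_add_distrib]
    ring
  | monomial d c hd =>
    by_cases hZ : ∀ i ∈ d.support, i ∈ Z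
    · refine ⟨monomial d c, ?_, isWeightedHomogeneous_monomial _ _ _ hd, 0,
        fun j => isHomogeneous_zero _ _ _, by simp⟩
      rw [mem_supported]
      intro i hi
      by_cases hc : c = 0
      · simp [hc] at hi
      · rw [vars_monomial hc] at hi
        exact hZ i hi
    · push Not at hZ
      obtain ⟨i, hi, hiZ⟩ := hZ
      obtain ⟨j, rfl⟩ := (hy i).resolve_left hiZ
      obtain ⟨d', rfl⟩ : ∃ d', d = Finsupp.single (y j) 1 + d' := by
        refine exists_add_of_le ?_
        rw [Finsupp.single_le_iff]
        have := Finsupp.mem_support_iff.mp hi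
        omega
      refine ⟨0, zero_mem _, isHomogeneous_zero _ _ _, Pi.single j (monomial d' c), ?_, ?_⟩
      · intro l
        by_cases hl : l = j
        · subst hl
          rw [Pi.single_eq_same]
          refine isWeightedHomogeneous_monomial _ _ _ ?_
          rw [map_add, Finsupp.weight_single] at hd
          simp at hd
          omega
        · rw [Pi.single_eq_of_ne hl]
          exact isHomogeneous_zero _ _ _
      · rw [Finset.sum_eq_single j]
        · rw [Pi.single_eq_same, zero_add, X, monomial_mul, one_mul]
        · intro l _ hl
          rw [Pi.single_eq_of_ne hl, mul_zero]
        · simp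

namespace GData
variable {k R J : Type*} [Field k] [CommRing R] [Algebra k R]

lemma dec_sum (G : GData k R J) (e : ℕ) {x : R} (hx : x ∈ G.Dec) :
    ∃ (ι : Type) (_ : Fintype ι) (g h : ι → R), (∀ i, ∃ a, 0 < a ∧ g i ∈ G.S a) ∧
      (∀ i, ∃ a, 0 < a ∧ h i ∈ G.S a) ∧ G.π e x = ∑ i, g i * h i := by
  induction hx using Submodule.span_induction with
  | mem x hx =>
    obtain ⟨i, j, a, b, hi, hj, ha, hb, rfl⟩ := hx
    by_cases hij : i + j = e
    · refine ⟨Unit, inferInstance, fun _ => a, fun _ => b, fun _ => ⟨i, hi, ha⟩,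
        fun _ => ⟨j, hj, hb⟩, ?_⟩
      have := G.mul_mem ha hb
      rw [hij] at this
      rw [G.π_same this]
      simp
    · refine ⟨Empty, inferInstance, fun _ => a, fun _ => b, fun _ => ⟨i, hi, ha⟩,
        fun _ => ⟨j, hj, hb⟩, ?_⟩
      rw [G.π_ne (G.mul_mem ha hb) hij]
      simp
  | zero => exact ⟨Empty, inferInstance, fun _ => 0, fun _ => 0, fun i => i.elim,
      fun i => i.elim, by simp⟩
  | add x y _ _ h1 h2 =>
    obtain ⟨ι, _, g, h, hg, hh, h1⟩ := h1
    obtain ⟨ι', _, g', h', hg', hh', h2⟩ := h2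
    refine ⟨ι ⊕ ι', inferInstance, Sum.elim g g', Sum.elim h h', ?_, ?_, ?_⟩
    · rintro (i | i)
      · exact hg i
      · exact hg' i
    · rintro (i | i)
      · exact hh i
      · exact hh' i
    · rw [map_add, h1, h2]; simp
  | smul c x _ h1 =>
    obtain ⟨ι, _, g, h, hg, hh, h1⟩ := h1
    refine ⟨ι, inferInstance, fun i => c • g i, h, ?_, hh, ?_⟩
    · intro i
      obtain ⟨a, ha, ha'⟩ := hg i
      exact ⟨a, ha, Submodule.smul_mem _ _ ha'⟩
    · rw [map_smul, h1, Finset.smul_sum]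
      simp
end GData

namespace IsUP
variable {U : Ultrafilter ℕ} {k : ℕ → Type} [∀ N, Field (k N)] {n : ℕ → ℕ}
  {K : Type} [Field K] {κ : (∀ N, k N) →+* K}
  {R : Type} [CommRing R] {ρ : (∀ N, MvPolynomial (Fin (n N)) (k N)) →+* R} [Algebra K R]

lemma up_linindep (hU : (U : Filter ℕ) ≤ atTop) (hκ : IsUP U κ) (hρ : IsUP U ρ)
    (halg : ∀ c, algebraMap K R (κ c) = ρ fun N => C (c N)) {r : ℕ} (d : Fin r → ℕ)
    (f : ∀ N, Fin r → MvPolynomial (Fin (n N)) (k N)) (hf : ∀ N i, (f N i).IsHomogeneous (d i))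
    (hs : ∀ N, CollectiveStrengthGE N d (f N)) :
    LinearIndependent K (fun i => (gdata hκ hρ halg).Dec.mkQ (ρ fun N => f N i)) := by
  classical
  set G := gdata hκ hρ halg with hG
  have hfS : ∀ i, (ρ fun N => f N i) ∈ G.S (d i) := fun i => ⟨_, rfl, fun N => hf N i⟩
  rw [Fintype.linearIndependent_iff]
  intro c hc
  by_contra hcon
  push Not at hcon
  obtain ⟨i0, hi0⟩ := hcon
  have hmem : (∑ i, c i • (ρ fun N => f N i)) ∈ G.Dec := by
    rw [← Submodule.ker_mkQ G.Dec, LinearMap.mem_ker, map_sum, ← hc]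
    simp
  obtain ⟨ι, _, g, h, hg, hh, heq⟩ := G.dec_sum (d i0) hmem
  choose ct hct using fun i => hκ.surj (c i)
  have hg' : ∀ l, ∃ (t : ∀ N, MvPolynomial (Fin (n N)) (k N)), ρ t = g l ∧
      ∃ a, 0 < a ∧ ∀ N, (t N).IsHomogeneous a := by
    intro l
    obtain ⟨a, ha, t, ht, ht'⟩ := hg l
    exact ⟨t, ht, a, ha, ht'⟩
  have hh' : ∀ l, ∃ (t : ∀ N, MvPolynomial (Fin (n N)) (k N)), ρ t = h l ∧
      ∃ a, 0 < a ∧ ∀ N, (t N).IsHomogeneous a := by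
    intro l
    obtain ⟨a, ha, t, ht, ht'⟩ := hh l
    exact ⟨t, ht, a, ha, ht'⟩
  choose gt hgt hgt' using hg'
  choose ht hht hht' using hh'
  let c' : ∀ N, Fin r → k N := fun N i => if d i = d i0 then ct i N else 0
  have h1 : G.π (d i0) (∑ i, c i • (ρ fun N => f N i)) =
      ρ fun N => ∑ i, C (c' N i) * f N i := by
    have : (fun N => ∑ i, C (c' N i) * f N i) =
        ∑ i, ((fun N => C (c' N i)) * (fun N => f N i) :
          ∀ N, MvPolynomial (Fin (n N)) (k N)) := by
      ext1 N
      simp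
    rw [this, map_sum, map_sum]
    refine Finset.sum_congr rfl fun i _ => ?_
    rw [map_smul, map_mul, ← hct, Algebra.smul_def, halg]
    by_cases hi : d i = d i0
    · have h2 := hfS i
      rw [hi] at h2
      rw [G.π_same h2]
      simp [c', hi]
    · rw [G.π_ne (hfS i) hi, mul_zero]
      have : (fun N => C (c' N i) : ∀ N, MvPolynomial (Fin (n N)) (k N)) = 0 := by
        ext1 N
        simp [c', hi]
      rw [this, map_zero, zero_mul]
  have h2 : ∑ l, g l * h l = ρ fun N => ∑ l, gt l N * ht l N := by
    have : (fun N => ∑ l, gt l N * ht l N) = ∑ l, gt l * ht l := by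
      ext1 N
      simp
    rw [this, map_sum]
    simp [hgt, hht]
  rw [h1, h2, hρ.eq_iff] at heq
  have h3 : ∀ᶠ N in (U : Filter ℕ), ct i0 N ≠ 0 := by
    rw [Ultrafilter.eventually_not, ← hκ.zero_iff, hct]
    exact hi0
  have h4 : ∀ᶠ N in (U : Filter ℕ), Fintype.card ι ≤ N := hU (eventually_ge_atTop _)
  obtain ⟨N, hN1, hN2, hN3⟩ := (heq.and (h3.and h4)).exists
  refine hs N (c' N) ?_ ?_ ?_
  · intro h0
    apply hN2
    simpa [c'] using congrFun h0 i0
  · intro i j hi hj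
    have : ∀ i, c' N i ≠ 0 → d i = d i0 := by
      intro i hi
      by_contra hne
      exact hi (by simp [c', hne])
    rw [this i hi, this j hj]
  · let eq := Fintype.equivFin ι
    refine ⟨Fintype.card ι, hN3, fun l => gt (eq.symm l) N, fun l => ht (eq.symm l) N, ?_, ?_, ?_⟩
    · intro l
      obtain ⟨a, ha, ha'⟩ := hgt' (eq.symm l)
      exact ⟨a, ha, ha' N⟩
    · intro l
      obtain ⟨a, ha, ha'⟩ := hht' (eq.symm l)
      exact ⟨a, ha, ha' N⟩
    · rw [hN1]
      exact (Equiv.sum_comp eq.symm (fun l => gt l N * ht l N)).symm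

lemma up_bound (hU : (U : Filter ℕ) ≤ atTop) [∀ N, PerfectField (k N)] (hκ : IsUP U κ)
    (hρ : IsUP U ρ)
    (halg : ∀ c, algebraMap K R (κ c) = ρ fun N => C (c N)) {r h : ℕ} (d : Fin r → ℕ)
    (hd : ∀ i, 0 < d i)
    (f : ∀ N, Fin r → MvPolynomial (Fin (n N)) (k N)) (hf : ∀ N i, (f N i).IsHomogeneous (d i))
    (hs : ∀ N, CollectiveStrengthGE N d (f N))
    (Z : ∀ N, Set (Fin (n N))) (y : ∀ N, Fin h → Fin (n N)) (hy : ∀ N i, i ∈ Z N ∨ ∃ j, y N j = i)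
    (Q : ∀ N, Ideal (MvPolynomial (Fin (n N)) (k N))) (hfQ : ∀ N i, f N i ∈ Q N)
    (hQ : ∀ N, ∀ F ∈ supported (k N) (Z N), F ∈ Q N → F = 0) : r ≤ h := by
  have : PerfectField K := hκ.perfect
  have : IsDomain R := hρ.isDomain
  let AS : Subalgebra K R :=
    { carrier := {x | ∃ s, ρ s = x ∧ ∀ N, s N ∈ supported (k N) (Z N)}
      mul_mem' := by
        rintro _ _ ⟨s, rfl, hs⟩ ⟨t, rfl, ht⟩
        exact ⟨s * t, map_mul _ _ _, fun N => mul_mem (hs N) (ht N)⟩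
      add_mem' := by
        rintro _ _ ⟨s, rfl, hs⟩ ⟨t, rfl, ht⟩
        exact ⟨s + t, map_add _ _ _, fun N => add_mem (hs N) (ht N)⟩
      algebraMap_mem' := by
        intro c
        obtain ⟨c, rfl⟩ := hκ.surj c
        exact ⟨_, (halg c).symm, fun N => (supported (k N) (Z N)).algebraMap_mem (c N)⟩ }
  let QS : Ideal R :=
    { carrier := {x | ∃ s, ρ s = x ∧ ∀ N, s N ∈ Q N}
      zero_mem' := ⟨0, map_zero _, fun N => zero_mem _⟩
      add_mem' := by
        rintro _ _ ⟨s, rfl, hs⟩ ⟨t, rfl, ht⟩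
        exact ⟨s + t, map_add _ _ _, fun N => add_mem (hs N) (ht N)⟩
      smul_mem' := by
        rintro c _ ⟨s, rfl, hs⟩
        obtain ⟨c, rfl⟩ := hρ.surj c
        exact ⟨c * s, map_mul _ _ _, fun N => Ideal.mul_mem_left _ _ (hs N)⟩ }
  refine GData.main_bound (gdata hκ hρ halg) (fun i => ρ fun N => f N i) d hd
    (fun i => ⟨_, rfl, fun N => hf N i⟩) (up_linindep hU hκ hρ halg d f hf hs) AS
    (fun j => ρ fun N => X (y N j)) (fun j => ⟨_, rfl, fun N => isHomogeneous_X _ _⟩) ?_ QS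
    (fun i => ⟨_, rfl, fun N => hfQ N i⟩) ?_
  · rintro e _ ⟨s, rfl, hs⟩
    choose a ha ha' t ht hst using fun N => split_vars (Z N) (y N) (hy N) (hs N)
    refine ⟨ρ a, ⟨a, rfl, ha⟩, ⟨a, rfl, ha'⟩, fun j => ρ fun N => t N j,
      fun j => ⟨_, rfl, fun N => ht N j⟩, ?_⟩
    simp only [← map_mul, ← map_sum, ← map_add]
    congr 1
    ext1 N
    rw [hst N]
    simp
  · rintro _ ⟨s, rfl, hs⟩ ⟨t, hst, ht⟩
    rw [hρ.eq_iff] at hst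
    rw [hρ.zero_iff]
    exact hst.mono fun N hN => hQ N _ (hs N) (hN ▸ ht N)

end IsUP

/-- the ideal of sequences vanishing `U`-almost everywhere -/
def upIdeal (U : Ultrafilter ℕ) (A : ℕ → Type) [∀ N, CommRing (A N)] : Ideal (∀ N, A N) where
  carrier := {s | ∀ᶠ N in (U : Filter ℕ), s N = 0}
  zero_mem' := by simp
  add_mem' := by
    intro s t hs ht
    filter_upwards [hs, ht] with N h1 h2
    simp [h1, h2]
  smul_mem' := by
    intro c s hs
    filter_upwards [hs] with N h1
    simp [h1]

lemma upIdeal_isUP (U : Ultrafilter ℕ) (A : ℕ → Type) [∀ N, CommRing (A N)] :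
    IsUP U (Ideal.Quotient.mk (upIdeal U A)) :=
  ⟨Ideal.Quotient.mk_surjective, fun _ => Ideal.Quotient.eq_zero_iff_mem⟩

lemma upIdeal_max (U : Ultrafilter ℕ) (k : ℕ → Type) [∀ N, Field (k N)] :
    (upIdeal U k).IsMaximal := by
  apply Ideal.Quotient.maximal_of_isField
  have hup := upIdeal_isUP U k
  have := hup.isDomain
  refine ⟨⟨0, 1, zero_ne_one⟩, mul_comm, fun {x} hx => ?_⟩
  obtain ⟨s, rfl⟩ := hup.surj x
  refine ⟨Ideal.Quotient.mk _ fun N => (s N)⁻¹, ?_⟩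
  rw [← map_mul, ← map_one (Ideal.Quotient.mk (upIdeal U k)), hup.eq_iff]
  rw [Ne, hup.zero_iff, ← Ultrafilter.eventually_not] at hx
  exact hx.mono fun N hN => mul_inv_cancel₀ hN

theorem key_thm (r h : ℕ) (hr : h < r) (d : Fin r → ℕ) (hd : ∀ i, 0 < d i) :
    ∃ N : ℕ, ∀ (k : Type) [Field k] [PerfectField k] (n : ℕ)
      (f : Fin r → MvPolynomial (Fin n) k),
      (∀ i, (f i).IsHomogeneous (d i)) → CollectiveStrengthGE N d f →
      ∀ (Z : Set (Fin n)) (y : Fin h → Fin n), (∀ i, i ∈ Z ∨ ∃ j, y j = i) →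
      ∀ Q : Ideal (MvPolynomial (Fin n) k), (∀ i, f i ∈ Q) →
      (∀ F ∈ supported k Z, F ∈ Q → F = 0) → False := by
  by_contra hcon
  push Not at hcon
  choose k hk hperf n f hf hs Z y hy Q hfQ hQ using hcon
  let U : Ultrafilter ℕ := hyperfilter ℕ
  have hU : (U : Filter ℕ) ≤ atTop := by
    rw [← Nat.cofinite_eq_atTop]; exact hyperfilter_le_cofinite
  have := upIdeal_max U k
  let : Field ((∀ N, k N) ⧸ upIdeal U k) := Ideal.Quotient.field _
  let Φ : (∀ N, k N) →+* (∀ N, MvPolynomial (Fin (n N)) (k N)) :=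
    RingHom.pi fun N => (C).comp (Pi.evalRingHom k N)
  let ρ := Ideal.Quotient.mk (upIdeal U fun N => MvPolynomial (Fin (n N)) (k N))
  let α := Ideal.Quotient.lift (upIdeal U k) (ρ.comp Φ) (by
    intro s hs
    change ρ _ = 0
    rw [(upIdeal_isUP U _).zero_iff]
    exact Filter.Eventually.mono hs fun N hN => by
      change C (s N) = 0
      rw [hN, map_zero])
  let := α.toAlgebra
  have := IsUP.up_bound (U := U) hU (upIdeal_isUP U k)
    (upIdeal_isUP U fun N => MvPolynomial (Fin (n N)) (k N)) (fun c => rfl) d hd f hf hs Z y hy Q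
    hfQ (fun N => (hQ N).1)
  omega
end Piece8

section Piece9
open MvPolynomial

section RR
open CategoryTheory Abelian Limits RingTheory.Sequence Pointwise IsSMulRegular

theorem hom_quot_aux {T : Type} [CommRing T] [IsNoetherianRing T] (N : ModuleCat.{0} T)
    (fs : List T) : ∀ (M : ModuleCat.{0} T), IsWeaklyRegular M fs →
    (∀ i ≤ fs.length, Subsingleton (Ext N M i)) →
    Subsingleton (N →ₗ[T] (M ⧸ (Ideal.ofList fs • ⊤ : Submodule T M))) := by
  induction fs with
  | nil =>
    intro M _ h
    have : Subsingleton (N ⟶ M) := Ext.addEquiv₀.subsingleton_congr.mp (h 0 (Nat.zero_le _))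
    have : Subsingleton (N →ₗ[T] M) := ModuleCat.homAddEquiv.symm.subsingleton
    have e : (M ⧸ (Ideal.ofList ([] : List T) • ⊤ : Submodule T M)) ≃ₗ[T] M :=
      Submodule.quotEquivOfEqBot _ (by simp)
    refine ⟨fun a b => ?_⟩
    have := Subsingleton.elim (e.toLinearMap ∘ₗ a) (e.toLinearMap ∘ₗ b)
    ext z
    exact e.injective (LinearMap.congr_fun this z)
  | cons x fs ih =>
    intro M hM h
    rw [isWeaklyRegular_cons_iff] at hM
    obtain ⟨hx, hM⟩ := hM
    have := ih (ModuleCat.of T (QuotSMulTop x M)) hM (by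
      intro i hi
      have zero1 := AddCommGrpCat.isZero_of_iff_subsingleton.mpr (h i (by simp; omega))
      have zero2 := AddCommGrpCat.isZero_of_iff_subsingleton.mpr (h (i + 1) (by simp; omega))
      exact AddCommGrpCat.subsingleton_of_isZero <| ShortComplex.Exact.isZero_of_both_zeros
        ((Ext.covariant_sequence_exact₃' N hx.smulShortComplex_shortExact) i (i + 1) rfl)
        (zero1.eq_zero_of_src _) (zero2.eq_zero_of_tgt _))
    have e := Submodule.quotOfListConsSMulTopEquivQuotSMulTopInner M x fs
    refine ⟨fun a b => ?_⟩
    have := Subsingleton.elim (e.toLinearMap ∘ₗ a) (e.toLinearMap ∘ₗ b)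
    ext z
    exact e.injective (LinearMap.congr_fun this z)

theorem lemR {T : Type} [CommRing T] [IsNoetherianRing T] (q : Ideal T) (hq : q ≠ ⊤)
    (ps fs : List T) (hps : ∀ p ∈ ps, p ∈ q) (wps : IsWeaklyRegular T ps)
    (wfs : IsWeaklyRegular T fs) (hlen : fs.length < ps.length) (x : T)
    (hx : ∀ a ∈ q, a * x ∈ Ideal.ofList fs) : x ∈ Ideal.ofList fs := by
  have hle : Ideal.ofList ps ≤ q := Ideal.span_le.mpr fun p hp => hps p hp
  have hlt : q • (⊤ : Submodule T T) < ⊤ := by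
    rw [smul_eq_mul, Ideal.mul_top]; exact hq.lt_top
  have hreg : IsRegular T ps := ⟨wps, by
    rw [smul_eq_mul, Ideal.mul_top]
    intro h
    exact hq (top_le_iff.mp (h.trans_le hle))⟩
  have hext := ModuleCat.subsingleton_ext_of_exists_isRegular q (ModuleCat.of T (T ⧸ q))
    (by
      show Module.support T (T ⧸ q) ⊆ _
      rw [Module.support_eq_zeroLocus, Ideal.annihilator_quotient]) (ModuleCat.of T T) hlt ps hps hreg
  have hs := hom_quot_aux (ModuleCat.of T (T ⧸ q)) fs (ModuleCat.of T T) wfs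
    (fun i hi => hext i (by omega))
  have hs' : Subsingleton ((T ⧸ q) →ₗ[T] (T ⧸ (Ideal.ofList fs • ⊤ : Submodule T T))) := hs
  let φ : (T ⧸ q) →ₗ[T] (T ⧸ (Ideal.ofList fs • ⊤ : Submodule T T)) :=
    Submodule.liftQ q (LinearMap.toSpanSingleton T _ (Submodule.Quotient.mk x)) (by
      intro a ha
      rw [LinearMap.mem_ker, LinearMap.toSpanSingleton_apply, ← Submodule.Quotient.mk_smul,
        Submodule.Quotient.mk_eq_zero, smul_eq_mul, smul_eq_mul, Ideal.mul_top]
      exact hx a ha)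
  have h0 : φ = 0 := Subsingleton.elim _ _
  have h1 := LinearMap.congr_fun h0 (Submodule.Quotient.mk 1)
  have h2 : (Submodule.Quotient.mk x : T ⧸ (Ideal.ofList fs • ⊤ : Submodule T T)) = 0 := by
    rw [← one_smul T (Submodule.Quotient.mk x)]
    exact h1
  rw [Submodule.Quotient.mk_eq_zero, smul_eq_mul, Ideal.mul_top] at h2
  exact h2
end RR
end Piece9

section Piece10
open MvPolynomial

section L2
open RingTheory.Sequence

theorem wr_snoc {T : Type*} [CommRing T] (fs : List T) (g : T) :
    IsWeaklyRegular T (fs ++ [g]) ↔ IsWeaklyRegular T fs ∧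
      ∀ u, g * u ∈ Ideal.ofList fs → u ∈ Ideal.ofList fs := by
  rw [isWeaklyRegular_append_iff, isWeaklyRegular_singleton_iff]
  refine and_congr_right fun _ => ?_
  have key : ∀ u : T, (Submodule.Quotient.mk u : T ⧸ (Ideal.ofList fs • ⊤ : Submodule T T)) = 0 ↔
      u ∈ Ideal.ofList fs := by
    intro u
    rw [Submodule.Quotient.mk_eq_zero, smul_eq_mul, Ideal.mul_top]
  rw [isSMulRegular_iff_right_eq_zero_of_smul]
  rw [(Submodule.mkQ_surjective _).forall]
  refine forall_congr' fun u => ?_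
  rw [Submodule.mkQ_apply, ← Submodule.Quotient.mk_smul, key, key, smul_eq_mul]

theorem wr_ringEquiv {S T : Type*} [CommRing S] [CommRing T] (e : S ≃+* T) (fs : List S) :
    IsWeaklyRegular S fs ↔ IsWeaklyRegular T (fs.map e) := by
  refine AddEquiv.isWeaklyRegular_congr (e := e.toAddEquiv) ?_
  refine List.forall₂_map_right_iff.mpr (List.forall₂_same.mpr fun r _ x => ?_)
  simp

theorem monic_reg {S : Type*} [CommRing S] (I : Ideal S) (g u : Polynomial S) (hg : g.Monic)
    (h : g * u ∈ I.map Polynomial.C) : u ∈ I.map Polynomial.C := by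
  have key : ∀ v : Polynomial S, v ∈ I.map Polynomial.C ↔ v.map (Ideal.Quotient.mk I) = 0 := by
    intro v
    rw [Ideal.mem_map_C_iff, Polynomial.ext_iff]
    simp [Polynomial.coeff_map, Ideal.Quotient.eq_zero_iff_mem]
  rw [key] at h ⊢
  rw [Polynomial.map_mul] at h
  exact (hg.map _).mul_right_eq_zero_iff.mp h

theorem lemL2 (K : Type) [Field K] : ∀ (h : ℕ) (P : Fin h → Polynomial K), (∀ j, (P j).Monic) →
    ∃ ps : List (MvPolynomial (Fin h) K), ps.length = h ∧ IsWeaklyRegular (MvPolynomial (Fin h) K) ps ∧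
      ∀ p ∈ ps, ∃ j, p = Polynomial.aeval (X j) (P j) := by
  intro h
  induction h with
  | zero =>
    intro P _
    exact ⟨[], rfl, IsWeaklyRegular.nil _ _, by simp⟩
  | succ h ih =>
    intro P hP
    obtain ⟨ps, hl, hw, hm⟩ := ih (fun j => P j.succ) (fun j => hP _)
    let S := MvPolynomial (Fin h) K
    let e := (finSuccEquiv K h)
    let g : Polynomial S := (P 0).map (algebraMap K S)
    have hw' : IsWeaklyRegular (Polynomial S) (ps.map (algebraMap S (Polynomial S)) ++ [g]) := by
      rw [wr_snoc]
      refine ⟨hw.of_flat, fun u hu => ?_⟩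
      rw [← Ideal.map_ofList] at hu ⊢
      exact monic_reg _ g u ((hP 0).map _) hu
    rw [wr_ringEquiv (e.symm : Polynomial S ≃+* MvPolynomial (Fin (h+1)) K)] at hw'
    refine ⟨_, ?_, hw', ?_⟩
    · simp [hl]
    · intro p hp
      rw [List.mem_map] at hp
      obtain ⟨q, hq, rfl⟩ := hp
      rw [List.mem_append] at hq
      rcases hq with hq | hq
      · rw [List.mem_map] at hq
        obtain ⟨q, hq, rfl⟩ := hq
        obtain ⟨j, rfl⟩ := hm q hq
        refine ⟨j.succ, ?_⟩
        show e.symm _ = _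
        rw [AlgEquiv.symm_apply_eq, ← Polynomial.aeval_algHom_apply e, finSuccEquiv_X_succ]
        exact (Polynomial.aeval_algHom_apply (IsScalarTower.toAlgHom K S (Polynomial S)) (X j) _).symm
      · rw [List.mem_singleton] at hq
        subst hq
        refine ⟨0, ?_⟩
        show e.symm _ = _
        rw [AlgEquiv.symm_apply_eq, ← Polynomial.aeval_algHom_apply e, finSuccEquiv_X_zero]
        rw [← Polynomial.aeval_map_algebraMap S, Polynomial.aeval_X_left_apply]
end L2
end Piece10

section Piece11
open MvPolynomial

section L1
open RingTheory.Sequence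
attribute [local instance] MvPolynomial.algebraMvPolynomial

theorem lemL1 (A : Type) [CommRing A] [IsDomain A] [IsNoetherianRing A] (h : ℕ)
    (Q : Ideal (MvPolynomial (Fin h) A)) (hQ : ∀ a, C a ∈ Q → a = 0)
    (hp : ∀ j, ∃ p : Polynomial A, p ≠ 0 ∧ Polynomial.aeval (X j) p ∈ Q)
    (fs : List (MvPolynomial (Fin h) A)) (wfs : IsWeaklyRegular (MvPolynomial (Fin h) A) fs)
    (x : MvPolynomial (Fin h) A) (hx : ∀ m, m ∈ Q ↔ m * x ∈ Ideal.ofList fs) :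
    h ≤ fs.length := by
  by_contra hlt
  push Not at hlt
  let K := FractionRing A
  let R := MvPolynomial (Fin h) A
  let T := MvPolynomial (Fin h) K
  let M : Submonoid R := (nonZeroDivisors A).map C
  have : IsLocalization M T := MvPolynomial.isLocalization (nonZeroDivisors A) K
  have hM : ∀ (I : Ideal R) (y : R), algebraMap R T y ∈ I.map (algebraMap R T) ↔
      ∃ a : A, a ≠ 0 ∧ C a * y ∈ I := by
    intro I y
    rw [IsLocalization.algebraMap_mem_map_algebraMap_iff M]
    constructor
    · rintro ⟨m, ⟨a, ha, rfl⟩, hm⟩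
      exact ⟨a, nonZeroDivisors.ne_zero ha, hm⟩
    · rintro ⟨a, ha, hm⟩
      exact ⟨C a, ⟨a, mem_nonZeroDivisors_of_ne_zero ha, rfl⟩, hm⟩
  have hq : Q.map (algebraMap R T) ≠ ⊤ := by
    intro h
    have : algebraMap R T 1 ∈ Q.map (algebraMap R T) := by rw [h]; trivial
    rw [hM] at this
    obtain ⟨a, ha, hm⟩ := this
    rw [mul_one] at hm
    exact ha (hQ a hm)
  have hmonic : ∀ j : Fin h, ∃ p : Polynomial K, p.Monic ∧
      Polynomial.aeval (X j : T) p ∈ Q.map (algebraMap R T) := by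
    intro j
    obtain ⟨p, hp0, hp⟩ := hp j
    have h0 : p.map (algebraMap A K) ≠ 0 := by
      rwa [Ne, Polynomial.map_eq_zero_iff (IsFractionRing.injective A K)]
    refine ⟨_, Polynomial.monic_mul_leadingCoeff_inv h0, ?_⟩
    rw [map_mul]
    refine Ideal.mul_mem_right _ _ ?_
    have : Polynomial.aeval (X j : T) (p.map (algebraMap A K)) = algebraMap R T (Polynomial.aeval (X j) p) := by
      rw [Polynomial.aeval_map_algebraMap]
      have h1 : (X j : T) = algebraMap R T (X j) := (MvPolynomial.map_X (algebraMap A K) j).symm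
      rw [h1, Polynomial.aeval_algebraMap_apply]
    rw [this]
    exact Ideal.mem_map_of_mem _ hp
  choose P hP1 hP2 using hmonic
  obtain ⟨ps, hl, hw, hm⟩ := lemL2 K h P hP1
  have hxx : algebraMap R T x ∈ Ideal.ofList (fs.map (algebraMap R T)) := by
    refine lemR (Q.map (algebraMap R T)) hq ps _ ?_ hw (wfs.of_isLocalization T M) ?_ _ ?_
    · intro p hp
      obtain ⟨j, rfl⟩ := hm p hp
      exact hP2 j
    · simp; omega
    · intro a ha
      rw [← Ideal.map_ofList]
      have : Q.map (algebraMap R T) ≤ Submodule.comap (LinearMap.mulRight T (algebraMap R T x))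
        ((Ideal.ofList fs).map (algebraMap R T)) := by
        rw [Ideal.map_le_iff_le_comap]
        intro m hm
        rw [Ideal.mem_comap, Submodule.mem_comap, LinearMap.mulRight_apply, ← map_mul]
        exact Ideal.mem_map_of_mem _ ((hx m).mp hm)
      exact this ha
  rw [← Ideal.map_ofList, hM] at hxx
  obtain ⟨a, ha, hm⟩ := hxx
  exact ha (hQ a ((hx _).mpr hm))
end L1
end Piece11

section Piece12
open MvPolynomial

section L0
open RingTheory.Sequence

theorem ofList_ringEquiv {S T : Type*} [CommRing S] [CommRing T] (e : S ≃+* T) (fs : List S) (u : S) :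
    u ∈ Ideal.ofList fs ↔ e u ∈ Ideal.ofList (fs.map e) := by
  have h := Ideal.map_ofList (e : S →+* T) fs
  have h' : Ideal.ofList (fs.map e) = (Ideal.ofList fs).map e := h.symm
  rw [h', Ideal.mem_map_of_equiv]
  constructor
  · intro hm
    exact ⟨_, hm, rfl⟩
  · rintro ⟨v, hv, hvu⟩
    rwa [← e.injective hvu]

theorem lemT (k : Type) [Field k] (n : ℕ) (Q : Ideal (MvPolynomial (Fin n) k)) (hQ : Q ≠ ⊤)
    (fs : List (MvPolynomial (Fin n) k)) (wfs : IsWeaklyRegular (MvPolynomial (Fin n) k) fs)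
    (x : MvPolynomial (Fin n) k) (hx : ∀ m, m ∈ Q ↔ m * x ∈ Ideal.ofList fs) :
    ∃ h ≤ fs.length, ∃ (Z : Set (Fin n)) (y : Fin h → Fin n), (∀ i, i ∈ Z ∨ ∃ j, y j = i) ∧
      (∀ F ∈ supported k Z, F ∈ Q → F = 0) := by
  classical
  obtain ⟨Z, hZ⟩ := Set.Finite.exists_maximal
    (s := {Z : Set (Fin n) | ∀ F ∈ supported k Z, F ∈ Q → F = 0}) (Set.toFinite _) ⟨∅, by
      intro F hF hFQ
      rw [supported_empty, Algebra.mem_bot] at hF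
      obtain ⟨c, rfl⟩ := hF
      by_contra hc
      have hc' : c ≠ 0 := by rintro rfl; simp at hc
      exact hQ (Ideal.eq_top_of_isUnit_mem _ hFQ ((isUnit_iff_ne_zero.mpr hc').map _))⟩
  have hZ1 : ∀ F ∈ supported k Z, F ∈ Q → F = 0 := hZ.prop
  let h := Fintype.card (Zᶜ : Set (Fin n))
  let ε : (Zᶜ : Set (Fin n)) ≃ Fin h := Fintype.equivFin _
  let σ : Fin n ≃ Fin h ⊕ Z :=
    (Equiv.Set.sumCompl Z).symm.trans ((Equiv.sumComm _ _).trans (Equiv.sumCongr ε (Equiv.refl _)))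
  have hσ1 : ∀ z : Z, σ z = Sum.inr z := by intro z; simp [σ]
  have hσ2 : ∀ z : (Zᶜ : Set (Fin n)), σ z = Sum.inl (ε z) := by intro z; simp [σ]
  let A := MvPolynomial Z k
  let e : MvPolynomial (Fin n) k ≃ₐ[k] MvPolynomial (Fin h) A :=
    (renameEquiv k σ).trans (sumAlgEquiv k (Fin h) Z)
  have he1 : ∀ z : Z, e (X (z : Fin n)) = C (X z) := by
    intro z; simp only [e, AlgEquiv.trans_apply, renameEquiv_apply, rename_X, hσ1]; exact sumAlgEquiv_X_inr ..
  have he2 : ∀ z : (Zᶜ : Set (Fin n)), e (X (z : Fin n)) = X (ε z) := by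
    intro z; simp only [e, AlgEquiv.trans_apply, renameEquiv_apply, rename_X, hσ2]; exact sumAlgEquiv_X_inl ..
  clear_value e
  have hle : h ≤ (fs.map e).length := by
    refine lemL1 A h (Q.comap (e.symm : _ →+* _)) ?_ ?_ (fs.map e) ?_ (e x) ?_
    · intro a ha
      rw [Ideal.mem_comap] at ha
      have h1 : e (rename (Subtype.val : Z → Fin n) a) = C a := by
        have : (e : _ →ₐ[k] _).comp (rename (Subtype.val : Z → Fin n)) =
            IsScalarTower.toAlgHom k A (MvPolynomial (Fin h) A) := by
          refine MvPolynomial.algHom_ext fun z => ?_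
          show e (rename (Subtype.val : Z → Fin n) (X z)) = C (X z)
          rw [rename_X, he1]
        exact DFunLike.congr_fun this a
      have h2 : e.symm (C a) = rename (Subtype.val : Z → Fin n) a := by
        rw [← h1, AlgEquiv.symm_apply_apply]
      have h3 := hZ1 (rename (Subtype.val : Z → Fin n) a) (by
        rw [supported_eq_range_rename]; exact ⟨a, rfl⟩) (by rw [← h2]; exact ha)
      exact rename_injective _ Subtype.val_injective (h3.trans (map_zero _).symm)
    · intro j
      obtain ⟨i, rfl⟩ := ε.surjective j
      have hi : ¬ ∀ F ∈ supported k (insert (i : Fin n) Z), F ∈ Q → F = 0 := by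
        intro hh
        exact i.2 (hZ.le_of_ge (y := insert (i : Fin n) Z) hh (Set.subset_insert _ _)
          (Set.mem_insert _ _))
      push Not at hi
      obtain ⟨F, hF, hFQ, hF0⟩ := hi
      let φ : Polynomial A →ₐ[k] MvPolynomial (Fin h) A :=
        (Polynomial.aeval (X (ε i)) : Polynomial A →ₐ[A] MvPolynomial (Fin h) A).restrictScalars k
      have hsub : supported k (insert (i : Fin n) Z) ≤ φ.range.comap (e : _ →ₐ[k] _) := by
        rw [supported, Algebra.adjoin_le_iff]
        rintro _ ⟨z, hz, rfl⟩
        rcases hz with rfl | hz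
        · exact ⟨Polynomial.X, by simp [φ, he2]⟩
        · exact ⟨Polynomial.C (X ⟨z, hz⟩), by simp [φ, he1 ⟨z, hz⟩, algebraMap_eq]⟩
      obtain ⟨p, hp⟩ := hsub hF
      have hp' : Polynomial.aeval (X (ε i)) p = e F := hp
      refine ⟨p, ?_, ?_⟩
      · rintro rfl
        rw [map_zero] at hp'
        exact hF0 (e.injective (hp'.symm.trans (map_zero e).symm))
      · rw [hp', Ideal.mem_comap]
        show e.symm (e F) ∈ Q
        rwa [AlgEquiv.symm_apply_apply]
    · exact (wr_ringEquiv e.toRingEquiv fs).mp wfs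
    · intro m
      rw [Ideal.mem_comap]
      show e.symm m ∈ Q ↔ _
      rw [hx]
      have h1 := ofList_ringEquiv e.toRingEquiv fs (e.symm m * x)
      have h2 : e.toRingEquiv (e.symm m * x) = m * e x := by
        show e (e.symm m * x) = m * e x
        rw [map_mul, AlgEquiv.apply_symm_apply]
      rw [h2] at h1
      exact h1
  refine ⟨h, by simpa using hle, Z, fun j => (ε.symm j : Fin n), ?_, hZ1⟩
  intro i
  by_cases hi : i ∈ Z
  · exact Or.inl hi
  · exact Or.inr ⟨ε ⟨i, hi⟩, by simp⟩
end L0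
end Piece12

section Piece13
open MvPolynomial

section Fin
open RingTheory.Sequence

theorem csge_mono {k : Type} [Field k] {σ : Type} {r : ℕ} {N N' : ℕ} (h : N' ≤ N)
    (d : Fin r → ℕ) (f : Fin r → MvPolynomial σ k) (H : CollectiveStrengthGE N d f) :
    CollectiveStrengthGE N' d f := by
  intro c hc hh ⟨m, hm, g⟩
  exact H c hc hh ⟨m, hm.trans h, g⟩

theorem csge_init {k : Type} [Field k] {σ : Type} {r : ℕ} {N : ℕ}
    (d : Fin (r+1) → ℕ) (f : Fin (r+1) → MvPolynomial σ k) (H : CollectiveStrengthGE N d f) :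
    CollectiveStrengthGE N (fun i => d (Fin.castSucc i)) (fun i => f (Fin.castSucc i)) := by
  intro c hc hh hs
  refine H (Fin.snoc (α := fun _ => k) c 0) ?_ ?_ ?_
  · intro h0
    apply hc
    funext i
    have := congrFun h0 (Fin.castSucc i)
    simpa using this
  · intro i j
    refine Fin.lastCases ?_ (fun i => ?_) i
    · intro h; simp at h
    · refine Fin.lastCases ?_ (fun j => ?_) j
      · intro _ h; simp at h
      · simpa using hh i j
  · rw [Fin.sum_univ_castSucc]
    simpa using hs

theorem assoc_aux (k : Type) [Field k] (n : ℕ) (fs : List (MvPolynomial (Fin n) k))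
    (g u : MvPolynomial (Fin n) k) (hu : g * u ∈ Ideal.ofList fs) (hu' : u ∉ Ideal.ofList fs) :
    ∃ (Q : Ideal (MvPolynomial (Fin n) k)) (x : MvPolynomial (Fin n) k), Q ≠ ⊤ ∧ g ∈ Q ∧
      ∀ m, m ∈ Q ↔ m * x ∈ Ideal.ofList fs := by
  have key : ∀ m x : MvPolynomial (Fin n) k,
      m ∈ (⊥ : Submodule (MvPolynomial (Fin n) k) (MvPolynomial (Fin n) k ⧸ Ideal.ofList fs)).colon
        {Ideal.Quotient.mk _ x} ↔ m * x ∈ Ideal.ofList fs := by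
    intro m x
    rw [Submodule.mem_colon_singleton, Submodule.mem_bot, ← Ideal.Quotient.eq_zero_iff_mem,
      map_mul]
    rfl
  have h0 : Ideal.Quotient.mk (Ideal.ofList fs) u ≠ 0 := by
    rwa [Ne, Ideal.Quotient.eq_zero_iff_mem]
  obtain ⟨Q, hQ, hle⟩ := exists_le_isAssociatedPrime_of_isNoetherianRing
    (MvPolynomial (Fin n) k) (Ideal.Quotient.mk (Ideal.ofList fs) u) h0
  rw [isAssociatedPrime_iff] at hQ
  obtain ⟨hp, x, hx⟩ := hQ
  obtain ⟨x, rfl⟩ := Ideal.Quotient.mk_surjective x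
  refine ⟨Q, x, hp.ne_top, hle ((key g u).mpr hu), fun m => ?_⟩
  rw [hx, key]

theorem weak_thm (r : ℕ) : ∀ (d : Fin r → ℕ) (_ : ∀ i, 0 < d i),
    ∃ N : ℕ, ∀ (k : Type) [Field k] [PerfectField k] (n : ℕ)
      (f : Fin r → MvPolynomial (Fin n) k),
      (∀ i, (f i).IsHomogeneous (d i)) →
      CollectiveStrengthGE N d f →
      IsWeaklyRegular (MvPolynomial (Fin n) k) (List.ofFn f) := by
  induction r with
  | zero =>
    intro d hd
    refine ⟨0, fun k _ _ n f _ _ => ?_⟩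
    rw [List.ofFn_zero]
    exact IsWeaklyRegular.nil _ _
  | succ r ih =>
    intro d hd
    obtain ⟨N0, hN0⟩ := ih (fun i => d (Fin.castSucc i)) (fun i => hd _)
    have hk := fun h : Fin (r+1) => key_thm (r+1) h h.2 d hd
    choose N1 hN1 using hk
    refine ⟨max N0 (Finset.univ.sup N1), fun k _ _ n f hf hs => ?_⟩
    have h1 := hN0 k n (fun i => f (Fin.castSucc i)) (fun i => hf _)
      (csge_init d f (csge_mono (le_max_left _ _) d f hs))
    rw [List.ofFn_succ', List.concat_eq_append, wr_snoc]
    refine ⟨h1, fun u hu => ?_⟩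
    by_contra hu'
    obtain ⟨Q, x, hQ, hg, hx⟩ := assoc_aux k n _ _ u hu hu'
    obtain ⟨h, hle, Z, y, hy, hZ⟩ := lemT k n Q hQ _ h1 x hx
    rw [List.length_ofFn] at hle
    have hlt : h < r + 1 := by omega
    refine hN1 ⟨h, hlt⟩ k n f hf (csge_mono ?_ d f hs) Z y hy Q ?_ hZ
    · exact (Finset.le_sup (f := N1) (Finset.mem_univ _)).trans (le_max_right _ _)
    · intro i
      refine Fin.lastCases hg (fun i => ?_) i
      rw [hx]
      refine Ideal.mul_mem_right _ _ (Ideal.subset_span ?_)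
      exact List.mem_ofFn.mpr ⟨i, rfl⟩

theorem final_thm (r : ℕ) (d : Fin r → ℕ) (hd : ∀ i, 0 < d i) :
    ∃ N : ℕ, ∀ (k : Type) [Field k] [PerfectField k] (n : ℕ)
      (f : Fin r → MvPolynomial (Fin n) k),
      (∀ i, (f i).IsHomogeneous (d i)) →
      CollectiveStrengthGE N d f →
      RingTheory.Sequence.IsRegular (MvPolynomial (Fin n) k) (List.ofFn f) := by
  obtain ⟨N, hN⟩ := weak_thm r d hd
  refine ⟨N, fun k _ _ n f hf hs => ⟨hN k n f hf hs, ?_⟩⟩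
  rw [smul_eq_mul, Ideal.mul_top]
  intro h
  have hle : Ideal.ofList (List.ofFn f) ≤ RingHom.ker (constantCoeff (R := k) (σ := Fin n)) := by
    refine Ideal.span_le.mpr ?_
    intro p hp
    obtain ⟨i, rfl⟩ := List.mem_ofFn.mp hp
    rw [SetLike.mem_coe, RingHom.mem_ker, constantCoeff_eq]
    by_contra hc
    have := hf i hc
    rw [map_zero] at this
    exact (hd i).ne this
  have h1 : (1 : MvPolynomial (Fin n) k) ∈ RingHom.ker (constantCoeff (R := k) (σ := Fin n)) :=
    hle (h ▸ Submodule.mem_top)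
  rw [RingHom.mem_ker, map_one] at h1
  exact one_ne_zero h1
end Fin
end Piece13

/-- Theorem (Stillman-type bound): given degrees `d₁,…,d_r` there is `N` such that over any
perfect field and in any number of variables, homogeneous polynomials of these degrees with
collective strength at least `N` form a regular sequence. -/
theorem stmt19 (r : ℕ) (d : Fin r → ℕ) (hd : ∀ i, 0 < d i) :
    ∃ N : ℕ, ∀ (k : Type) [Field k] [PerfectField k] (n : ℕ)
      (f : Fin r → MvPolynomial (Fin n) k),
      (∀ i, (f i).IsHomogeneous (d i)) →
      CollectiveStrengthGE N d f →
      RingTheory.Sequence.IsRegular (MvPolynomial (Fin n) k) (List.ofFn f) := by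
  exact final_thm r d hd
end
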